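/- arXiv:1912.03875 — 9 statements merged into one kernel-verified Lean document; each statement's English description precedes it below -/
import Mathlib

section
/- Let S be a finite set of points in ℝ² in general linear position (no three points of S are collinear). Then the image V₂²(S) of S under the degree-2 Veronese map is a neighborly point set in ℝ⁵: for every nonempty subset T ⊆ S with |T| ≤ 2 there exist a ∈ ℝ⁵ with a ≠ 0 and c ∈ ℝ such that ⟨a, V₂²(t)⟩ = c for all t ∈ T and ⟨a, V₂²(s)⟩ < c for all s ∈ S \ T. -/
/-- The degree-2 Veronese map of the plane: `(x, y) ↦ (x², xy, y², x, y)`. -/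
noncomputable def V22 (p : Fin 2 → ℝ) : Fin 5 → ℝ :=
  ![p 0 ^ 2, p 0 * p 1, p 1 ^ 2, p 0, p 1]

/-- Three points of the plane whose orientation determinant vanishes, the first two of them
distinct, are collinear. -/
theorem collinear_of_det_eq_zero {p q s : Fin 2 → ℝ} (hpq : p ≠ q)
    (h : (q 1 - p 1) * (s 0 - p 0) - (q 0 - p 0) * (s 1 - p 1) = 0) :
    Collinear ℝ {p, q, s} := by
  have hd : (q 0 - p 0) ^ 2 + (q 1 - p 1) ^ 2 ≠ 0 := by
    intro h0
    apply hpq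
    ext i
    fin_cases i <;> simp <;> nlinarith [sq_nonneg (q 0 - p 0), sq_nonneg (q 1 - p 1)]
  rw [collinear_iff_of_mem (p₀ := p) (by simp)]
  refine ⟨q - p, ?_⟩
  rintro x (rfl | rfl | rfl)
  · exact ⟨0, by simp⟩
  · exact ⟨1, by simp⟩
  · refine ⟨((x 0 - p 0) * (q 0 - p 0) + (x 1 - p 1) * (q 1 - p 1)) /
      ((q 0 - p 0) ^ 2 + (q 1 - p 1) ^ 2), ?_⟩
    ext i
    fin_cases i <;> simp <;> field_simp
    · linear_combination (q 1 - p 1) * h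
    · linear_combination -(q 0 - p 0) * h

/-- Distinct points of an affinely independent family have nonvanishing orientation
determinant. -/
theorem det_ne_zero_of_affineIndependent {p q s : Fin 2 → ℝ} {U : Set (Fin 2 → ℝ)}
    (hU : AffineIndependent ℝ (fun t : U => (t : Fin 2 → ℝ)))
    (hp : p ∈ U) (hq : q ∈ U) (hs : s ∈ U) (hpq : p ≠ q) (hps : p ≠ s) (hqs : q ≠ s) :
    (q 1 - p 1) * (s 0 - p 0) - (q 0 - p 0) * (s 1 - p 1) ≠ 0 := by
  intro h
  have hinj : Function.Injective (![⟨p, hp⟩, ⟨q, hq⟩, ⟨s, hs⟩] : Fin 3 → U) := by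
    intro i j hij
    fin_cases i <;> fin_cases j <;> simp_all [eq_comm]
  have hind : AffineIndependent ℝ ![p, q, s] := by
    convert hU.comp_embedding ⟨_, hinj⟩ using 1
    ext i
    fin_cases i <;> rfl
  exact affineIndependent_iff_not_collinear_set.1 hind (collinear_of_det_eq_zero hpq h)

/-- If `S ⊆ ℝ²` is finite and in general linear position (no three points collinear,
i.e. every subset with at most 3 points is affinely independent), then `V₂²(S)` is a
neighborly point set in `ℝ⁵`. -/
theorem veronese2_neighborly (S : Finset (Fin 2 → ℝ))
    (hgen : ∀ T ⊆ S, T.card ≤ 3 →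
      AffineIndependent ℝ (fun t : (T : Set (Fin 2 → ℝ)) => (t : Fin 2 → ℝ))) :
    ∀ T ⊆ S, T.Nonempty → T.card ≤ 2 →
      ∃ (a : Fin 5 → ℝ) (c : ℝ), a ≠ 0 ∧
        (∀ t ∈ T, ∑ i, a i * V22 t i = c) ∧
        (∀ s ∈ S \ T, ∑ i, a i * V22 s i < c) := by
  classical
  intro T hT hne hcard
  have hpos := hne.card_pos
  obtain h1 | h2 : T.card = 1 ∨ T.card = 2 := by omega
  · obtain ⟨p, rfl⟩ := Finset.card_eq_one.1 h1
    refine ⟨![-1, 0, -1, 2 * p 0, 2 * p 1], p 0 ^ 2 + p 1 ^ 2, ?_, ?_, ?_⟩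
    · intro h
      simpa using congrFun h 0
    · simp [Fin.sum_univ_succ, V22]
      ring
    · intro s hs
      have hsp : s ≠ p := by simpa using (Finset.mem_sdiff.1 hs).2
      have hd : 0 < (s 0 - p 0) ^ 2 + (s 1 - p 1) ^ 2 := by
        by_contra! h0
        apply hsp
        ext i
        fin_cases i <;> simp <;> nlinarith [sq_nonneg (s 0 - p 0), sq_nonneg (s 1 - p 1)]
      simp [Fin.sum_univ_succ, V22]
      linarith
  · obtain ⟨p, q, hpq, rfl⟩ := Finset.card_eq_two.1 h2
    obtain ⟨A, hA⟩ : ∃ A, A = q 1 - p 1 := ⟨_, rfl⟩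
    obtain ⟨B, hB⟩ : ∃ B, B = p 0 - q 0 := ⟨_, rfl⟩
    obtain ⟨C, hC⟩ : ∃ C, C = -(A * p 0 + B * p 1) := ⟨_, rfl⟩
    have hsum : ∀ s : Fin 2 → ℝ,
        ∑ i, (![-A ^ 2, -2 * A * B, -B ^ 2, -2 * A * C, -2 * B * C] : Fin 5 → ℝ) i * V22 s i =
          C ^ 2 - (A * s 0 + B * s 1 + C) ^ 2 := by
      intro s
      simp [Fin.sum_univ_succ, V22]
      ring
    refine ⟨![-A ^ 2, -2 * A * B, -B ^ 2, -2 * A * C, -2 * B * C], C ^ 2, ?_, ?_, ?_⟩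
    · intro h
      have hA0 : A = 0 := by simpa using congrFun h 0
      have hB0 : B = 0 := by simpa using congrFun h 2
      apply hpq
      ext i
      fin_cases i <;> simp <;> linarith
    · intro t ht
      rw [hsum]
      obtain rfl | rfl : t = p ∨ t = q := by simpa using ht
      all_goals
        subst hC hA hB
        ring
    · intro s hs
      rw [hsum]
      obtain ⟨hsS, hsT⟩ := Finset.mem_sdiff.1 hs
      obtain ⟨hsp, hsq⟩ : s ≠ p ∧ s ≠ q := by simpa using hsT
      have hU : ({p, q, s} : Finset (Fin 2 → ℝ)) ⊆ S := by
        intro x hx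
        obtain rfl | rfl | rfl : x = p ∨ x = q ∨ x = s := by simpa using hx
        exacts [hT (by simp), hT (by simp), hsS]
      have hdet := det_ne_zero_of_affineIndependent (hgen _ hU Finset.card_le_three)
        (p := p) (q := q) (s := s) (by simp) (by simp) (by simp) hpq hsp.symm hsq.symm
      have hL : A * s 0 + B * s 1 + C ≠ 0 := by
        subst hC hA hB
        intro h
        exact hdet (by linear_combination h)
      have := pow_pos (abs_pos.2 hL) 2
      rw [sq_abs] at this
      linarith
end

section
/- Let m be a positive even integer and let S be a finite set of points in ℝ² such that no two distinct points of S lie on a common line through the origin. Then the image HV_m²(S) of S under the degree-m homogeneous Veronese map is a neighborly point set in ℝ^{m+1}: for every nonempty subset T ⊆ S with |T| ≤ m/2 there exist a ∈ ℝ^{m+1} with a ≠ 0 and c ∈ ℝ such that ⟨a, HV_m²(t)⟩ = c for all t ∈ T and ⟨a, HV_m²(s)⟩ < c for all s ∈ S \ T. -/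
/-- The degree-`m` homogeneous Veronese map of the plane:
`(x, y) ↦ (xᵐ, xᵐ⁻¹y, …, x yᵐ⁻¹, yᵐ)`. -/
noncomputable def HV2 (m : ℕ) (p : Fin 2 → ℝ) : Fin (m + 1) → ℝ :=
  fun i => p 0 ^ (m - (i : ℕ)) * p 1 ^ (i : ℕ)

/-- `f` is a binary form of degree `k` in the coordinates of the plane. -/
def IsBinaryForm (k : ℕ) (f : (Fin 2 → ℝ) → ℝ) : Prop :=
  ∃ a : ℕ → ℝ, ∀ p, f p = ∑ i ∈ Finset.range (k + 1), a i * (p 0 ^ (k - i) * p 1 ^ i)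

namespace IsBinaryForm

variable {k : ℕ} {f g : (Fin 2 → ℝ) → ℝ}

theorem add (hf : IsBinaryForm k f) (hg : IsBinaryForm k g) :
    IsBinaryForm k fun p => f p + g p := by
  obtain ⟨a, ha⟩ := hf
  obtain ⟨b, hb⟩ := hg
  exact ⟨fun i => a i + b i, fun p => by simp [ha, hb, add_mul, Finset.sum_add_distrib]⟩

theorem const_mul (c : ℝ) (hf : IsBinaryForm k f) : IsBinaryForm k fun p => c * f p := by
  obtain ⟨a, ha⟩ := hf
  exact ⟨fun i => c * a i, fun p => by simp [ha, Finset.mul_sum, mul_assoc]⟩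

theorem fst_mul (hf : IsBinaryForm k f) : IsBinaryForm (k + 1) fun p => p 0 * f p := by
  obtain ⟨a, ha⟩ := hf
  refine ⟨fun i => if i = k + 1 then 0 else a i, fun p => ?_⟩
  beta_reduce
  rw [Finset.sum_range_succ, ha, Finset.mul_sum]
  simp only [if_true, zero_mul, add_zero]
  refine Finset.sum_congr rfl fun i hi => ?_
  have hi' : i < k + 1 := Finset.mem_range.mp hi
  rw [if_neg hi'.ne, Nat.succ_sub (Nat.le_of_lt_succ hi'), pow_succ]
  ring

theorem snd_mul (hf : IsBinaryForm k f) : IsBinaryForm (k + 1) fun p => p 1 * f p := by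
  obtain ⟨a, ha⟩ := hf
  refine ⟨fun i => if i = 0 then 0 else a (i - 1), fun p => ?_⟩
  beta_reduce
  rw [Finset.sum_range_succ', ha, Finset.mul_sum]
  simp only [if_true, zero_mul, add_zero]
  refine Finset.sum_congr rfl fun i _ => ?_
  simp only [Nat.add_sub_add_right, Nat.add_sub_cancel, Nat.succ_ne_zero, if_false, pow_succ]
  ring

theorem linear_mul (a b : ℝ) (hf : IsBinaryForm k f) :
    IsBinaryForm (k + 1) fun p => (a * p 0 + b * p 1) * f p := by
  convert (hf.fst_mul.const_mul a).add (hf.snd_mul.const_mul b) using 2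
  ring

theorem normSq_pow (n : ℕ) : IsBinaryForm (2 * n) fun p => (p 0 ^ 2 + p 1 ^ 2) ^ n := by
  induction n with
  | zero => exact ⟨fun _ => 1, fun p => by simp⟩
  | succ n ih =>
    convert ih.fst_mul.fst_mul.add ih.snd_mul.snd_mul using 1
    · ring
    · ext p
      ring

theorem prod_sq_mul (T : Finset (Fin 2 → ℝ)) (hf : IsBinaryForm k f) :
    IsBinaryForm (2 * T.card + k) fun p => (∏ t ∈ T, (t 1 * p 0 + -t 0 * p 1) ^ 2) * f p := by
  classical
  induction T using Finset.induction_on with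
  | empty => simpa using hf
  | insert t T ht ih =>
    convert (ih.linear_mul (t 1) (-t 0)).linear_mul (t 1) (-t 0) using 1
    · rw [Finset.card_insert_of_notMem ht]
      ring
    · ext p
      rw [Finset.prod_insert ht]
      ring

theorem exists_eq_sum_HV2 (hf : IsBinaryForm k f) :
    ∃ a : Fin (k + 1) → ℝ, ∀ p, ∑ i, a i * HV2 k p i = f p := by
  obtain ⟨a, ha⟩ := hf
  exact ⟨fun i => a i, fun p => by
    rw [ha, ← Fin.sum_univ_eq_sum_range fun i => a i * (p 0 ^ (k - i) * p 1 ^ i)]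
    rfl⟩

end IsBinaryForm

/-- At most `m` points of the Veronese image lie on a common linear hyperplane. -/
theorem exists_ne_zero_sum_HV2_eq_zero {m : ℕ} {T : Finset (Fin 2 → ℝ)} (hT : T.card ≤ m) :
    ∃ a : Fin (m + 1) → ℝ, a ≠ 0 ∧ ∀ t ∈ T, ∑ i, a i * HV2 m t i = 0 := by
  let M : Matrix T (Fin (m + 1)) ℝ := fun t => HV2 m t
  have hker : LinearMap.ker M.mulVecLin ≠ ⊥ :=
    LinearMap.ker_ne_bot_of_finrank_lt (by simp; omega)
  obtain ⟨a, ha, ha0⟩ := Submodule.exists_mem_ne_zero_of_ne_bot hker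
  refine ⟨a, ha0, fun t ht => ?_⟩
  have := congrFun (LinearMap.mem_ker.mp ha) ⟨t, ht⟩
  rw [Matrix.mulVecLin_apply] at this
  simpa [M, Matrix.mulVec, dotProduct, mul_comm] using this

theorem det_ne_zero_of_linearIndependent_pair {p q : Fin 2 → ℝ}
    (h : LinearIndependent ℝ ![p, q]) : p 1 * q 0 + -p 0 * q 1 ≠ 0 := by
  have hdet : IsUnit (Matrix.of ![p, q]) := Matrix.linearIndependent_rows_iff_isUnit.mp h
  rw [Matrix.isUnit_iff_isUnit_det, isUnit_iff_ne_zero, Matrix.det_fin_two] at hdet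
  intro h0
  apply hdet
  simp
  linarith

/-- If `m` is a positive even integer and `S ⊆ ℝ²` is a finite set such that no two
distinct points of `S` lie on a common line through the origin (i.e. any two distinct
points of `S` are linearly independent), then `HV_m²(S)` is a neighborly point set in
`ℝ^{m+1}`. -/
theorem homogeneousVeronese2_neighborly (m : ℕ) (hm : 0 < m) (hmeven : Even m)
    (S : Finset (Fin 2 → ℝ))
    (hgen : ∀ p ∈ S, ∀ q ∈ S, p ≠ q → LinearIndependent ℝ ![p, q]) :
    ∀ T ⊆ S, T.Nonempty → T.card ≤ m / 2 →
      ∃ (a : Fin (m + 1) → ℝ) (c : ℝ), a ≠ 0 ∧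
        (∀ t ∈ T, ∑ i, a i * HV2 m t i = c) ∧
        (∀ s ∈ S \ T, ∑ i, a i * HV2 m s i < c) := by
  intro T hTS hT hcard
  rcases (S \ T).eq_empty_or_nonempty with hempty | ⟨s₀, hs₀⟩
  · obtain ⟨a, ha, hTa⟩ := exists_ne_zero_sum_HV2_eq_zero (hcard.trans (Nat.div_le_self m 2))
    exact ⟨a, 0, ha, hTa, by simp [hempty]⟩
  have hform := ((IsBinaryForm.normSq_pow (m / 2 - T.card)).prod_sq_mul T).const_mul (-1)
  have hdeg : 2 * T.card + 2 * (m / 2 - T.card) = m := by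
    have := Nat.two_mul_div_two_of_even hmeven
    omega
  rw [hdeg] at hform
  obtain ⟨a, ha⟩ := hform.exists_eq_sum_HV2
  have hneg : ∀ s ∈ S \ T, ∑ i, a i * HV2 m s i < 0 := by
    intro s hs
    obtain ⟨hsS, hsT⟩ := Finset.mem_sdiff.mp hs
    have hdet : ∀ t ∈ T, t 1 * s 0 + -t 0 * s 1 ≠ 0 := fun t ht =>
      det_ne_zero_of_linearIndependent_pair
        (hgen t (hTS ht) s hsS fun h => hsT (h ▸ ht))
    have hprod : 0 < ∏ t ∈ T, (t 1 * s 0 + -t 0 * s 1) ^ 2 :=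
      Finset.prod_pos fun t ht => sq_pos_of_ne_zero (hdet t ht)
    have hnorm : 0 < s 0 ^ 2 + s 1 ^ 2 := by
      obtain ⟨t, ht⟩ := hT
      by_contra! h
      have h0 : s 0 = 0 := by nlinarith [sq_nonneg (s 0), sq_nonneg (s 1)]
      have h1 : s 1 = 0 := by nlinarith [sq_nonneg (s 0), sq_nonneg (s 1)]
      exact hdet t ht (by simp [h0, h1])
    rw [ha]
    have := mul_pos hprod (pow_pos hnorm (m / 2 - T.card))
    linarith
  refine ⟨a, 0, ?_, fun t ht => ?_, hneg⟩
  · rintro rfl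
    simpa using hneg s₀ hs₀
  · have hzero : ∏ u ∈ T, (u 1 * t 0 + -u 0 * t 1) ^ 2 = 0 :=
      Finset.prod_eq_zero ht (by ring)
    rw [ha, hzero]
    ring
end

section
/- Let S be a set of n points in ℝ² in general position with respect to conics, i.e., S is in general linear position and its image V₂²(S) under the degree-2 Veronese map is in general linear position in ℝ⁵. Then for every k with 0 ≤ k ≤ n − 5, the number of pairs (P, O), where P ⊆ S has exactly 5 elements and O is one of the two open half-spaces of ℝ⁵ bounded by the affine hyperplane spanned by V₂²(P), such that O contains exactly k of the points V₂²(s) with s ∈ S \ P, is exactly 2·C(k+2, 2)·C(n−k−3, 2). -/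
section LinearProgramming

variable {α E : Type*} [DecidableEq α] [NormedAddCommGroup E] [NormedSpace ℝ E]
  [FiniteDimensional ℝ E]

/-- Functionals `ev s` for `s ∈ S` such that values at any `d + 1` of them can be prescribed. -/
def Interpolates (ev : α → E →ₗ[ℝ] ℝ) (d : ℕ) (S : Finset α) : Prop :=
  ∀ U ⊆ S, U.card ≤ d + 1 → ∀ y : α → ℝ, ∃ g : E, ∀ u ∈ U, ev u g = y u

/-- `Q` is cut out of `T` by a supporting hyperplane. -/
def IsFace (ev : α → E →ₗ[ℝ] ℝ) (T Q : Finset α) : Prop :=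
  Q ⊆ T ∧ ∃ g : E, (∀ q ∈ Q, ev q g = 0) ∧ ∀ t ∈ T, t ∉ Q → 0 < ev t g

/-- The reduced cost at `p` of the vertex `P` of the linear program of minimizing `φ` over the
`g` with `ev t g ≥ 0` for `t ∈ T`, normalized by the sum of the values, is positive. -/
def PosCost (ev : α → E →ₗ[ℝ] ℝ) (T : Finset α) (φ : E →ₗ[ℝ] ℝ) (P : Finset α) (p : α) : Prop :=
  ∀ d : E, (∀ q ∈ P, q ≠ p → ev q d = 0) → ∑ t ∈ T, ev t d = 0 → 0 < ev p d → 0 < φ d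

/-- Genericity of the objective functional `φ`. -/
def GenericObjective (ev : α → E →ₗ[ℝ] ℝ) (d : ℕ) (T : Finset α) (φ : E →ₗ[ℝ] ℝ) : Prop :=
  ∀ Q ⊆ T, Q.card + 1 = d → ∃ g : E, (∀ q ∈ Q, ev q g = 0) ∧ ∑ t ∈ T, ev t g = 0 ∧ φ g ≠ 0

variable {ev : α → E →ₗ[ℝ] ℝ} {d : ℕ} {S T P Q : Finset α} {φ : E →ₗ[ℝ] ℝ}

omit [DecidableEq α] [FiniteDimensional ℝ E] in
lemma Interpolates.mono (h : Interpolates ev d S) (hT : T ⊆ S) : Interpolates ev d T :=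
  fun U hU => h U (hU.trans hT)

omit [DecidableEq α] [FiniteDimensional ℝ E] in
lemma Interpolates.surjective (h : Interpolates ev d S) (hP : P ⊆ S) (hc : P.card ≤ d + 1) :
    Function.Surjective (LinearMap.pi fun u : P => ev u) := by
  classical
  intro y
  obtain ⟨g, hg⟩ := h P hP hc fun a => if ha : a ∈ P then y ⟨a, ha⟩ else 0
  refine ⟨g, funext fun u => ?_⟩
  simp [hg u u.2]

omit [DecidableEq α] in
lemma Interpolates.eq_zero (h : Interpolates ev d S) (hE : Module.finrank ℝ E = d + 1)
    (hP : P ⊆ S) (hc : P.card = d + 1) {g : E} (hg : ∀ p ∈ P, ev p g = 0) : g = 0 := by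
  have hs := h.surjective hP hc.le
  have hi := (LinearMap.injective_iff_surjective_of_finrank_eq_finrank (by simp [hE, hc])).2 hs
  exact hi (by ext u; simp [hg u u.2])

omit [DecidableEq α] in
lemma exists_ne_zero_vanishing (ev : α → E →ₗ[ℝ] ℝ) (hE : Module.finrank ℝ E = d + 1)
    (hc : P.card = d) : ∃ g : E, g ≠ 0 ∧ ∀ p ∈ P, ev p g = 0 := by
  have hk : (LinearMap.pi fun u : P => ev u).ker ≠ ⊥ :=
    LinearMap.ker_ne_bot_of_finrank_lt (by simp [hE, hc])
  obtain ⟨g, hg, hg0⟩ := Submodule.exists_mem_ne_zero_of_ne_bot hk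
  exact ⟨g, hg0, fun p hp => congrFun (LinearMap.mem_ker.1 hg) ⟨p, hp⟩⟩

omit [DecidableEq α] in
lemma Interpolates.exists_smul_eq (h : Interpolates ev d S) (hE : Module.finrank ℝ E = d + 1)
    (hP : P ⊆ S) (hc : P.card = d) {g g' : E} (hg0 : g ≠ 0) (hg : ∀ p ∈ P, ev p g = 0)
    (hg' : ∀ p ∈ P, ev p g' = 0) : ∃ c : ℝ, c • g = g' := by
  set R := LinearMap.pi fun u : P => ev u with hR
  have hs : Function.Surjective R := h.surjective hP (by omega)
  have hrk := LinearMap.finrank_range_add_finrank_ker R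
  rw [LinearMap.range_eq_top.2 hs, finrank_top, hE] at hrk
  have h1 : Module.finrank ℝ R.ker = 1 := by
    simp [hc] at hrk
    omega
  have hmem : ∀ {x : E}, (∀ p ∈ P, ev p x = 0) → x ∈ R.ker := fun hx =>
    LinearMap.mem_ker.2 (funext fun u => hx u u.2)
  obtain ⟨c, hc⟩ := (finrank_eq_one_iff_of_nonzero' (⟨g, hmem hg⟩ : R.ker)
    (by simpa [Subtype.ext_iff] using hg0)).1 h1 ⟨g', hmem hg'⟩
  exact ⟨c, congrArg Subtype.val hc⟩

omit [DecidableEq α] in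
lemma exists_genericObjective (ev : α → E →ₗ[ℝ] ℝ) (hE : Module.finrank ℝ E = d + 1)
    (T : Finset α) : ∃ φ : E →ₗ[ℝ] ℝ, GenericObjective ev d T φ := by
  have key : ∀ Q : {Q // Q ∈ T.powerset.filter (fun Q => Q.card + 1 = d)},
      ∃ g : E, g ≠ 0 ∧ (∀ q ∈ Q.1, ev q g = 0) ∧ ∑ t ∈ T, ev t g = 0 := by
    rintro ⟨Q, hQ⟩
    have hc := (Finset.mem_filter.1 hQ).2
    have hk : ((LinearMap.pi fun u : Q => ev u).prod (∑ t ∈ T, ev t)).ker ≠ ⊥ :=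
      LinearMap.ker_ne_bot_of_finrank_lt (by simp [hE]; omega)
    obtain ⟨g, hg, hg0⟩ := Submodule.exists_mem_ne_zero_of_ne_bot hk
    have hg := LinearMap.mem_ker.1 hg
    refine ⟨g, hg0, fun p hp => congrFun (congrArg Prod.fst hg) ⟨p, hp⟩, ?_⟩
    simpa using congrArg Prod.snd hg
  choose g hg0 hg hsum using key
  obtain ⟨φ, hφ⟩ := Module.exists_dual_forall_apply_ne_zero (K := ℝ) g hg0
  refine ⟨φ, fun Q hQ hc => ?_⟩
  have hm : Q ∈ T.powerset.filter (fun Q => Q.card + 1 = d) := by simp [hQ, hc]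
  exact ⟨g ⟨Q, hm⟩, hg ⟨Q, hm⟩, hsum ⟨Q, hm⟩, hφ ⟨Q, hm⟩⟩

omit [DecidableEq α] [FiniteDimensional ℝ E] in
lemma GenericObjective.neg (h : GenericObjective ev d T φ) : GenericObjective ev d T (-φ) := by
  intro Q hQ hc
  obtain ⟨g, h1, h2, h3⟩ := h Q hQ hc
  exact ⟨g, h1, h2, by simpa using h3⟩

omit [FiniteDimensional ℝ E] in
/-- A facet carries a normalized supporting functional. -/
lemma IsFace.exists_normalized (h : IsFace ev T Q) (hlt : Q.card < T.card) :
    ∃ g : E, (∀ q ∈ Q, ev q g = 0) ∧ (∀ t ∈ T, t ∉ Q → 0 < ev t g) ∧ ∑ t ∈ T, ev t g = 1 := by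
  obtain ⟨-, g, hg, hpos⟩ := h
  have hnn : ∀ t ∈ T, 0 ≤ ev t g := fun t ht => by
    by_cases hq : t ∈ Q
    · exact (hg t hq).ge
    · exact (hpos t ht hq).le
  obtain ⟨t, ht, htQ⟩ := Finset.exists_mem_notMem_of_card_lt_card hlt
  have hs : 0 < ∑ t ∈ T, ev t g := Finset.sum_pos' hnn ⟨t, ht, hpos t ht htQ⟩
  refine ⟨(∑ t ∈ T, ev t g)⁻¹ • g, fun q hq => by simp [hg q hq], fun t ht htQ => ?_, ?_⟩
  · have := hpos t ht htQ
    rw [map_smul, smul_eq_mul]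
    positivity
  · simp only [map_smul, smul_eq_mul, ← Finset.mul_sum]
    exact inv_mul_cancel₀ hs.ne'

omit [DecidableEq α] [FiniteDimensional ℝ E] in
/-- Small perturbations keep positive values positive. -/
lemma exists_perturbation (ev : α → E →ₗ[ℝ] ℝ) (T : Finset α) (g x : E) :
    ∃ ε : ℝ, 0 < ε ∧ ∀ t ∈ T, 0 < ev t g → ε * |ev t x| < ev t g := by
  classical
  induction T using Finset.induction_on with
  | empty => exact ⟨1, one_pos, by simp⟩
  | insert a T ha ih =>
    obtain ⟨ε, hε, h⟩ := ih
    by_cases hpos : 0 < ev a g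
    · refine ⟨min ε (ev a g / (|ev a x| + 1)), by positivity, fun t ht htpos => ?_⟩
      rcases Finset.mem_insert.1 ht with rfl | ht
      · calc _ ≤ ev t g / (|ev t x| + 1) * |ev t x| := by gcongr; exact min_le_right _ _
          _ < ev t g / (|ev t x| + 1) * (|ev t x| + 1) := by gcongr; linarith
          _ = ev t g := by field_simp
      · exact lt_of_le_of_lt (by gcongr; exact min_le_left _ _) (h t ht htpos)
    · refine ⟨ε, hε, fun t ht htpos => ?_⟩
      rcases Finset.mem_insert.1 ht with rfl | ht
      · exact absurd htpos hpos
      · exact h t ht htpos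

/-- A vector annihilated by `P` and by the sum functional is zero, when `P` is a facet. -/
lemma Interpolates.eq_zero_of_isFace (h : Interpolates ev d T) (hE : Module.finrank ℝ E = d + 1)
    (hP : IsFace ev T P) (hc : P.card = d) (hT : d < T.card) {x : E}
    (hx : ∀ p ∈ P, ev p x = 0) (hs : ∑ t ∈ T, ev t x = 0) : x = 0 := by
  obtain ⟨g, hg, -, hg1⟩ := hP.exists_normalized (by omega)
  have hg0 : g ≠ 0 := by
    rintro rfl
    simp at hg1
  obtain ⟨c, rfl⟩ := h.exists_smul_eq hE hP.1 hc hg0 hg hx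
  simp only [map_smul, smul_eq_mul, ← Finset.mul_sum, hg1, mul_one] at hs
  simp [hs]

omit [FiniteDimensional ℝ E] in
/-- Each element of a facet gives an edge direction leaving it. -/
lemma Interpolates.exists_edge (h : Interpolates ev d T)
    (hP : IsFace ev T P) (hc : P.card = d) (hT : d < T.card) (p : α) :
    ∃ x : E, (∀ q ∈ P, ev q x = if q = p then 1 else 0) ∧ ∑ t ∈ T, ev t x = 0 := by
  obtain ⟨g, hg, -, hg1⟩ := hP.exists_normalized (by omega)
  obtain ⟨u, hu⟩ := h P hP.1 (by omega) fun q => if q = p then 1 else 0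
  refine ⟨u - (∑ t ∈ T, ev t u) • g, fun q hq => by simp [hu q hq, hg q hq], ?_⟩
  simp [← Finset.mul_sum, hg1]

lemma Interpolates.posCost_iff (h : Interpolates ev d T) (hE : Module.finrank ℝ E = d + 1)
    (hP : IsFace ev T P) (hc : P.card = d) (hT : d < T.card) {p : α} (hp : p ∈ P)
    {x : E} (hx : ∀ q ∈ P, q ≠ p → ev q x = 0) (hs : ∑ t ∈ T, ev t x = 0)
    (hpos : 0 < ev p x) : PosCost ev T φ P p ↔ 0 < φ x := by
  refine ⟨fun H => H x hx hs hpos, fun H y hy hys hypos => ?_⟩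
  have hz : y - (ev p y / ev p x) • x = 0 := by
    refine h.eq_zero_of_isFace hE hP hc hT (fun q hq => ?_) ?_
    · rcases eq_or_ne q p with rfl | hqp
      · simp [hpos.ne']
      · simp [hx q hq hqp, hy q hq hqp]
    · simp [← Finset.mul_sum, hs, hys]
  rw [sub_eq_zero.1 hz, map_smul, smul_eq_mul]
  positivity

lemma GenericObjective.apply_ne_zero (hφ : GenericObjective ev d T φ) (h : Interpolates ev d T)
    (hE : Module.finrank ℝ E = d + 1) (hP : IsFace ev T P) (hc : P.card = d) (hT : d < T.card)
    {p : α} (hp : p ∈ P) {x : E} (hx : ∀ q ∈ P, q ≠ p → ev q x = 0)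
    (hs : ∑ t ∈ T, ev t x = 0) (hpos : 0 < ev p x) : φ x ≠ 0 := by
  obtain ⟨y, hy, hys, hyφ⟩ := hφ (P.erase p) ((P.erase_subset p).trans hP.1)
    (by rw [Finset.card_erase_add_one hp, hc])
  intro h0
  have hz : y - (ev p y / ev p x) • x = 0 := by
    refine h.eq_zero_of_isFace hE hP hc hT (fun q hq => ?_) ?_
    · rcases eq_or_ne q p with rfl | hqp
      · simp [hpos.ne']
      · simp [hx q hq hqp, hy q (Finset.mem_erase.2 ⟨hqp, hq⟩)]
    · simp [← Finset.mul_sum, hs, hys]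
  rw [sub_eq_zero.1 hz, map_smul, h0, smul_zero] at hyφ
  exact hyφ rfl

lemma GenericObjective.posCost_neg_iff (hφ : GenericObjective ev d T φ)
    (h : Interpolates ev d T) (hE : Module.finrank ℝ E = d + 1) (hP : IsFace ev T P)
    (hc : P.card = d) (hT : d < T.card) {p : α} (hp : p ∈ P) :
    PosCost ev T (-φ) P p ↔ ¬ PosCost ev T φ P p := by
  obtain ⟨x, hx, hs⟩ := h.exists_edge hP hc hT p
  have hx' : ∀ q ∈ P, q ≠ p → ev q x = 0 := fun q hq hqp => by simp [hx q hq, hqp]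
  have hpos : 0 < ev p x := by simp [hx p hp]
  have hne := hφ.apply_ne_zero h hE hP hc hT hp hx' hs hpos
  rw [h.posCost_iff hE hP hc hT hp hx' hs hpos, h.posCost_iff hE hP hc hT hp hx' hs hpos]
  simp only [LinearMap.neg_apply, neg_pos, not_lt]
  exact ⟨le_of_lt, fun h => lt_of_le_of_ne h hne⟩

/-- The minimum of `φ` over the normalized functionals supporting `Q` exists. -/
lemma IsFace.exists_minimizer (h : Interpolates ev d T) (hE : Module.finrank ℝ E = d + 1)
    (hQ : IsFace ev T Q) (hlt : Q.card < T.card) (hT : d < T.card) (φ : E →ₗ[ℝ] ℝ) :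
    ∃ g : E, ((∀ q ∈ Q, ev q g = 0) ∧ (∀ t ∈ T, 0 ≤ ev t g) ∧ ∑ t ∈ T, ev t g = 1) ∧
      ∀ g' : E, (∀ q ∈ Q, ev q g' = 0) → (∀ t ∈ T, 0 ≤ ev t g') → ∑ t ∈ T, ev t g' = 1 →
        φ g ≤ φ g' := by
  set K : Set E :=
    {g | (∀ q ∈ Q, ev q g = 0) ∧ (∀ t ∈ T, 0 ≤ ev t g) ∧ ∑ t ∈ T, ev t g = 1} with hK
  have hcont : ∀ ψ : E →ₗ[ℝ] ℝ, Continuous ψ := fun ψ => ψ.continuous_of_finiteDimensional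
  have hclosed : IsClosed K := by
    have : K = (⋂ q ∈ Q, {g | ev q g = 0}) ∩ ((⋂ t ∈ T, {g | 0 ≤ ev t g}) ∩
        {g | ∑ t ∈ T, ev t g = 1}) := by
      ext g
      simp [hK]
    rw [this]
    refine .inter (isClosed_biInter fun q _ => isClosed_eq (hcont _) continuous_const)
      (.inter (isClosed_biInter fun t _ => isClosed_le continuous_const (hcont _))
        (isClosed_eq (continuous_finsetSum _ fun t _ => hcont _) continuous_const))
  have hbdd : Bornology.IsBounded K := by
    have hker : (LinearMap.pi fun u : T => ev u).ker = ⊥ := by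
      refine LinearMap.ker_eq_bot'.2 fun g hg => ?_
      obtain ⟨U, hU, hUc⟩ := Finset.exists_subset_card_eq (Nat.succ_le_of_lt hT)
      exact h.eq_zero hE hU hUc fun p hp => congrFun hg ⟨p, hU hp⟩
    obtain ⟨C, -, hC⟩ := LinearMap.exists_antilipschitzWith _ hker
    refine (hC.isBounded_preimage (Metric.isBounded_Icc (0 : T → ℝ) 1)).subset ?_
    rintro g ⟨-, hnn, hsum⟩
    refine ⟨fun t => hnn t t.2, fun t => ?_⟩
    have := Finset.single_le_sum (f := fun t => ev t g) hnn t.2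
    simpa [hsum] using this
  have hne : K.Nonempty := by
    obtain ⟨g, hg, hpos, hsum⟩ := hQ.exists_normalized hlt
    refine ⟨g, hg, fun t ht => ?_, hsum⟩
    by_cases hq : t ∈ Q
    · exact (hg t hq).ge
    · exact (hpos t ht hq).le
  obtain ⟨g, hg, hmin⟩ := (Metric.isCompact_of_isClosed_isBounded hclosed hbdd).exists_isMinOn hne
    (hcont φ).continuousOn
  exact ⟨g, hg, fun g' h1 h2 h3 => hmin ⟨h1, h2, h3⟩⟩

/-- Every face lies on a facet where all reduced costs off the face are positive. -/
lemma GenericObjective.exists_facet (hφ : GenericObjective ev d T φ)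
    (h : Interpolates ev d T) (hE : Module.finrank ℝ E = d + 1) (hQ : IsFace ev T Q)
    (hQd : Q.card ≤ d) (hT : d < T.card) :
    ∃ P, IsFace ev T P ∧ P.card = d ∧ Q ⊆ P ∧ ∀ p ∈ P, p ∉ Q → PosCost ev T φ P p := by
  obtain ⟨g, ⟨hgQ, hnn, hsum⟩, hmin⟩ := hQ.exists_minimizer h hE (by omega) hT φ
  have hg0 : g ≠ 0 := by
    rintro rfl
    simp at hsum
  set Z := T.filter fun t => ev t g = 0 with hZ
  have hmemZ : ∀ {t}, t ∈ Z ↔ t ∈ T ∧ ev t g = 0 := fun {t} => by simp [hZ]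
  have hpos : ∀ t ∈ T, t ∉ Z → 0 < ev t g := fun t ht htZ =>
    lt_of_le_of_ne (hnn t ht) fun h0 => htZ (hmemZ.2 ⟨ht, h0.symm⟩)
  have hQZ : Q ⊆ Z := fun q hq => hmemZ.2 ⟨hQ.1 hq, hgQ q hq⟩
  have hZle : Z.card ≤ d := by
    by_contra! hlt
    obtain ⟨U, hU, hUc⟩ := Finset.exists_subset_card_eq (Nat.succ_le_of_lt hlt)
    exact hg0 (h.eq_zero hE (hU.trans (Finset.filter_subset _ _)) hUc fun p hp =>
      (hmemZ.1 (hU hp)).2)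
  have hZge : d ≤ Z.card := by
    by_contra! hlt
    obtain ⟨U, hZU, hUT, hUc⟩ := Finset.exists_subsuperset_card_eq (n := d - 1)
      (Finset.filter_subset _ _ : Z ⊆ T) (Nat.le_sub_one_of_lt hlt) (by omega)
    obtain ⟨x, hx, hxs, hxφ⟩ := hφ U hUT (by omega)
    obtain ⟨ε, hε, hpert⟩ := exists_perturbation ev T g x
    have hle : ∀ c : ℝ, |c| = ε → φ g ≤ φ (g + c • x) := by
      intro c hc
      refine hmin _ (fun q hq => by simp [hgQ q hq, hx q (hZU (hQZ hq))]) (fun t ht => ?_) ?_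
      · by_cases htZ : t ∈ Z
        · simp [(hmemZ.1 htZ).2, hx t (hZU htZ)]
        · have h1 := hpert t ht (hpos t ht htZ)
          rw [← hc, ← abs_mul] at h1
          have h2 := neg_abs_le (c * ev t x)
          simp only [map_add, map_smul, smul_eq_mul]
          linarith
      · simp [Finset.sum_add_distrib, ← Finset.mul_sum, hsum, hxs]
    have h1 := hle ε (abs_of_pos hε)
    have h2 := hle (-ε) (by rw [abs_neg, abs_of_pos hε])
    simp only [map_add, map_smul, smul_eq_mul] at h1 h2
    have h3 : ε * φ x = 0 := by linarith
    exact (mul_ne_zero hε.ne' hxφ) h3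
  have hZc : Z.card = d := le_antisymm hZle hZge
  have hZF : IsFace ev T Z := ⟨Finset.filter_subset _ _, g, fun q hq => (hmemZ.1 hq).2, hpos⟩
  refine ⟨Z, hZF, hZc, hQZ, fun p hp hpQ x hx hxs hxp => ?_⟩
  obtain ⟨ε, hε, hpert⟩ := exists_perturbation ev T g x
  have hle : φ g ≤ φ (g + ε • x) := by
    refine hmin _ (fun q hq => ?_) (fun t ht => ?_) ?_
    · simp [hgQ q hq, hx q (hQZ hq) fun hqp => hpQ (hqp ▸ hq)]
    · by_cases htZ : t ∈ Z
      · rcases eq_or_ne t p with rfl | htp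
        · simp only [map_add, map_smul, smul_eq_mul, (hmemZ.1 htZ).2]
          positivity
        · simp [(hmemZ.1 htZ).2, hx t htZ htp]
      · have h1 := hpert t ht (hpos t ht htZ)
        have h2 := mul_le_mul_of_nonneg_left (neg_abs_le (ev t x)) hε.le
        simp only [map_add, map_smul, smul_eq_mul]
        linarith
    · simp [Finset.sum_add_distrib, ← Finset.mul_sum, hsum, hxs]
  simp only [map_add, map_smul, smul_eq_mul] at hle
  have hnn' : 0 ≤ φ x := nonneg_of_mul_nonneg_right (by linarith : 0 ≤ ε * φ x) hε
  exact lt_of_le_of_ne hnn' (hφ.apply_ne_zero h hE hZF hZc hT hp hx hxs hxp).symm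

/-- Positive reduced costs certify optimality, and the optimum is attained only once. -/
lemma Interpolates.eq_of_posCost (h : Interpolates ev d T) (hE : Module.finrank ℝ E = d + 1)
    (hT : d < T.card) (hP : IsFace ev T P) (hPd : P.card = d)
    (hpos : ∀ p ∈ P, p ∉ Q → PosCost ev T φ P p) {g g' : E} (hg : ∀ p ∈ P, ev p g = 0)
    (hgs : ∑ t ∈ T, ev t g = 1) (hg'Q : ∀ q ∈ Q, ev q g' = 0) (hg' : ∀ t ∈ T, 0 ≤ ev t g')
    (hgs' : ∑ t ∈ T, ev t g' = 1) (hle : φ g' ≤ φ g) : g' = g := by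
  choose x hx hxs using h.exists_edge hP hPd hT
  have hdec : g' - g - ∑ p ∈ P, ev p g' • x p = 0 := by
    refine h.eq_zero_of_isFace hE hP hPd hT (fun q hq => ?_) ?_
    · simp only [map_sub, map_sum, map_smul, smul_eq_mul, hx _ q hq, hg q hq]
      simp [hq]
    · simp only [map_sub, map_sum, map_smul, smul_eq_mul, Finset.sum_sub_distrib, hgs, hgs']
      rw [Finset.sum_comm]
      simp [← Finset.mul_sum, hxs]
  have hcost : ∀ p ∈ P, p ∉ Q → 0 < φ (x p) := fun p hp hpQ =>
    hpos p hp hpQ (x p) (fun q hq hqp => by simp [hx p q hq, hqp]) (hxs p) (by simp [hx p p hp])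
  have hnn : ∀ p ∈ P, 0 ≤ ev p g' * φ (x p) := fun p hp => by
    by_cases hpQ : p ∈ Q
    · simp [hg'Q p hpQ]
    · exact mul_nonneg (hg' p (hP.1 hp)) (hcost p hp hpQ).le
  have hval : φ g' - φ g = ∑ p ∈ P, ev p g' * φ (x p) := by
    have := congrArg φ (sub_eq_zero.1 hdec)
    simpa using this
  have hz : ∀ p ∈ P, ev p g' * φ (x p) = 0 :=
    (Finset.sum_eq_zero_iff_of_nonneg hnn).1
      (le_antisymm (by linarith) (Finset.sum_nonneg hnn))
  have hz' : ∀ p ∈ P, ev p g' = 0 := fun p hp => by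
    by_cases hpQ : p ∈ Q
    · exact hg'Q p hpQ
    · exact (mul_eq_zero.1 (hz p hp)).resolve_right (hcost p hp hpQ).ne'
  refine sub_eq_zero.1 (h.eq_zero_of_isFace hE hP hPd hT (fun p hp => ?_) ?_)
  · simp [hz' p hp, hg p hp]
  · simp [hgs, hgs']

lemma Interpolates.facet_unique (h : Interpolates ev d T) (hE : Module.finrank ℝ E = d + 1)
    (hT : d < T.card) {P₁ P₂ : Finset α} (h₁ : IsFace ev T P₁) (hc₁ : P₁.card = d)
    (hQ₁ : Q ⊆ P₁) (hp₁ : ∀ p ∈ P₁, p ∉ Q → PosCost ev T φ P₁ p) (h₂ : IsFace ev T P₂)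
    (hc₂ : P₂.card = d) (hQ₂ : Q ⊆ P₂) (hp₂ : ∀ p ∈ P₂, p ∉ Q → PosCost ev T φ P₂ p) :
    P₁ = P₂ := by
  obtain ⟨g₁, hz₁, hpos₁, hs₁⟩ := h₁.exists_normalized (by omega)
  obtain ⟨g₂, hz₂, hpos₂, hs₂⟩ := h₂.exists_normalized (by omega)
  have hnn : ∀ {P : Finset α} {g : E}, (∀ q ∈ P, ev q g = 0) → (∀ t ∈ T, t ∉ P → 0 < ev t g) →
      ∀ t ∈ T, 0 ≤ ev t g := fun {P g} hz hp t ht => by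
    by_cases hq : t ∈ P
    · exact (hz t hq).ge
    · exact (hp t ht hq).le
  have hg : g₁ = g₂ := by
    rcases le_total (φ g₁) (φ g₂) with hle | hle
    · exact h.eq_of_posCost hE hT h₂ hc₂ hp₂ hz₂ hs₂ (fun q hq => hz₁ q (hQ₁ hq))
        (hnn hz₁ hpos₁) hs₁ hle
    · exact (h.eq_of_posCost hE hT h₁ hc₁ hp₁ hz₁ hs₁ (fun q hq => hz₂ q (hQ₂ hq))
        (hnn hz₂ hpos₂) hs₂ hle).symm
  subst hg
  refine Finset.eq_of_subset_of_card_le (fun p hp => ?_) (by omega)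
  by_contra hp2
  exact (hpos₂ p (h₁.1 hp) hp2).ne' (hz₁ p hp)

end LinearProgramming

section Counting

variable {α : Type*} [DecidableEq α]

/-- Counting the `j`-subsets of `T` when each lies in exactly one interval `[N P, P]`. -/
lemma choose_eq_sum_of_intervals {T : Finset α} {F : Finset (Finset α)}
    {N : Finset α → Finset α} {d j : ℕ} (hF : ∀ P ∈ F, P ⊆ T ∧ P.card = d ∧ N P ⊆ P)
    (h : ∀ Q ⊆ T, Q.card = j → ∃! P, P ∈ F ∧ N P ⊆ Q ∧ Q ⊆ P) :
    T.card.choose j =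
      ∑ P ∈ F, if (N P).card ≤ j then (d - (N P).card).choose (j - (N P).card) else 0 := by
  have h1 : ∀ Q ∈ T.powersetCard j, (F.filter fun P => N P ⊆ Q ∧ Q ⊆ P).card = 1 := by
    intro Q hQ
    obtain ⟨hQT, hQj⟩ := Finset.mem_powersetCard.1 hQ
    obtain ⟨P, hP, huniq⟩ := h Q hQT hQj
    refine Finset.card_eq_one.2 ⟨P, Finset.ext fun P' => ?_⟩
    rw [Finset.mem_filter, Finset.mem_singleton]
    exact ⟨huniq P', fun h => h ▸ hP⟩
  have h2 : ∑ Q ∈ T.powersetCard j, (F.filter fun P => N P ⊆ Q ∧ Q ⊆ P).card =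
      ∑ P ∈ F, ((T.powersetCard j).filter fun Q => N P ⊆ Q ∧ Q ⊆ P).card :=
    Finset.sum_card_bipartiteAbove_eq_sum_card_bipartiteBelow fun Q P => N P ⊆ Q ∧ Q ⊆ P
  rw [Finset.sum_congr rfl h1, Finset.sum_const, Finset.card_powersetCard, smul_eq_mul,
    mul_one] at h2
  rw [h2]
  refine Finset.sum_congr rfl fun P hP => ?_
  obtain ⟨hPT, hPd, hNP⟩ := hF P hP
  split_ifs with hj
  · rw [← hPd, ← Finset.card_filter_powersetCard_subset _ _ _ hNP hj]
    congr 1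
    ext Q
    simp only [Finset.mem_filter, Finset.mem_powersetCard]
    exact ⟨fun ⟨⟨_, h2⟩, h3, h4⟩ => ⟨⟨h4, h2⟩, h3⟩, fun ⟨⟨h1, h2⟩, h3⟩ =>
      ⟨⟨h1.trans hPT, h2⟩, h3, h1⟩⟩
  · refine Finset.card_eq_zero.2 (Finset.filter_eq_empty_iff.2 fun Q hQ ⟨h3, _⟩ => hj ?_)
    exact (Finset.card_le_card h3).trans (Finset.mem_powersetCard.1 hQ).2.le

lemma card_filter_le_two_of_intervals {T : Finset α} {F : Finset (Finset α)}
    {N : Finset α → Finset α} (hF : ∀ P ∈ F, P ⊆ T ∧ P.card = 5 ∧ N P ⊆ P)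
    (h : ∀ Q ⊆ T, Q.card ≤ 2 → ∃! P, P ∈ F ∧ N P ⊆ Q ∧ Q ⊆ P) :
    (F.filter fun P => (N P).card ≤ 2).card + 3 * T.card = T.card.choose 2 + 6 := by
  have h0 := choose_eq_sum_of_intervals (j := 0) hF fun Q hQ hc => h Q hQ (by omega)
  have h1 := choose_eq_sum_of_intervals (j := 1) hF fun Q hQ hc => h Q hQ (by omega)
  have h2 := choose_eq_sum_of_intervals (j := 2) hF fun Q hQ hc => h Q hQ (by omega)
  rw [Nat.choose_zero_right] at h0
  rw [Nat.choose_one_right] at h1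
  have key : (∑ P ∈ F, if (N P).card ≤ 2 then 1 else 0) +
      3 * ∑ P ∈ F, (if (N P).card ≤ 1 then (5 - (N P).card).choose (1 - (N P).card) else 0) =
      (∑ P ∈ F, if (N P).card ≤ 2 then (5 - (N P).card).choose (2 - (N P).card) else 0) +
      6 * ∑ P ∈ F, if (N P).card ≤ 0 then (5 - (N P).card).choose (0 - (N P).card) else 0 := by
    rw [Finset.mul_sum, Finset.mul_sum, ← Finset.sum_add_distrib, ← Finset.sum_add_distrib]
    refine Finset.sum_congr rfl fun P hP => ?_
    obtain ⟨-, hPd, hNP⟩ := hF P hP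
    have hle := Finset.card_le_card hNP
    rw [hPd] at hle
    generalize (N P).card = i at hle
    interval_cases i <;> rfl
  rwa [← Finset.card_filter, ← h0, ← h1, ← h2] at key

lemma card_eq_of_dual_intervals {T : Finset α} {F : Finset (Finset α)}
    {N : Finset α → Finset α} (hF : ∀ P ∈ F, P ⊆ T ∧ P.card = 5 ∧ N P ⊆ P)
    (h : ∀ Q ⊆ T, Q.card ≤ 2 → ∃! P, P ∈ F ∧ N P ⊆ Q ∧ Q ⊆ P)
    (h' : ∀ Q ⊆ T, Q.card ≤ 2 → ∃! P, P ∈ F ∧ P \ N P ⊆ Q ∧ Q ⊆ P) (hT : 3 ≤ T.card) :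
    F.card = 2 * (T.card - 3).choose 2 := by
  have h1 := card_filter_le_two_of_intervals hF h
  have h2 := card_filter_le_two_of_intervals (N := fun P => P \ N P)
    (fun P hP => ⟨(hF P hP).1, (hF P hP).2.1, Finset.sdiff_subset⟩) h'
  have h3 : (F.filter fun P => (P \ N P).card ≤ 2) = F.filter fun P => ¬ (N P).card ≤ 2 := by
    refine Finset.filter_congr fun P hP => ?_
    obtain ⟨-, hPd, hNP⟩ := hF P hP
    rw [Finset.card_sdiff_of_subset hNP]
    have := Finset.card_le_card hNP
    omega
  rw [h3] at h2
  have h4 := Finset.card_filter_add_card_filter_not (s := F) fun P => (N P).card ≤ 2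
  obtain ⟨m, hm⟩ := Nat.exists_eq_add_of_le hT
  rw [hm] at h1 h2 ⊢
  have h5 : (3 + m).choose 2 = m.choose 2 + 3 * m + 3 := by
    rw [Nat.add_choose_eq]
    simp [Finset.Nat.antidiagonal_succ, Nat.choose]
    ring
  rw [Nat.add_sub_cancel_left]
  omega

lemma sum_antidiagonal_choose_mul_choose (N a b : ℕ) :
    ∑ ij ∈ Finset.HasAntidiagonal.antidiagonal N, ij.1.choose a * ij.2.choose b =
      (N + 1).choose (a + b + 1) := by
  induction N generalizing b with
  | zero =>
    cases a <;> cases b <;>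
      simp only [Finset.Nat.antidiagonal_zero, Finset.sum_singleton, Nat.choose_self,
        Nat.choose_zero_succ, mul_zero, mul_one, zero_add] <;>
      exact (Nat.choose_eq_zero_of_lt (by omega)).symm
  | succ N ih =>
    rw [Finset.Nat.sum_antidiagonal_succ']
    cases b with
    | zero =>
      have := ih 0
      simp only [Nat.choose_zero_right, mul_one, add_zero] at this ⊢
      rw [this, Nat.choose_succ_succ (N + 1) a]
    | succ b =>
      simp only [Nat.choose_succ_succ _ b, mul_add, Finset.sum_add_distrib, ih]
      rw [Nat.choose_zero_succ, mul_zero, zero_add, Nat.succ_eq_add_one,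
        show a + (b + 1) + 1 = a + b + 1 + 1 by ring, Nat.choose_succ_succ (N + 1) (a + b + 1)]

lemma sum_range_choose_mul_choose (N r : ℕ) :
    ∑ k ∈ Finset.range (N + 1), (k + 2).choose 2 * (N - k + 2).choose (r + 2) =
      (N + 5).choose (r + 5) := by
  have h := sum_antidiagonal_choose_mul_choose (N + 4) 2 (r + 2)
  rw [Finset.Nat.sum_antidiagonal_eq_sum_range_succ (fun i j => i.choose 2 * j.choose (r + 2)),
    Finset.sum_range_succ', Finset.sum_range_succ', Finset.sum_range_succ,
    Finset.sum_range_succ] at h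
  have e1 : N + 4 - (N + 2 + 1 + 1) = 0 := by omega
  have e2 : N + 4 - (N + 1 + 1 + 1) = 1 := by omega
  rw [e1, e2] at h
  simp only [Nat.choose_zero_succ, zero_add, mul_zero, add_zero, zero_mul,
    Nat.choose_eq_zero_of_lt (show 1 < 2 by norm_num),
    Nat.choose_eq_zero_of_lt (show 1 < r + 2 by omega)] at h
  rw [show r + 5 = 2 + (r + 2) + 1 by ring, ← h]
  refine Finset.sum_congr rfl fun k hk => ?_
  rw [show N - k + 2 = N + 4 - (k + 1 + 1) by have := Finset.mem_range.1 hk; omega]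

/-- The matrix with entries `(N - k).choose r` is invertible. -/
lemma eq_of_sum_mul_choose_eq {N : ℕ} {f g : ℕ → ℕ}
    (h : ∀ r ≤ N, ∑ k ∈ Finset.range (N + 1), f k * (N - k).choose r =
      ∑ k ∈ Finset.range (N + 1), g k * (N - k).choose r) : ∀ k ≤ N, f k = g k := by
  intro k
  induction k using Nat.strong_induction_on with
  | _ k ih =>
    intro hk
    have h1 := h (N - k) (by omega)
    have hmem : k ∈ Finset.range (N + 1) := Finset.mem_range.2 (by omega)
    rw [← Finset.add_sum_erase _ _ hmem, ← Finset.add_sum_erase _ _ hmem] at h1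
    have h2 : ∑ i ∈ (Finset.range (N + 1)).erase k, f i * (N - i).choose (N - k) =
        ∑ i ∈ (Finset.range (N + 1)).erase k, g i * (N - i).choose (N - k) := by
      refine Finset.sum_congr rfl fun i hi => ?_
      obtain ⟨hne, hi⟩ := Finset.mem_erase.1 hi
      have hi := Finset.mem_range.1 hi
      rcases lt_or_gt_of_ne hne with hlt | hlt
      · rw [ih i hlt (by omega)]
      · rw [Nat.choose_eq_zero_of_lt (by omega), mul_zero, mul_zero]
    rw [h2, Nat.choose_self, mul_one, mul_one] at h1
    exact Nat.add_right_cancel h1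

/-- If every subset of size at least `5` has the facet number of a neighborly `5`-polytope, the
`k`-facet numbers are determined. -/
lemma card_filter_card_eq_of_facet_count {ι : Type*} {S : Finset α} {I : Finset ι}
    {P O : ι → Finset α} (hP : ∀ i ∈ I, P i ⊆ S) (hc : ∀ i ∈ I, (P i).card = 5)
    (hO : ∀ i ∈ I, O i ⊆ S) (hPO : ∀ i ∈ I, Disjoint (P i) (O i))
    (h : ∀ T ⊆ S, 5 ≤ T.card →
      (I.filter fun i => P i ⊆ T ∧ Disjoint (O i) T).card = 2 * (T.card - 3).choose 2)
    {k : ℕ} (hk : k + 5 ≤ S.card) :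
    (I.filter fun i => (O i).card = k).card =
      2 * (k + 2).choose 2 * (S.card - k - 3).choose 2 := by
  obtain ⟨N, hN⟩ := Nat.exists_eq_add_of_le (show 5 ≤ S.card by omega)
  have hle : ∀ i ∈ I, (O i).card ≤ N := fun i hi => by
    have := Finset.card_le_card (Finset.union_subset (hP i hi) (hO i hi))
    rw [Finset.card_union_of_disjoint (hPO i hi), hc i hi] at this
    omega
  refine eq_of_sum_mul_choose_eq (N := N)
    (f := fun k => (I.filter fun i => (O i).card = k).card)
    (g := fun k => 2 * (k + 2).choose 2 * (S.card - k - 3).choose 2) (fun r hr => ?_) k (by omega)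
  have h1 : ∑ T ∈ S.powersetCard (r + 5), (I.filter fun i => P i ⊆ T ∧ Disjoint (O i) T).card =
      ∑ i ∈ I, ((S.powersetCard (r + 5)).filter fun T => P i ⊆ T ∧ Disjoint (O i) T).card :=
    Finset.sum_card_bipartiteAbove_eq_sum_card_bipartiteBelow
      fun T i => P i ⊆ T ∧ Disjoint (O i) T
  have h2 : ∀ i ∈ I, ((S.powersetCard (r + 5)).filter
      fun T => P i ⊆ T ∧ Disjoint (O i) T).card = (N - (O i).card).choose r := by
    intro i hi
    have hsub : P i ⊆ S \ O i := Finset.subset_sdiff.2 ⟨hP i hi, hPO i hi⟩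
    have h3 := Finset.card_filter_powersetCard_subset (P i) (S \ O i) (r + 5) hsub
      (by rw [hc i hi]; omega)
    rw [Finset.card_sdiff_of_subset (hO i hi), hc i hi, hN] at h3
    rw [show N - (O i).card = 5 + N - (O i).card - 5 by omega, show r = r + 5 - 5 by omega, ← h3]
    congr 1
    ext T
    simp only [Finset.mem_filter, Finset.mem_powersetCard, Finset.subset_sdiff, disjoint_comm,
      Nat.add_sub_cancel]
    tauto
  have h3 : ∀ T ∈ S.powersetCard (r + 5),
      (I.filter fun i => P i ⊆ T ∧ Disjoint (O i) T).card = 2 * (r + 2).choose 2 := by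
    intro T hT
    obtain ⟨hTS, hTc⟩ := Finset.mem_powersetCard.1 hT
    rw [h T hTS (by omega), hTc, show r + 5 - 3 = r + 2 by omega]
  rw [Finset.sum_congr rfl h3, Finset.sum_congr rfl h2, Finset.sum_const,
    Finset.card_powersetCard, smul_eq_mul, hN] at h1
  have h4 : ∑ k ∈ Finset.range (N + 1),
      (I.filter fun i => (O i).card = k).card * (N - k).choose r =
        ∑ i ∈ I, (N - (O i).card).choose r := by
    rw [← Finset.sum_fiberwise_of_maps_to (t := Finset.range (N + 1)) (g := fun i => (O i).card)
      fun i hi => Finset.mem_range.2 (Nat.lt_succ_of_le (hle i hi))]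
    refine Finset.sum_congr rfl fun k _ => ?_
    rw [Finset.sum_congr rfl fun i hi => by rw [(Finset.mem_filter.1 hi).2], Finset.sum_const,
      smul_eq_mul]
  rw [h4, ← h1, add_comm 5 N, ← sum_range_choose_mul_choose, Finset.sum_mul]
  refine Finset.sum_congr rfl fun k hk => ?_
  have hk := Finset.mem_range.1 hk
  have h5 := Nat.choose_mul (n := N - k + 2) (k := r + 2) (s := 2) (by omega)
  rw [Nat.add_sub_cancel, Nat.add_sub_cancel] at h5
  rw [hN, show 5 + N - k - 3 = N - k + 2 by omega]
  calc _ = 2 * (k + 2).choose 2 * ((N - k + 2).choose (r + 2) * (r + 2).choose 2) := by ring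
    _ = _ := by rw [h5]; ring

end Counting

section NeighborlyConfigurations

variable {α E : Type*} [DecidableEq α] [NormedAddCommGroup E] [NormedSpace ℝ E]
  [FiniteDimensional ℝ E] {ev : α → E →ₗ[ℝ] ℝ} {S T : Finset α}

open Classical in
/-- The facet number of a neighborly simplicial `5`-polytope. -/
lemma Interpolates.card_facets (h : Interpolates ev 5 T) (hE : Module.finrank ℝ E = 6)
    (hn : ∀ Q ⊆ T, Q.card ≤ 2 → IsFace ev T Q) (hT : 5 < T.card) :
    ((T.powersetCard 5).filter (IsFace ev T)).card = 2 * (T.card - 3).choose 2 := by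
  obtain ⟨φ, hφ⟩ := exists_genericObjective (d := 5) ev hE T
  set F := (T.powersetCard 5).filter (IsFace ev T) with hFdef
  have hF : ∀ {P}, P ∈ F ↔ P.card = 5 ∧ IsFace ev T P := fun {P} => by
    simp only [hFdef, Finset.mem_filter, Finset.mem_powersetCard]
    exact ⟨fun h => ⟨h.1.2, h.2⟩, fun h => ⟨⟨h.2.1, h.1⟩, h.2⟩⟩
  have main : ∀ ψ : E →ₗ[ℝ] ℝ, GenericObjective ev 5 T ψ → ∀ Q ⊆ T, Q.card ≤ 2 →
      ∃! P, P ∈ F ∧ (∀ p ∈ P, p ∉ Q → PosCost ev T ψ P p) ∧ Q ⊆ P := by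
    intro ψ hψ Q hQ hQc
    obtain ⟨P, hP, hPc, hQP, hpos⟩ := hψ.exists_facet h hE (hn Q hQ hQc) (by omega) hT
    refine ⟨P, ⟨hF.2 ⟨hPc, hP⟩, hpos, hQP⟩, ?_⟩
    rintro P' ⟨hP', hpos', hQP'⟩
    exact h.facet_unique hE hT (hF.1 hP').2 (hF.1 hP').1 hQP' hpos' hP hPc hQP hpos
  refine card_eq_of_dual_intervals (N := fun P => P.filter fun p => ¬ PosCost ev T φ P p)
    (fun P hP => ⟨(hF.1 hP).2.1, (hF.1 hP).1, Finset.filter_subset _ _⟩)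
    (fun Q hQ hQc => ?_) (fun Q hQ hQc => ?_) (by omega)
  · convert main φ hφ Q hQ hQc using 5
    simp only [Finset.subset_iff, Finset.mem_filter]
    exact forall_congr' fun p => by tauto
  · refine (existsUnique_congr fun P => ?_).2 (main (-φ) hφ.neg Q hQ hQc)
    refine and_congr_right fun hP => and_congr_left fun _ => ?_
    simp only [Finset.subset_iff, Finset.mem_filter, Finset.mem_sdiff]
    refine forall_congr' fun p => ?_
    by_cases hp : p ∈ P
    · have := hφ.posCost_neg_iff h hE (hF.1 hP).2 (hF.1 hP).1 hT hp
      tauto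
    · tauto

/-- The functional `g` or its opposite. -/
def orient (b : Bool) (g : E) : E := if b then g else -g

/-- The `k`-facets of a configuration all of whose small subsets are faces. -/
theorem Interpolates.card_kfacets (h : Interpolates ev 5 S) (hE : Module.finrank ℝ E = 6)
    (hn : ∀ Q ⊆ S, Q.card ≤ 2 → IsFace ev S Q) {G : Finset α → E}
    (hG0 : ∀ P ⊆ S, P.card = 5 → G P ≠ 0)
    (hG : ∀ P ⊆ S, P.card = 5 → ∀ p ∈ P, ev p (G P) = 0) {k : ℕ} (hk : k + 5 ≤ S.card) :
    (((S.powersetCard 5) ×ˢ (Finset.univ : Finset Bool)).filter fun i =>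
      (S.filter fun s => ev s (orient i.2 (G i.1)) < 0).card = k).card =
      2 * (k + 2).choose 2 * (S.card - k - 3).choose 2 := by
  classical
  have hI : ∀ {i : Finset α × Bool}, i ∈ (S.powersetCard 5) ×ˢ (Finset.univ : Finset Bool) ↔
      i.1 ⊆ S ∧ i.1.card = 5 := by simp
  have hzero : ∀ {P : Finset α} (b : Bool), P ⊆ S → P.card = 5 → ∀ p ∈ P,
      ev p (orient b (G P)) = 0 := fun {P} b hP hc p hp => by
    cases b <;> simp [orient, hG P hP hc p hp]
  have hne : ∀ {P : Finset α} (b : Bool), P ⊆ S → P.card = 5 → ∀ s ∈ S, s ∉ P →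
      ev s (orient b (G P)) ≠ 0 := fun {P} b hP hc s hs hsP h0 => by
    refine hG0 P hP hc (h.eq_zero hE (Finset.insert_subset hs hP)
      (by rw [Finset.card_insert_of_notMem hsP, hc]) fun p hp => ?_)
    rcases Finset.mem_insert.1 hp with rfl | hp
    · cases b <;> simpa [orient] using h0
    · exact hG P hP hc p hp
  refine card_filter_card_eq_of_facet_count (P := Prod.fst) (fun i hi => (hI.1 hi).1)
    (fun i hi => (hI.1 hi).2) (fun i _ => Finset.filter_subset _ _) (fun i hi => ?_)
    (fun T hTS hT => ?_) hk
  · refine Finset.disjoint_left.2 fun p hp hpO => ?_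
    exact (Finset.mem_filter.1 hpO).2.ne (hzero i.2 (hI.1 hi).1 (hI.1 hi).2 p hp)
  rcases hT.eq_or_lt with hT | hT
  · have : (((S.powersetCard 5) ×ˢ (Finset.univ : Finset Bool)).filter fun i =>
        i.1 ⊆ T ∧ Disjoint (S.filter fun s => ev s (orient i.2 (G i.1)) < 0) T) =
        {T} ×ˢ (Finset.univ : Finset Bool) := by
      ext ⟨P, b⟩
      rw [Finset.mem_filter, hI]
      simp only [Finset.mem_product, Finset.mem_singleton, Finset.mem_univ, and_true]
      constructor
      · rintro ⟨⟨-, hPc⟩, hPT, -⟩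
        exact Finset.eq_of_subset_of_card_le hPT (by omega)
      · rintro rfl
        refine ⟨⟨hTS, hT.symm⟩, subset_rfl, Finset.disjoint_left.2 fun p hpO hp => ?_⟩
        exact (Finset.mem_filter.1 hpO).2.ne (hzero b hTS hT.symm p hp)
    rw [this, ← hT]
    simp
  have hnT : ∀ Q ⊆ T, Q.card ≤ 2 → IsFace ev T Q := fun Q hQ hc => by
    obtain ⟨-, g, hg, hpos⟩ := hn Q (hQ.trans hTS) hc
    exact ⟨hQ, g, hg, fun t ht => hpos t (hTS ht)⟩
  rw [← (h.mono hTS).card_facets hE hnT hT]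
  have hpos : ∀ {P : Finset α} {b : Bool}, P ⊆ S → P.card = 5 →
      Disjoint (S.filter fun s => ev s (orient b (G P)) < 0) T →
        ∀ t ∈ T, t ∉ P → 0 < ev t (orient b (G P)) := fun {P b} hP hc hdis t ht htP => by
    refine lt_of_le_of_ne (not_lt.1 fun hlt => ?_) (hne b hP hc t (hTS ht) htP).symm
    exact Finset.disjoint_left.1 hdis (Finset.mem_filter.2 ⟨hTS ht, hlt⟩) ht
  refine Finset.card_bij (fun i _ => i.1) ?_ ?_ ?_
  · rintro ⟨P, b⟩ hi
    obtain ⟨hi, hPT, hdis⟩ := Finset.mem_filter.1 hi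
    obtain ⟨hPS, hPc⟩ := hI.1 hi
    exact Finset.mem_filter.2 ⟨Finset.mem_powersetCard.2 ⟨hPT, hPc⟩, hPT,
      orient b (G P), hzero b hPS hPc, hpos hPS hPc hdis⟩
  · rintro ⟨P, b⟩ hi ⟨P', b'⟩ hi' (rfl : P = P')
    obtain ⟨hi, hPT, hdis⟩ := Finset.mem_filter.1 hi
    obtain ⟨-, -, hdis'⟩ := Finset.mem_filter.1 hi'
    obtain ⟨hPS, hPc⟩ := hI.1 hi
    simp only at hPc
    obtain ⟨t, ht, htP⟩ := Finset.exists_mem_notMem_of_card_lt_card (s := P) (t := T) (by omega)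
    have h1 := hpos hPS hPc hdis t ht htP
    have h2 := hpos hPS hPc hdis' t ht htP
    cases b <;> cases b' <;> simp [orient] at h1 h2 ⊢ <;> linarith
  · intro P hP
    obtain ⟨hP, hPT, g, hg, hgpos⟩ := Finset.mem_filter.1 hP
    have hPc := (Finset.mem_powersetCard.1 hP).2
    have hPS := hPT.trans hTS
    obtain ⟨c, rfl⟩ := h.exists_smul_eq hE hPS hPc (hG0 P hPS hPc) (hG P hPS hPc) hg
    obtain ⟨t, ht, htP⟩ := Finset.exists_mem_notMem_of_card_lt_card (s := P) (t := T) (by omega)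
    have hc0 : c ≠ 0 := by
      rintro rfl
      simpa using hgpos t ht htP
    refine ⟨(P, decide (0 < c)), Finset.mem_filter.2 ⟨hI.2 ⟨hPS, hPc⟩, hPT,
      Finset.disjoint_left.2 fun s hsO hs => ?_⟩, rfl⟩
    have hlt := (Finset.mem_filter.1 hsO).2
    by_cases hsP : s ∈ P
    · exact hlt.ne (hzero _ hPS hPc s hsP)
    have hgs := hgpos s hs hsP
    rw [map_smul, smul_eq_mul] at hgs
    rcases hc0.lt_or_gt with hc | hc
    · simp [orient, hc.not_gt] at hlt
      nlinarith
    · simp [orient, hc] at hlt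
      nlinarith

end NeighborlyConfigurations

/-- The value at `V22 s` of the affine function `y ↦ ∑ i, a i * y i - c`, as a linear function of
`(a, c)`. -/
noncomputable def conicEval (s : Fin 2 → ℝ) : ((Fin 5 → ℝ) × ℝ) →ₗ[ℝ] ℝ where
  toFun g := ∑ i, g.1 i * V22 s i - g.2
  map_add' g g' := by simp [add_mul, Finset.sum_add_distrib]; ring
  map_smul' r g := by simp [mul_assoc, ← Finset.mul_sum, mul_sub]

lemma conicEval_apply (s : Fin 2 → ℝ) (g : (Fin 5 → ℝ) × ℝ) :
    conicEval s g = ∑ i, g.1 i * V22 s i - g.2 := rfl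

lemma interpolates_conicEval {S : Finset (Fin 2 → ℝ)}
    (h : ∀ T ⊆ S, T.card ≤ 6 →
      AffineIndependent ℝ (fun t : (T : Set (Fin 2 → ℝ)) => V22 t)) :
    Interpolates conicEval 5 S := by
  classical
  intro U hU hUc y
  suffices hs : Function.Surjective (LinearMap.pi fun u : U => conicEval u) by
    obtain ⟨g, hg⟩ := hs fun u => y u
    exact ⟨g, fun u hu => congrFun hg ⟨u, hu⟩⟩
  rw [← LinearMap.dualMap_injective_iff, ← LinearMap.ker_eq_bot, LinearMap.ker_eq_bot']
  intro f hf
  set w : U → ℝ := fun u => f (Pi.single u 1) with hw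
  have hfw : ∀ x : U → ℝ, f x = ∑ u, x u * w u := fun x => by
    conv_lhs => rw [pi_eq_sum_univ' x]
    simp [hw, Pi.single]
  have hann : ∀ g, ∑ u : U, conicEval u g * w u = 0 := fun g => by
    rw [← hfw fun u => conicEval u g]
    exact LinearMap.congr_fun hf g
  have hw0 : ∑ u, w u = 0 := by
    simpa [conicEval_apply] using hann (0, -1)
  have hwV : ∑ u, w u • V22 u = 0 := by
    ext i
    simpa [conicEval_apply, Pi.single_apply, mul_comm] using hann (Pi.single i 1, 0)
  have hz := (h U hU hUc).eq_zero_of_sum_eq_zero (s := Finset.univ) (w := w) hw0 hwV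
  ext u
  exact hz u (Finset.mem_univ u)

lemma line_ne_zero {p q s : Fin 2 → ℝ} (hpq : p ≠ q)
    (h : AffineIndependent ℝ ![p, q, s]) :
    (s 0 - p 0) * (q 1 - p 1) - (s 1 - p 1) * (q 0 - p 0) ≠ 0 := by
  intro h0
  rw [affineIndependent_iff_not_collinear_set] at h
  refine h ((collinear_iff_of_mem (p₀ := p) (by simp)).2 ⟨q - p, ?_⟩)
  have hs : ∃ r : ℝ, s = r • (q - p) + p := by
    by_cases hq : q 0 - p 0 = 0
    · have hq1 : q 1 - p 1 ≠ 0 := fun hq1 => hpq <| by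
        ext i
        fin_cases i
        · exact (sub_eq_zero.1 hq).symm
        · exact (sub_eq_zero.1 hq1).symm
      have hs0 : s 0 - p 0 = 0 := by simpa [hq, hq1] using h0
      refine ⟨(s 1 - p 1) / (q 1 - p 1), ?_⟩
      ext i
      fin_cases i
      · simp [hq]
        linarith
      · simp [hq1]
    · refine ⟨(s 0 - p 0) / (q 0 - p 0), ?_⟩
      ext i
      fin_cases i
      · simp [hq]
      · simp
        field_simp
        linarith
  simp only [Set.mem_insert_iff, Set.mem_singleton_iff, vadd_eq_add]
  rintro x (rfl | rfl | rfl)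
  · exact ⟨0, by simp⟩
  · exact ⟨1, by simp⟩
  · exact hs

/-- Every pair of points is cut out by a double line, every point by a degenerate circle. -/
lemma isFace_conicEval {S : Finset (Fin 2 → ℝ)}
    (h : ∀ T ⊆ S, T.card ≤ 3 →
      AffineIndependent ℝ (fun t : (T : Set (Fin 2 → ℝ)) => (t : Fin 2 → ℝ)))
    {Q : Finset (Fin 2 → ℝ)} (hQ : Q ⊆ S) (hc : Q.card ≤ 2) : IsFace conicEval S Q := by
  classical
  refine ⟨hQ, ?_⟩
  interval_cases hQc : Q.card
  · obtain rfl := Finset.card_eq_zero.1 hQc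
    exact ⟨(0, -1), by simp, fun t _ _ => by simp [conicEval_apply]⟩
  · obtain ⟨p, rfl⟩ := Finset.card_eq_one.1 hQc
    have hval : ∀ t, conicEval t (![1, 0, 1, -2 * p 0, -2 * p 1], -(p 0 ^ 2 + p 1 ^ 2)) =
        (t 0 - p 0) ^ 2 + (t 1 - p 1) ^ 2 := fun t => by
      simp [conicEval_apply, V22, Fin.sum_univ_five]
      ring
    refine ⟨_, fun q hq => (hval q).trans (by simp [Finset.mem_singleton.1 hq]), fun t _ htp => ?_⟩
    rw [hval]
    refine lt_of_le_of_ne (by positivity) fun h0 => htp (Finset.mem_singleton.2 ?_)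
    have h1 : t 0 - p 0 = 0 := by nlinarith [sq_nonneg (t 0 - p 0), sq_nonneg (t 1 - p 1)]
    have h2 : t 1 - p 1 = 0 := by nlinarith [sq_nonneg (t 0 - p 0), sq_nonneg (t 1 - p 1)]
    ext i
    fin_cases i
    · exact sub_eq_zero.1 h1
    · exact sub_eq_zero.1 h2
  · obtain ⟨p, q, hpq, rfl⟩ := Finset.card_eq_two.1 hQc
    set a := q 1 - p 1 with ha
    set b := q 0 - p 0 with hb
    set c := p 0 * a - p 1 * b with hcdef
    have hval : ∀ t, conicEval t (![a ^ 2, -2 * a * b, b ^ 2, -2 * a * c, 2 * b * c], -c ^ 2) =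
        ((t 0 - p 0) * a - (t 1 - p 1) * b) ^ 2 := fun t => by
      simp [conicEval_apply, V22, Fin.sum_univ_five, hcdef]
      ring
    refine ⟨_, fun t ht => (hval t).trans ?_, fun t ht htQ => ?_⟩
    · simp only [Finset.mem_insert, Finset.mem_singleton] at ht
      rcases ht with rfl | rfl
      · ring
      · rw [ha, hb]
        ring
    · rw [hval]
      simp only [Finset.mem_insert, Finset.mem_singleton, not_or] at htQ
      have hcard : ({p, q, t} : Finset (Fin 2 → ℝ)).card = 3 :=
        Finset.card_eq_three.2 ⟨p, q, t, hpq, Ne.symm htQ.1, Ne.symm htQ.2, rfl⟩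
      have hsub : ({p, q, t} : Finset (Fin 2 → ℝ)) ⊆ S := by
        simp only [Finset.insert_subset_iff, Finset.singleton_subset_iff] at hQ ⊢
        exact ⟨hQ.1, hQ.2, ht⟩
      have haff := h _ hsub hcard.le
      have hinj : Function.Injective ![p, q, t] := by
        intro i j hij
        fin_cases i <;> fin_cases j <;> first | rfl | skip
        · exact absurd hij hpq
        · exact absurd hij.symm htQ.1
        · exact absurd hij.symm hpq
        · exact absurd hij.symm htQ.2
        · exact absurd hij htQ.1
        · exact absurd hij htQ.2
      have hmem : ∀ i, ![p, q, t] i ∈ (({p, q, t} : Finset (Fin 2 → ℝ)) : Set (Fin 2 → ℝ)) := by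
        intro i
        fin_cases i <;> simp
      let e : Fin 3 ↪ (({p, q, t} : Finset (Fin 2 → ℝ)) : Set (Fin 2 → ℝ)) :=
        ⟨fun i => ⟨![p, q, t] i, hmem i⟩, fun i j hij => hinj (congrArg Subtype.val hij)⟩
      have h3 : AffineIndependent ℝ ![p, q, t] := haff.comp_embedding e
      have := line_ne_zero hpq h3
      positivity

/-- The open half-space where the affine function encoded by `g` is negative. -/
def negHalfSpace (g : (Fin 5 → ℝ) × ℝ) : Set (Fin 5 → ℝ) := {y | ∑ i, g.1 i * y i < g.2}

lemma V22_mem_negHalfSpace {s : Fin 2 → ℝ} {g : (Fin 5 → ℝ) × ℝ} :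
    V22 s ∈ negHalfSpace g ↔ conicEval s g < 0 := by
  rw [conicEval_apply, sub_neg]
  rfl

lemma negHalfSpace_smul {r : ℝ} (hr : 0 < r) (g : (Fin 5 → ℝ) × ℝ) :
    negHalfSpace (r • g) = negHalfSpace g := by
  ext y
  simp [negHalfSpace, mul_assoc, ← Finset.mul_sum, hr]

lemma negHalfSpace_neg_ne {g : (Fin 5 → ℝ) × ℝ} (hg : g.1 ≠ 0) :
    negHalfSpace (-g) ≠ negHalfSpace g := by
  obtain ⟨i, hi⟩ := Function.ne_iff.1 hg
  intro h
  have hy : Pi.single i ((g.2 - 1) / g.1 i) ∈ negHalfSpace g := by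
    simp [negHalfSpace, Pi.single_apply, mul_div_cancel₀ _ hi]
  have hy' := h ▸ hy
  simp [negHalfSpace, Pi.single_apply, mul_div_cancel₀ _ hi] at hy'
  linarith

/-- Exact count of conic-section `k`-facets.  If `S` is a set of `n` points of `ℝ²` in
general position with respect to conics (`S` in general linear position and `V₂²(S)` in
general linear position in `ℝ⁵`), then for every `0 ≤ k ≤ n - 5` the number of pairs
`(P, O)`, where `P ⊆ S` has exactly 5 elements and `O` is one of the two open
half-spaces bounded by the affine hyperplane spanned by `V₂²(P)`, such that `O` contains
exactly `k` of the points `V₂²(s)`, `s ∈ S \ P`, is exactly `2·C(k+2,2)·C(n-k-3,2)`. -/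
theorem conic_kfacet_count (n k : ℕ) (S : Finset (Fin 2 → ℝ)) (hcard : S.card = n)
    (hgen1 : ∀ T ⊆ S, T.card ≤ 3 →
      AffineIndependent ℝ (fun t : (T : Set (Fin 2 → ℝ)) => (t : Fin 2 → ℝ)))
    (hgen2 : ∀ T ⊆ S, T.card ≤ 6 →
      AffineIndependent ℝ (fun t : (T : Set (Fin 2 → ℝ)) => V22 t))
    (hk : k + 5 ≤ n) :
    Set.ncard {PO : Finset (Fin 2 → ℝ) × Set (Fin 5 → ℝ) |
      PO.1 ⊆ S ∧ PO.1.card = 5 ∧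
      (∃ (a : Fin 5 → ℝ) (c : ℝ), a ≠ 0 ∧
        (∀ p ∈ PO.1, ∑ i, a i * V22 p i = c) ∧
        PO.2 = {y : Fin 5 → ℝ | ∑ i, a i * y i < c}) ∧
      Set.ncard {s : Fin 2 → ℝ | s ∈ S ∧ s ∉ PO.1 ∧ V22 s ∈ PO.2} = k} =
    2 * (k + 2).choose 2 * (n - k - 3).choose 2 := by
  classical
  subst hcard
  have h := interpolates_conicEval hgen2
  have hE : Module.finrank ℝ ((Fin 5 → ℝ) × ℝ) = 5 + 1 := by simp
  have hex : ∀ P : Finset (Fin 2 → ℝ), ∃ g : (Fin 5 → ℝ) × ℝ,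
      P.card = 5 → g ≠ 0 ∧ ∀ p ∈ P, conicEval p g = 0 := fun P => by
    by_cases hP : P.card = 5
    · obtain ⟨g, hg⟩ := exists_ne_zero_vanishing conicEval hE hP
      exact ⟨g, fun _ => hg⟩
    · exact ⟨0, fun h => absurd h hP⟩
  choose G hG using hex
  have hor : ∀ {P : Finset (Fin 2 → ℝ)} (b : Bool), P.card = 5 → ∀ p ∈ P,
      conicEval p (orient b (G P)) = 0 := fun {P} b hP p hp => by
    cases b <;> simp [orient, (hG P hP).2 p hp]
  have hfst : ∀ {P : Finset (Fin 2 → ℝ)} {g : (Fin 5 → ℝ) × ℝ}, P.card = 5 → g ≠ 0 →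
      (∀ p ∈ P, conicEval p g = 0) → g.1 ≠ 0 := fun {P g} hP hg0 hg h0 => by
    obtain ⟨p, hp⟩ := Finset.card_pos.1 (by omega : 0 < P.card)
    have h1 := hg p hp
    simp only [conicEval_apply, h0, Pi.zero_apply, zero_mul, Finset.sum_const_zero, zero_sub,
      neg_eq_zero] at h1
    exact hg0 (Prod.ext h0 h1)
  rw [← h.card_kfacets hE (fun Q hQ hQc => isFace_conicEval hgen1 hQ hQc)
    (fun P _ hP => (hG P hP).1) (fun P _ hP => (hG P hP).2) hk]
  have hcount : ∀ {P : Finset (Fin 2 → ℝ)} {g : (Fin 5 → ℝ) × ℝ},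
      (∀ p ∈ P, conicEval p g = 0) →
      Set.ncard {s : Fin 2 → ℝ | s ∈ S ∧ s ∉ P ∧ V22 s ∈ negHalfSpace g} =
        (S.filter fun s => conicEval s g < 0).card := fun {P g} hg => by
    rw [← Set.ncard_coe_finset]
    congr 1
    ext s
    simp only [Set.mem_ofPred_eq, V22_mem_negHalfSpace, Finset.coe_filter]
    exact ⟨fun h => ⟨h.1, h.2.2⟩, fun h => ⟨h.1, fun hs => h.2.ne (hg s hs), h.2⟩⟩
  have hinj : Set.InjOn (fun i : Finset (Fin 2 → ℝ) × Bool =>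
      (i.1, negHalfSpace (orient i.2 (G i.1))))
      (((S.powersetCard 5) ×ˢ (Finset.univ : Finset Bool)).filter fun i =>
        (S.filter fun s => conicEval s (orient i.2 (G i.1)) < 0).card = k) := by
    rintro ⟨P, b⟩ hi ⟨P', b'⟩ - heq
    obtain ⟨rfl, heq⟩ := Prod.mk.inj heq
    have hP : P.card = 5 := by
      simp only [Finset.coe_filter, Set.mem_ofPred_eq, Finset.mem_product,
        Finset.mem_powersetCard] at hi
      exact hi.1.1.2
    have hne := negHalfSpace_neg_ne (hfst hP (hG P hP).1 (hG P hP).2)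
    cases b <;> cases b' <;> simp only [orient] at heq ⊢
    · exact absurd heq hne
    · exact absurd heq.symm hne
  rw [← Finset.card_image_of_injOn hinj, ← Set.ncard_coe_finset]
  congr 1
  ext ⟨P, O⟩
  simp only [Set.mem_ofPred_eq, Finset.coe_image, Set.mem_image, Finset.coe_filter,
    Finset.mem_product, Finset.mem_powersetCard, Finset.mem_univ, and_true, Prod.exists,
    Prod.mk.injEq]
  constructor
  · rintro ⟨hPS, hP, ⟨a, c, ha, hac, hO⟩, hk⟩
    have hO' : O = negHalfSpace (a, c) := hO
    obtain ⟨r, hr⟩ := h.exists_smul_eq hE hPS hP (hG P hP).1 (hG P hP).2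
      (g' := (a, c)) fun p hp => sub_eq_zero.2 (hac p hp)
    have hr0 : r ≠ 0 := by
      rintro rfl
      rw [zero_smul] at hr
      exact ha (congrArg Prod.fst hr).symm
    have hO'' : negHalfSpace (orient (decide (0 < r)) (G P)) = O := by
      rw [hO', ← hr]
      rcases hr0.lt_or_gt with hlt | hlt
      · rw [← neg_smul_neg, negHalfSpace_smul (neg_pos.2 hlt)]
        simp [orient, hlt.not_gt]
      · rw [negHalfSpace_smul hlt]
        simp [orient, hlt]
    refine ⟨P, decide (0 < r), ⟨⟨hPS, hP⟩, ?_⟩, rfl, hO''⟩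
    rw [← hcount (hor _ hP), hO'', hk]
  · rintro ⟨P, b, ⟨⟨hPS, hP⟩, hk⟩, rfl, rfl⟩
    have hne : orient b (G P) ≠ 0 := by
      cases b <;> simp [orient, (hG P hP).1]
    refine ⟨hPS, hP, ⟨_, _, hfst hP hne (hor b hP), fun p hp => sub_eq_zero.1 (hor b hP p hp),
      rfl⟩, ?_⟩
    rw [hcount (hor b hP), hk]
end

section
/- Let m be a positive even integer and let S be a set of n points in ℝ² in general position with respect to degree-m homogeneous polynomials, i.e., no two distinct points of S lie on a common line through the origin and the image HV_m²(S) under the degree-m homogeneous Veronese map is in general linear position in ℝ^{m+1}. Then for every k with 0 ≤ k ≤ n − m − 1, the number of pairs (P, O), where P ⊆ S has exactly m+1 elements and O is one of the two open half-spaces of ℝ^{m+1} bounded by the affine hyperplane spanned by HV_m²(P), such that O contains exactly k of the points HV_m²(s) with s ∈ S \ P, is exactly 2·C(k+m/2, m/2)·C(n−k−m/2−1, m/2). -/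
open Finset in
theorem sum_sign_mul_crossings {α : Type*} [DecidableEq α] (t : α → ℝ) (σ : α → Prop)
    [DecidablePred σ] (R : Finset α) (ht : Set.InjOn t R) (φ : ℕ → ℤ) :
    ∑ s ∈ R, (if σ s then 1 else -1) *
        φ #{r ∈ R | (σ r ∧ t s < t r) ∨ (¬ σ r ∧ t r < t s)} =
      ∑ j ∈ range #{r ∈ R | σ r}, φ j - ∑ j ∈ range #{r ∈ R | ¬ σ r}, φ j := by
  induction R using Finset.induction_on_max_value t generalizing φ with
  | empty => simp
  | insert a R ha hmax ih =>
    have hlt : ∀ x ∈ R, t x < t a := fun x hx => lt_of_le_of_ne (hmax x hx) fun h =>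
      ha (ht (by simp [hx]) (by simp) h ▸ hx)
    have htR : Set.InjOn t R := ht.mono (by simp)
    have hself : #{r ∈ insert a R | (σ r ∧ t a < t r) ∨ (¬ σ r ∧ t r < t a)} =
        #{r ∈ R | ¬ σ r} := by
      congr 1
      ext r
      simp only [mem_filter, mem_insert]
      constructor
      · rintro ⟨rfl | h, h'⟩
        · simp at h'
        · exact ⟨h, h'.elim (fun h'' => absurd h''.2 (hlt r h).not_gt) And.left⟩
      · rintro ⟨h, h'⟩
        exact ⟨Or.inr h, Or.inr ⟨h', hlt r h⟩⟩
    rw [sum_insert ha, hself]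
    by_cases hσ : σ a
    · have hoth : ∀ s ∈ R, #{r ∈ insert a R | (σ r ∧ t s < t r) ∨ (¬ σ r ∧ t r < t s)} =
          #{r ∈ R | (σ r ∧ t s < t r) ∨ (¬ σ r ∧ t r < t s)} + 1 := by
        intro s hs
        rw [filter_insert, if_pos (Or.inl ⟨hσ, hlt s hs⟩), card_insert_of_notMem (by simp [ha])]
      rw [sum_congr rfl fun s hs => by rw [hoth s hs], ih htR fun j => φ (j + 1),
        filter_insert, filter_insert, if_pos hσ, if_neg (not_not.2 hσ), if_pos hσ,
        card_insert_of_notMem (by simp [ha]), sum_range_succ']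
      have := sum_range_succ' φ #{r ∈ R | ¬ σ r}
      rw [sum_range_succ] at this
      linarith
    · have hoth : ∀ s ∈ R, #{r ∈ insert a R | (σ r ∧ t s < t r) ∨ (¬ σ r ∧ t r < t s)} =
          #{r ∈ R | (σ r ∧ t s < t r) ∨ (¬ σ r ∧ t r < t s)} := by
        intro s hs
        rw [filter_insert, if_neg]
        rintro (h | h)
        · exact hσ h.1
        · exact h.2.not_gt (hlt s hs)
      rw [sum_congr rfl fun s hs => by rw [hoth s hs], ih htR φ,
        filter_insert, filter_insert, if_pos hσ, if_neg hσ, if_neg hσ,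
        card_insert_of_notMem (by simp [ha]), sum_range_succ]
      ring

open Finset in
theorem sum_neg_one_pow_card_gt {α K : Type*} [DecidableEq α] [LinearOrder K] (κ : α → K)
    (P : Finset α) (hκ : Set.InjOn κ P) :
    ∑ p ∈ P, (if Even #{q ∈ P | κ p < κ q} then (1 : ℤ) else -1) = if Even #P then 0 else 1 := by
  induction P using Finset.induction_on_min_value κ with
  | empty => simp
  | insert a P ha hmin ih =>
    have hlt : ∀ x ∈ P, κ a < κ x := fun x hx => lt_of_le_of_ne (hmin x hx) fun h =>
      ha (hκ (by simp) (by simp [hx]) h ▸ hx)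
    have hself : #{q ∈ insert a P | κ a < κ q} = #P := by
      rw [filter_insert, if_neg (lt_irrefl _), filter_true_of_mem hlt]
    have hoth : ∀ p ∈ P, #{q ∈ insert a P | κ p < κ q} = #{q ∈ P | κ p < κ q} := fun p hp => by
      rw [filter_insert, if_neg (hlt p hp).not_gt]
    rw [sum_insert ha, hself, sum_congr rfl fun p hp => by rw [hoth p hp],
      ih (hκ.mono (by simp)), card_insert_of_notMem ha]
    by_cases h : Even #P <;> simp [h, Nat.even_add_one]

open Finset in
theorem card_powersetCard_filter_parity {α K : Type*} [DecidableEq α] [LinearOrder K] (κ : α → K)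
    (S : Finset α) (hκ : Set.InjOn κ S) (m i j : ℕ) (h : #S = m + i + j) :
    #{Q ∈ powersetCard m S | #{s ∈ S \ Q | Even #{q ∈ Q | κ s < κ q}} = i ∧
        #{s ∈ S \ Q | ¬ Even #{q ∈ Q | κ s < κ q}} = j} =
      (m / 2 + 1).multichoose i * ((m + 1) / 2).multichoose j := by
  induction S using Finset.induction_on_min_value κ generalizing m i j with
  | empty =>
    obtain ⟨⟨rfl, rfl⟩, rfl⟩ : (m = 0 ∧ i = 0) ∧ j = 0 := by simpa using h.symm
    simp
  | insert a S ha hmin ih =>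
    have hlt : ∀ x ∈ S, κ a < κ x := fun x hx => lt_of_le_of_ne (hmin x hx) fun h =>
      ha (hκ (by simp) (by simp [hx]) h ▸ hx)
    have hκS : Set.InjOn κ S := hκ.mono (by simp)
    rw [card_insert_of_notMem ha] at h
    cases m with
    | zero =>
      rcases j with _ | j
      · have : #S + 1 = i := by omega
        simp [filter_singleton, card_insert_of_notMem ha, this]
      · simp [filter_singleton]
    | succ m =>
      have h1 : ∀ Q ∈ powersetCard m S,
          {s ∈ insert a S \ insert a Q | Even #{q ∈ insert a Q | κ s < κ q}} =
            {s ∈ S \ Q | Even #{q ∈ Q | κ s < κ q}} ∧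
          {s ∈ insert a S \ insert a Q | ¬ Even #{q ∈ insert a Q | κ s < κ q}} =
            {s ∈ S \ Q | ¬ Even #{q ∈ Q | κ s < κ q}} := by
        intro Q hQ
        have e : insert a S \ insert a Q = S \ Q := by grind
        have e2 : ∀ s ∈ S \ Q, #{q ∈ insert a Q | κ s < κ q} = #{q ∈ Q | κ s < κ q} := by
          intro s hs
          rw [filter_insert, if_neg (hlt s (mem_sdiff.1 hs).1).not_gt]
        rw [e]
        exact ⟨filter_congr fun s hs => by rw [e2 s hs], filter_congr fun s hs => by rw [e2 s hs]⟩
      have h2 : ∀ Q ∈ powersetCard (m + 1) S, insert a S \ Q = insert a (S \ Q) ∧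
          #{q ∈ Q | κ a < κ q} = m + 1 := by
        intro Q hQ
        rw [mem_powersetCard] at hQ
        refine ⟨insert_sdiff_of_notMem _ fun h => ha (hQ.1 h), ?_⟩
        rw [filter_true_of_mem fun x hx => hlt x (hQ.1 hx), hQ.2]
      rw [powersetCard_succ_insert ha, filter_union, card_union_of_disjoint, filter_image,
        card_image_of_injOn]
      · rw [filter_congr fun Q hQ => by
            rw [(h2 Q hQ).1, filter_insert, filter_insert, (h2 Q hQ).2],
          filter_congr (s := powersetCard m S) fun Q hQ => by rw [(h1 Q hQ).1, (h1 Q hQ).2],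
          ih hκS m i j (by omega)]
        by_cases hm : Even (m + 1)
        · obtain ⟨l, hl⟩ := hm
          obtain ⟨d, rfl⟩ : ∃ d, m = 2 * d + 1 := ⟨l - 1, by omega⟩
          have e : Even (2 * d + 1 + 1) := ⟨d + 1, by ring⟩
          simp only [e, not_true, if_true, if_false]
          have c1 : (2 * d + 1 + 1) / 2 = d + 1 := by omega
          have c2 : (2 * d + 1) / 2 = d := by omega
          have c3 : (2 * d + 1 + 1 + 1) / 2 = d + 1 := by omega
          rw [c1, c2, c3]
          rcases i with _ | i
          · rw [filter_false_of_mem]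
            · simp
            · intro Q hQ
              rw [card_insert_of_notMem (by simp [ha])]
              omega
          · have := ih hκS (2 * d + 1 + 1) i j (by omega)
            rw [c1, c3] at this
            rw [filter_congr fun Q hQ => by
              rw [card_insert_of_notMem (by simp [ha]), Nat.add_right_cancel_iff], this,
              Nat.multichoose_succ_succ (d + 1)]
            ring
        · have hm' : ¬ Odd m := fun h => hm h.add_one
          rw [Nat.not_odd_iff_even] at hm'
          obtain ⟨d, rfl⟩ := hm'
          simp only [hm, not_false_iff, if_true, if_false]
          have c1 : (d + d + 1) / 2 = d := by omega
          have c2 : (d + d) / 2 = d := by omega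
          have c3 : (d + d + 1 + 1) / 2 = d + 1 := by omega
          rw [c1, c2, c3]
          rcases j with _ | j
          · rw [filter_false_of_mem]
            · simp
            · intro Q hQ
              rw [card_insert_of_notMem (s := filter _ _) (by simp [ha])]
              omega
          · have := ih hκS (d + d + 1) i j (by omega)
            rw [c1, c3] at this
            rw [filter_congr fun Q hQ => by
              rw [card_insert_of_notMem (s := {s ∈ S \ Q | ¬ Even #{q ∈ Q | κ s < κ q}})
                (by simp [ha]), Nat.add_right_cancel_iff], this,
              Nat.multichoose_succ_succ d]
            ring
      · intro Q hQ Q' hQ' hEq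
        have hQ1 : a ∉ Q := fun h => ha ((mem_powersetCard.1 (mem_filter.1 hQ).1).1 h)
        have hQ2 : a ∉ Q' := fun h => ha ((mem_powersetCard.1 (mem_filter.1 hQ').1).1 h)
        rw [← erase_insert hQ1, ← erase_insert hQ2]
        exact congrArg (fun T => T.erase a) hEq
      · rw [disjoint_left]
        intro Q hQ hQ'
        have h1 := (mem_powersetCard.1 (mem_filter.1 hQ).1).1
        obtain ⟨Q', -, rfl⟩ := mem_image.1 (mem_filter.1 hQ').1
        exact ha (h1 (mem_insert_self _ _))

open Finset in
theorem sum_antidiagonal_ite_lt {M : Type*} [AddCommMonoid M] (k r : ℕ) (f : ℕ → ℕ → M) :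
    ∑ x ∈ antidiagonal (k + r + 1), (if k < x.1 then f x.1 x.2 else 0) =
      ∑ x ∈ antidiagonal r, f (x.1 + k + 1) x.2 := by
  induction k generalizing f with
  | zero => simp [Finset.Nat.sum_antidiagonal_succ]
  | succ k ih =>
    rw [show k + 1 + r + 1 = (k + r + 1) + 1 by ring, Finset.Nat.sum_antidiagonal_succ]
    have := ih fun i j => f (i + 1) j
    simp only [add_lt_add_iff_right]
    rw [this]
    simp only [Nat.not_lt_zero, if_false, zero_add]
    refine sum_congr rfl fun x _ => ?_
    ring_nf

open Finset in
theorem sum_antidiagonal_multichoose (h k r : ℕ) :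
    ∑ x ∈ antidiagonal r,
        (((h + 1).multichoose (x.1 + k + 1) * h.multichoose x.2 : ℤ) -
          h.multichoose (x.1 + k + 1) * (h + 1).multichoose x.2) =
      (h + 1).multichoose k * (h + 1).multichoose r := by
  induction r generalizing k with
  | zero => simp [Nat.multichoose_succ_succ]
  | succ r ih =>
    rw [Finset.Nat.sum_antidiagonal_succ]
    have := ih (k + 1)
    simp only [show ∀ x : ℕ, x + (k + 1) + 1 = x + 1 + k + 1 by intro x; ring] at this
    rw [this]
    simp only [Nat.multichoose_succ_succ, zero_add]
    push_cast
    ring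

theorem exists_form_eq_prod_linear {ι : Type*} (Q : Finset ι) (α β : ι → ℝ) :
    ∀ m, Q.card = m → ∃ a : Fin (m + 1) → ℝ, ∀ p : Fin 2 → ℝ,
      ∑ i, a i * HV2 m p i = ∏ q ∈ Q, (α q * p 0 + β q * p 1) := by
  classical
  induction Q using Finset.induction_on with
  | empty =>
    rintro m rfl
    exact ⟨fun _ => 1, fun p => by simp [HV2]; rfl⟩
  | insert q Q hq ih =>
    rintro m rfl
    rw [Finset.card_insert_of_notMem hq]
    obtain ⟨a, ha⟩ := ih _ rfl
    refine ⟨α q • (Fin.snoc a 0 : Fin (Q.card + 1 + 1) → ℝ) +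
      β q • (Fin.cons 0 a : Fin (Q.card + 1 + 1) → ℝ), fun p => ?_⟩
    have h0 : ∀ i : Fin (Q.card + 1), HV2 (Q.card + 1) p i.castSucc = p 0 * HV2 Q.card p i := by
      intro i
      have : Q.card + 1 - (i : ℕ) = Q.card - i + 1 := by omega
      simp only [HV2, Fin.val_castSucc, this, pow_succ]
      ring
    have h1 : ∀ i : Fin (Q.card + 1), HV2 (Q.card + 1) p i.succ = p 1 * HV2 Q.card p i := by
      intro i
      simp only [HV2, Fin.val_succ, Nat.add_sub_add_right, pow_succ]
      ring
    rw [Finset.prod_insert hq, ← ha p]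
    simp only [Pi.add_apply, Pi.smul_apply, smul_eq_mul, add_mul, Finset.sum_add_distrib]
    rw [Fin.sum_univ_castSucc, Fin.sum_univ_succ (fun i => β q * _ * _)]
    simp only [Fin.snoc_castSucc, Fin.snoc_last, Fin.cons_zero, Fin.cons_succ, h0, h1]
    simp only [Finset.mul_sum, mul_zero, zero_mul, add_zero, zero_add]
    exact congrArg₂ _ (Finset.sum_congr rfl fun i _ => by ring)
      (Finset.sum_congr rfl fun i _ => by ring)

theorem existsUnique_form_interpolating (m : ℕ) (P : Finset (Fin 2 → ℝ)) (hP : P.card = m + 1)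
    (hdet : ∀ p ∈ P, ∀ q ∈ P, p ≠ q → q 0 * p 1 - q 1 * p 0 ≠ 0) (v : (Fin 2 → ℝ) → ℝ) :
    ∃! a : Fin (m + 1) → ℝ, ∀ p ∈ P, ∑ i, a i * HV2 m p i = v p := by
  classical
  have hform : ∀ p : P, ∃ a : Fin (m + 1) → ℝ, ∀ x : Fin 2 → ℝ,
      ∑ i, a i * HV2 m x i = ∏ q ∈ P.erase p, (-q 1 * x 0 + q 0 * x 1) := fun p =>
    exists_form_eq_prod_linear _ _ _ m (by rw [Finset.card_erase_of_mem p.2, hP]; rfl)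
  choose A hA using hform
  have hA0 : ∀ p r : P, r ≠ p → ∑ i, A p i * HV2 m r i = 0 := by
    intro p r hrp
    rw [hA]
    refine Finset.prod_eq_zero (i := (r : Fin 2 → ℝ)) ?_ (by ring)
    exact Finset.mem_erase.2 ⟨fun h => hrp (Subtype.ext h), r.2⟩
  have hA1 : ∀ p : P, ∑ i, A p i * HV2 m p i ≠ 0 := by
    intro p
    rw [hA, Finset.prod_ne_zero_iff]
    intro q hq
    rw [Finset.mem_erase] at hq
    convert hdet p p.2 q hq.2 hq.1.symm using 1
    ring
  let E : (Fin (m + 1) → ℝ) →ₗ[ℝ] (P → ℝ) :=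
    { toFun := fun a p => ∑ i, a i * HV2 m p i
      map_add' := fun a b => by ext p; simp [add_mul, Finset.sum_add_distrib]
      map_smul' := fun c a => by ext p; simp [Finset.mul_sum, mul_assoc] }
  have hE : ∀ a p, E a p = ∑ i, a i * HV2 m p i := fun _ _ => rfl
  have hsurj : Function.Surjective E := by
    intro u
    refine ⟨∑ p : P, (u p / ∑ i, A p i * HV2 m p i) • A p, ?_⟩
    ext r
    rw [map_sum, Finset.sum_apply, Finset.sum_eq_single r]
    · rw [map_smul, Pi.smul_apply, hE, smul_eq_mul, div_mul_cancel₀ _ (hA1 r)]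
    · intro p _ hp
      rw [map_smul, Pi.smul_apply, hE, hA0 p r hp.symm, smul_zero]
    · simp
  have hinj : Function.Injective E :=
    (LinearMap.injective_iff_surjective_of_finrank_eq_finrank (by simp [hP])).2 hsurj
  obtain ⟨a, ha⟩ := hsurj fun p => v p
  refine ⟨a, fun p hp => congrFun ha ⟨p, hp⟩, fun b hb => hinj ?_⟩
  rw [ha]
  ext p
  exact hb p p.2

/-- The points of `S` are ordered by their direction, and the determinant of two of them, after a
sign change of each, detects this order. -/
theorem exists_direction_order (S : Finset (Fin 2 → ℝ))
    (hdet : ∀ p ∈ S, ∀ q ∈ S, p ≠ q → q 0 * p 1 - q 1 * p 0 ≠ 0) (hS : 1 < S.card) :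
    ∃ (κ : (Fin 2 → ℝ) → WithBot ℝ) (w : (Fin 2 → ℝ) → ℝ), Set.InjOn κ S ∧
      (∀ p ∈ S, w p ≠ 0) ∧
      ∀ p ∈ S, ∀ q ∈ S, κ q < κ p → 0 < (q 0 * p 1 - q 1 * p 0) * w q * w p := by
  have h0 : ∀ p ∈ S, p 1 = 0 → p 0 ≠ 0 := by
    intro p hp h1 h0
    obtain ⟨q, hq, hne⟩ := Finset.exists_mem_ne hS p
    exact hdet p hp q hq hne.symm (by simp [h1, h0])
  refine ⟨fun p => if p 1 = 0 then ⊥ else ((-(p 0 / p 1) : ℝ) : WithBot ℝ),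
    fun p => if p 1 = 0 then p 0 else p 1, ?_, ?_, ?_⟩
  · intro p hp q hq h
    by_contra hne
    apply hdet p hp q hq hne
    by_cases hp1 : p 1 = 0 <;> by_cases hq1 : q 1 = 0 <;> simp [hp1, hq1] at h ⊢
    field_simp at h
    linarith
  · intro p hp
    by_cases hp1 : p 1 = 0
    · simpa [hp1] using h0 p hp hp1
    · simp [hp1]
  · intro p hp q hq h
    by_cases hp1 : p 1 = 0
    · simp [hp1] at h
    by_cases hq1 : q 1 = 0
    · have := h0 q hq hq1
      simp only [hp1, hq1, if_true, if_false]
      have : 0 < (q 0 * p 1) ^ 2 := by positivity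
      linarith
    · simp only [hp1, hq1, if_false, WithBot.coe_lt_coe, neg_lt_neg_iff] at h ⊢
      have h2 : 0 < (q 1 * p 1) ^ 2 := by positivity
      have : (q 0 * p 1 - q 1 * p 0) * q 1 * p 1 = (q 1 * p 1) ^ 2 * (q 0 / q 1 - p 0 / p 1) := by
        field_simp
      rw [this]
      exact mul_pos h2 (sub_pos.2 h)

theorem prod_pos_iff_even_card_neg {ι : Type*} (Q : Finset ι) (f : ι → ℝ)
    (hf : ∀ q ∈ Q, f q ≠ 0) [DecidablePred fun q => f q < 0] :
    0 < ∏ q ∈ Q, f q ↔ Even (Q.filter fun q => f q < 0).card := by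
  classical
  induction Q using Finset.induction_on with
  | empty => simp
  | insert a Q ha ih =>
    have hQ : ∏ q ∈ Q, f q ≠ 0 := Finset.prod_ne_zero_iff.2 fun q hq => hf q (by simp [hq])
    have ih := ih fun q hq => hf q (by simp [hq])
    rw [Finset.prod_insert ha, Finset.filter_insert]
    rcases lt_or_gt_of_ne (hf a (by simp)) with h | h
    · rw [if_pos h, Finset.card_insert_of_notMem (by simp [ha]), Nat.even_add_one, ← ih,
        not_lt]
      exact ⟨fun h' => le_of_not_gt fun h'' =>
          h'.not_ge (mul_nonpos_of_nonpos_of_nonneg h.le h''.le),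
        fun h' => mul_pos_of_neg_of_neg h (lt_of_le_of_ne h' hQ)⟩
    · rw [if_neg h.not_gt, ← ih, mul_pos_iff_of_pos_left h]

/-- A degree-`m` form with prescribed sign pattern vanishing on an `m`-element set `Q`. -/
theorem exists_form_vanishing_sign {K : Type*} [LinearOrder K] (m : ℕ) (hm : Even m)
    (S : Finset (Fin 2 → ℝ)) (κ : (Fin 2 → ℝ) → K) (w : (Fin 2 → ℝ) → ℝ) (hκ : Set.InjOn κ S)
    (hw : ∀ p ∈ S, w p ≠ 0)
    (hsign : ∀ p ∈ S, ∀ q ∈ S, κ q < κ p → 0 < (q 0 * p 1 - q 1 * p 0) * w q * w p)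
    (Q : Finset (Fin 2 → ℝ)) (hQS : Q ⊆ S) (hQ : Q.card = m) :
    ∃ g : Fin (m + 1) → ℝ, (∀ q ∈ Q, ∑ i, g i * HV2 m q i = 0) ∧
      ∀ s ∈ S \ Q, ∑ i, g i * HV2 m s i ≠ 0 ∧
        (0 < ∑ i, g i * HV2 m s i ↔ Even (Q.filter fun q => κ s < κ q).card) := by
  classical
  obtain ⟨g, hg⟩ := exists_form_eq_prod_linear Q (fun q => -q 1 * w q) (fun q => q 0 * w q) m hQ
  refine ⟨g, fun q hq => ?_, fun s hs => ?_⟩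
  · rw [hg]
    exact Finset.prod_eq_zero hq (by ring)
  · rw [Finset.mem_sdiff] at hs
    have hsg : ∀ q ∈ Q, ((-q 1 * w q * s 0 + q 0 * w q * s 1) * w s ≠ 0) ∧
        ((-q 1 * w q * s 0 + q 0 * w q * s 1) * w s < 0 ↔ κ s < κ q) := by
      intro q hq
      rcases lt_trichotomy (κ s) (κ q) with h | h | h
      · have := hsign q (hQS hq) s hs.1 h
        have h' : (-q 1 * w q * s 0 + q 0 * w q * s 1) * w s < 0 := by linarith
        exact ⟨h'.ne, iff_of_true h' h⟩
      · exact absurd (hκ hs.1 (hQS hq) h ▸ hq) hs.2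
      · have := hsign s hs.1 q (hQS hq) h
        have h' : 0 < (-q 1 * w q * s 0 + q 0 * w q * s 1) * w s := by linarith
        exact ⟨h'.ne', iff_of_false h'.not_gt h.not_gt⟩
    have hws : 0 < w s ^ m := hm.pow_pos (hw s hs.1)
    have key : (∑ i, g i * HV2 m s i) * w s ^ m =
        ∏ q ∈ Q, (-q 1 * w q * s 0 + q 0 * w q * s 1) * w s := by
      rw [hg, Finset.prod_mul_distrib, Finset.prod_const, hQ]
    have hne : (∑ i, g i * HV2 m s i) * w s ^ m ≠ 0 := by
      rw [key, Finset.prod_ne_zero_iff]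
      exact fun q hq => (hsg q hq).1
    refine ⟨left_ne_zero_of_mul hne, ?_⟩
    rw [← mul_pos_iff_of_pos_right hws, key,
      prod_pos_iff_even_card_neg Q _ fun q hq => (hsg q hq).1,
      Finset.filter_congr fun q hq => (hsg q hq).2]

theorem form_ne_one_of_affineIndependent (m : ℕ) (P : Finset (Fin 2 → ℝ)) (hP : P.card = m + 1)
    (s : Fin 2 → ℝ) (hs : s ∉ P)
    (haff : AffineIndependent ℝ
      (fun t : ((insert s P : Finset (Fin 2 → ℝ)) : Set (Fin 2 → ℝ)) => HV2 m t))
    (a : Fin (m + 1) → ℝ) (ha : ∀ p ∈ P, ∑ i, a i * HV2 m p i = 1) :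
    ∑ i, a i * HV2 m s i ≠ 1 := by
  classical
  intro h1
  have hcard : Module.finrank ℝ (Fin (m + 1) → ℝ) + 1 =
      Fintype.card ((insert s P : Finset (Fin 2 → ℝ)) : Set (Fin 2 → ℝ)) := by
    simp [hs, hP]
  have hspan := haff.affineSpan_eq_top_iff_card_eq_finrank_add_one.2 hcard.symm
  let L : (Fin (m + 1) → ℝ) →ₗ[ℝ] ℝ := ∑ i, a i • LinearMap.proj i
  have hL : ∀ y, L y = ∑ i, a i * y i := fun y => by simp [L]
  have hle : affineSpan ℝ (Set.range fun t :
      ((insert s P : Finset (Fin 2 → ℝ)) : Set (Fin 2 → ℝ)) => HV2 m t) ≤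
      (AffineSubspace.mk' (1 : ℝ) ⊥).comap L.toAffineMap := by
    rw [affineSpan_le]
    rintro _ ⟨⟨t, ht⟩, rfl⟩
    rw [Finset.mem_coe, Finset.mem_insert] at ht
    simp only [AffineSubspace.coe_comap, Set.mem_preimage, LinearMap.coe_toAffineMap, hL,
      SetLike.mem_coe, AffineSubspace.mem_mk', Submodule.mem_bot, vsub_eq_sub, sub_eq_zero]
    rcases ht with rfl | ht
    · exact h1
    · exact ha t ht
  rw [hspan] at hle
  have := hle (AffineSubspace.mem_top ℝ _ (0 : Fin (m + 1) → ℝ))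
  simp [AffineSubspace.mem_mk'] at this

open Finset in
/-- Rotating the forms through `Q` in a linear pencil, with signs recording on which side
of the form vanishing on `Q` each point lies. -/
theorem sum_pencil (m : ℕ) (hm : Even m) {K : Type*} [LinearOrder K] (S : Finset (Fin 2 → ℝ))
    (hdet : ∀ p ∈ S, ∀ q ∈ S, p ≠ q → q 0 * p 1 - q 1 * p 0 ≠ 0)
    (κ : (Fin 2 → ℝ) → K) (w : (Fin 2 → ℝ) → ℝ) (hκ : Set.InjOn κ S)
    (hw : ∀ p ∈ S, w p ≠ 0)
    (hsign : ∀ p ∈ S, ∀ q ∈ S, κ q < κ p → 0 < (q 0 * p 1 - q 1 * p 0) * w q * w p)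
    (F : Finset (Fin 2 → ℝ) → Fin (m + 1) → ℝ)
    (hF : ∀ P ⊆ S, #P = m + 1 → ∀ p ∈ P, ∑ i, F P i * HV2 m p i = 1)
    (hne : ∀ P ⊆ S, #P = m + 1 → ∀ s ∈ S \ P, ∑ i, F P i * HV2 m s i ≠ 1)
    (Q : Finset (Fin 2 → ℝ)) (hQS : Q ⊆ S) (hQ : #Q = m) (φ : ℕ → ℤ) :
    ∑ s ∈ S \ Q, (if Even #{q ∈ Q | κ s < κ q} then 1 else -1) *
        φ #{r ∈ S \ insert s Q | ∑ i, F (insert s Q) i * HV2 m r i < 1} =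
      ∑ j ∈ range #{s ∈ S \ Q | Even #{q ∈ Q | κ s < κ q}}, φ j -
        ∑ j ∈ range #{s ∈ S \ Q | ¬ Even #{q ∈ Q | κ s < κ q}}, φ j := by
  obtain hempty | ⟨s₀, hs₀⟩ := (S \ Q).eq_empty_or_nonempty
  · simp [hempty]
  obtain ⟨g, hg0, hg⟩ := exists_form_vanishing_sign m hm S κ w hκ hw hsign Q hQS hQ
  have hins : ∀ s ∈ S \ Q, insert s Q ⊆ S ∧ #(insert s Q) = m + 1 := fun s hs =>
    ⟨insert_subset (mem_sdiff.1 hs).1 hQS, by rw [card_insert_of_notMem (mem_sdiff.1 hs).2, hQ]⟩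
  set G : (Fin 2 → ℝ) → ℝ := fun s => ∑ i, g i * HV2 m s i with hG
  set H : (Fin 2 → ℝ) → ℝ := fun s => ∑ i, F (insert s₀ Q) i * HV2 m s i with hH
  set t : (Fin 2 → ℝ) → ℝ := fun s => (1 - H s) / G s with ht
  have hFt : ∀ s ∈ S \ Q, ∀ r, ∑ i, F (insert s Q) i * HV2 m r i = H r + t s * G r := by
    intro s hs
    have hexp : ∀ r, ∑ i, (F (insert s₀ Q) + t s • g) i * HV2 m r i = H r + t s * G r := by
      intro r
      simp only [hH, hG, Pi.add_apply, Pi.smul_apply, smul_eq_mul, add_mul, sum_add_distrib,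
        mul_sum, mul_assoc]
    have := (existsUnique_form_interpolating m (insert s Q) (hins s hs).2
      (fun p hp q hq => hdet p ((hins s hs).1 hp) q ((hins s hs).1 hq)) fun _ => 1).unique
      (hF _ (hins s hs).1 (hins s hs).2) (y₂ := F (insert s₀ Q) + t s • g) (by
        intro p hp
        rw [hexp]
        rcases mem_insert.1 hp with rfl | hp
        · rw [show t p * G p = 1 - H p from div_mul_cancel₀ _ (hg p hs).1]
          ring
        · rw [show G p = 0 from hg0 p hp, mul_zero, add_zero]
          exact hF _ (hins s₀ hs₀).1 (hins s₀ hs₀).2 p (mem_insert_of_mem hp))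
    intro r
    rw [this, hexp]
  have hH' : ∀ r ∈ S \ Q, H r = 1 - t r * G r := by
    intro r hr
    rw [show t r * G r = 1 - H r from div_mul_cancel₀ _ (hg r hr).1]
    ring
  have htinj : Set.InjOn t (S \ Q : Finset _) := by
    intro s hs r hr hsr
    by_contra hsr'
    refine hne _ (hins s hs).1 (hins s hs).2 r ?_ ?_
    · rw [mem_coe, mem_sdiff] at hr
      exact mem_sdiff.2 ⟨hr.1, by simp [hr.2, Ne.symm hsr']⟩
    · rw [hFt s hs, hH' r hr, hsr]
      ring
  rw [← sum_sign_mul_crossings t _ _ htinj]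
  refine sum_congr rfl fun s hs => ?_
  congr 3
  ext r
  simp only [mem_filter, mem_sdiff, mem_insert, not_or]
  constructor
  · rintro ⟨⟨hr, -, hrQ⟩, hlt⟩
    have hrR : r ∈ S \ Q := mem_sdiff.2 ⟨hr, hrQ⟩
    refine ⟨⟨hr, hrQ⟩, ?_⟩
    rw [hFt s hs, hH' r hrR] at hlt
    have hlt' : (t s - t r) * G r < 0 := by linarith
    rw [← (hg r hrR).2]
    rcases lt_or_gt_of_ne (hg r hrR).1 with h | h
    · exact Or.inr ⟨h.not_gt, sub_pos.1 (pos_of_mul_neg_left hlt' h.le)⟩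
    · exact Or.inl ⟨h, sub_neg.1 (neg_of_mul_neg_left hlt' h.le)⟩
  · rintro ⟨⟨hr, hrQ⟩, hor⟩
    have hrR : r ∈ S \ Q := mem_sdiff.2 ⟨hr, hrQ⟩
    refine ⟨⟨hr, ?_, hrQ⟩, ?_⟩
    · rintro rfl
      simp at hor
    · rw [hFt s hs, hH' r hrR]
      have hlt' : (t s - t r) * G r < 0 := by
        rw [← (hg r hrR).2] at hor
        rcases hor with ⟨h, h'⟩ | ⟨h, h'⟩
        · exact mul_neg_of_neg_of_pos (sub_neg.2 h') h
        · exact mul_neg_of_pos_of_neg (sub_pos.2 h') (lt_of_le_of_ne (not_lt.1 h) (hg r hrR).1)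
      linarith

open Finset in
theorem card_filter_card_form_lt_one (m : ℕ) (hm : Even m) (S : Finset (Fin 2 → ℝ))
    (hdet : ∀ p ∈ S, ∀ q ∈ S, p ≠ q → q 0 * p 1 - q 1 * p 0 ≠ 0)
    (F : Finset (Fin 2 → ℝ) → Fin (m + 1) → ℝ)
    (hF : ∀ P ⊆ S, #P = m + 1 → ∀ p ∈ P, ∑ i, F P i * HV2 m p i = 1)
    (hne : ∀ P ⊆ S, #P = m + 1 → ∀ s ∈ S \ P, ∑ i, F P i * HV2 m s i ≠ 1)
    (k r : ℕ) (hS : #S = m + 1 + k + r) (hS1 : 1 < #S) :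
    #{P ∈ powersetCard (m + 1) S | #{s ∈ S \ P | ∑ i, F P i * HV2 m s i < 1} = k} =
      (m / 2 + 1).multichoose k * (m / 2 + 1).multichoose r := by
  obtain ⟨κ, w, hκ, hw, hsign⟩ := exists_direction_order S hdet hS1
  set φ : ℕ → ℤ := fun j => if j = k then 1 else 0 with hφ
  have hφsum : ∀ a, ∑ j ∈ range a, φ j = if k < a then 1 else 0 := by
    intro a
    simp [hφ]
  have hP : ∀ P ∈ powersetCard (m + 1) S,
      ∑ p ∈ P, (if Even #{q ∈ P | κ p < κ q} then (1 : ℤ) else -1) = 1 := by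
    intro P hP
    rw [mem_powersetCard] at hP
    rw [sum_neg_one_pow_card_gt κ P (hκ.mono (by exact_mod_cast hP.1)), if_neg]
    rw [hP.2, Nat.even_add_one, not_not]
    exact hm
  have hM : ∀ Q ∈ powersetCard m S, #{s ∈ S \ Q | Even #{q ∈ Q | κ s < κ q}} +
      #{s ∈ S \ Q | ¬ Even #{q ∈ Q | κ s < κ q}} = k + r + 1 := by
    intro Q hQ
    rw [mem_powersetCard] at hQ
    rw [card_filter_add_card_filter_not, card_sdiff_of_subset hQ.1, hQ.2]
    omega
  apply Nat.cast_injective (R := ℤ)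
  push_cast
  calc ((#{P ∈ powersetCard (m + 1) S |
          #{s ∈ S \ P | ∑ i, F P i * HV2 m s i < 1} = k} : ℕ) : ℤ)
      = ∑ P ∈ powersetCard (m + 1) S, φ #{s ∈ S \ P | ∑ i, F P i * HV2 m s i < 1} := by
        simp only [hφ, sum_boole]
    _ = ∑ P ∈ powersetCard (m + 1) S, ∑ p ∈ P,
          (if Even #{q ∈ P | κ p < κ q} then (1 : ℤ) else -1) *
            φ #{s ∈ S \ P | ∑ i, F P i * HV2 m s i < 1} := by
        refine sum_congr rfl fun P hP' => ?_
        rw [← sum_mul, hP P hP', one_mul]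
    _ = ∑ Q ∈ powersetCard m S, ∑ s ∈ S \ Q,
          (if Even #{q ∈ Q | κ s < κ q} then (1 : ℤ) else -1) *
            φ #{r ∈ S \ insert s Q | ∑ i, F (insert s Q) i * HV2 m r i < 1} := by
        rw [sum_sigma', sum_sigma']
        refine sum_bij' (fun x _ => ⟨x.1.erase x.2, x.2⟩) (fun x _ => ⟨insert x.2 x.1, x.2⟩)
          ?_ ?_ ?_ ?_ ?_
        · rintro ⟨P, p⟩ h
          simp only [mem_sigma, mem_powersetCard, mem_sdiff] at h ⊢
          refine ⟨⟨(erase_subset _ _).trans h.1.1, ?_⟩, h.1.1 h.2, by simp⟩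
          rw [card_erase_of_mem h.2, h.1.2, Nat.add_sub_cancel]
        · rintro ⟨Q, s⟩ h
          simp only [mem_sigma, mem_powersetCard, mem_sdiff] at h ⊢
          refine ⟨⟨insert_subset h.2.1 h.1.1, ?_⟩, by simp⟩
          rw [card_insert_of_notMem h.2.2, h.1.2]
        · rintro ⟨P, p⟩ h
          simp only [mem_sigma] at h
          simp [insert_erase h.2]
        · rintro ⟨Q, s⟩ h
          simp only [mem_sigma, mem_sdiff] at h
          simp [erase_insert h.2.2]
        · rintro ⟨P, p⟩ h
          simp only [mem_sigma] at h
          have : {q ∈ P.erase p | κ p < κ q} = {q ∈ P | κ p < κ q} := by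
            rw [filter_erase, erase_eq_of_notMem (by simp)]
          simp only [insert_erase h.2, this]
    _ = ∑ Q ∈ powersetCard m S,
          ((if k < #{s ∈ S \ Q | Even #{q ∈ Q | κ s < κ q}} then 1 else 0) -
            (if k < #{s ∈ S \ Q | ¬ Even #{q ∈ Q | κ s < κ q}} then 1 else 0)) := by
        refine sum_congr rfl fun Q hQ => ?_
        rw [mem_powersetCard] at hQ
        rw [sum_pencil m hm S hdet κ w hκ hw hsign F hF hne Q hQ.1 hQ.2, hφsum, hφsum]
    _ = ∑ x ∈ antidiagonal (k + r + 1),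
          ((m / 2 + 1).multichoose x.1 * (m / 2).multichoose x.2 : ℤ) *
            ((if k < x.1 then 1 else 0) - (if k < x.2 then 1 else 0)) := by
        rw [← sum_fiberwise_of_maps_to (t := antidiagonal (k + r + 1))
          (g := fun Q => (#{s ∈ S \ Q | Even #{q ∈ Q | κ s < κ q}},
            #{s ∈ S \ Q | ¬ Even #{q ∈ Q | κ s < κ q}}))
          fun Q hQ => HasAntidiagonal.mem_antidiagonal.2 (hM Q hQ)]
        refine sum_congr rfl fun x hx => ?_
        have hcount := card_powersetCard_filter_parity κ S hκ m x.1 x.2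
          (by rw [HasAntidiagonal.mem_antidiagonal] at hx; omega)
        rw [show (m + 1) / 2 = m / 2 by obtain ⟨l, rfl⟩ := hm; omega] at hcount
        rw [← Nat.cast_mul, ← hcount, ← nsmul_eq_mul, ← sum_const]
        simp only [Prod.ext_iff]
        refine sum_congr rfl fun Q hQ => ?_
        rw [(mem_filter.1 hQ).2.1, (mem_filter.1 hQ).2.2]
    _ = ∑ x ∈ antidiagonal (k + r + 1), (if k < x.1 then
          (((m / 2 + 1).multichoose x.1 * (m / 2).multichoose x.2 : ℤ) -
            (m / 2).multichoose x.1 * (m / 2 + 1).multichoose x.2) else 0) := by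
        simp only [mul_sub, sum_sub_distrib]
        rw [← Finset.Nat.sum_antidiagonal_swap (f := fun x : ℕ × ℕ =>
          ((m / 2 + 1).multichoose x.1 * (m / 2).multichoose x.2 : ℤ) *
            (if k < x.2 then 1 else 0)), ← sum_sub_distrib]
        refine sum_congr rfl fun x _ => ?_
        by_cases h : k < x.1 <;> simp [h]
        ring
    _ = _ := by
        rw [sum_antidiagonal_ite_lt k r fun i j =>
          (((m / 2 + 1).multichoose i * (m / 2).multichoose j : ℤ) -
            (m / 2).multichoose i * (m / 2 + 1).multichoose j),
          sum_antidiagonal_multichoose]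

/-- Exact count of `H_m²`-`k`-facets for even `m`.  If `S` is a set of `n` points of
`ℝ²` in general position with respect to degree-`m` homogeneous polynomials (no two
distinct points on a common line through the origin, and `HV_m²(S)` in general linear
position in `ℝ^{m+1}`), then for every `0 ≤ k ≤ n - m - 1` the number of pairs `(P, O)`,
where `P ⊆ S` has exactly `m+1` elements and `O` is one of the two open half-spaces
bounded by the affine hyperplane spanned by `HV_m²(P)`, such that `O` contains exactly
`k` of the points `HV_m²(s)`, `s ∈ S \ P`, is `2·C(k+m/2, m/2)·C(n-k-m/2-1, m/2)`. -/
theorem homogeneous_kfacet_count (m : ℕ) (hm : 0 < m) (hmeven : Even m)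
    (n k : ℕ) (S : Finset (Fin 2 → ℝ)) (hcard : S.card = n)
    (hgen1 : ∀ p ∈ S, ∀ q ∈ S, p ≠ q → LinearIndependent ℝ ![p, q])
    (hgen2 : ∀ T ⊆ S, T.card ≤ m + 2 →
      AffineIndependent ℝ (fun t : (T : Set (Fin 2 → ℝ)) => HV2 m t))
    (hk : k + m + 1 ≤ n) :
    Set.ncard {PO : Finset (Fin 2 → ℝ) × Set (Fin (m + 1) → ℝ) |
      PO.1 ⊆ S ∧ PO.1.card = m + 1 ∧
      (∃ (a : Fin (m + 1) → ℝ) (c : ℝ), a ≠ 0 ∧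
        (∀ p ∈ PO.1, ∑ i, a i * HV2 m p i = c) ∧
        PO.2 = {y : Fin (m + 1) → ℝ | ∑ i, a i * y i < c}) ∧
      Set.ncard {s : Fin 2 → ℝ | s ∈ S ∧ s ∉ PO.1 ∧ HV2 m s ∈ PO.2} = k} =
    2 * (k + m / 2).choose (m / 2) * (n - k - m / 2 - 1).choose (m / 2) := by
  classical
  have hdet : ∀ p ∈ S, ∀ q ∈ S, p ≠ q → q 0 * p 1 - q 1 * p 0 ≠ 0 := by
    intro p hp q hq hpq h
    have hli := LinearIndependent.pair_iff.1 (hgen1 p hp q hq hpq)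
    have h0 := hli (q 0) (-p 0) (by ext i; fin_cases i <;> simp <;> linarith)
    have h1 := hli (q 1) (-p 1) (by ext i; fin_cases i <;> simp <;> linarith)
    have hp0 : p = 0 := by ext i; fin_cases i <;> simp <;> linarith
    simpa using hli 1 0 (by simp [hp0])
  have huniq : ∀ P ⊆ S, P.card = m + 1 → ∀ c : ℝ,
      ∃! a : Fin (m + 1) → ℝ, ∀ p ∈ P, ∑ i, a i * HV2 m p i = c := fun P hP hPc c =>
    existsUnique_form_interpolating m P hPc (fun p hp q hq => hdet p (hP hp) q (hP hq)) fun _ => c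
  have hex : ∀ P : Finset (Fin 2 → ℝ), ∃ a : Fin (m + 1) → ℝ,
      P ⊆ S → P.card = m + 1 → ∀ p ∈ P, ∑ i, a i * HV2 m p i = 1 := by
    intro P
    by_cases h : P ⊆ S ∧ P.card = m + 1
    · obtain ⟨a, ha, -⟩ := huniq P h.1 h.2 1
      exact ⟨a, fun _ _ => ha⟩
    · exact ⟨0, fun h1 h2 => absurd ⟨h1, h2⟩ h⟩
  choose F hF using hex
  have hne : ∀ P ⊆ S, P.card = m + 1 → ∀ s ∈ S \ P, ∑ i, F P i * HV2 m s i ≠ 1 := by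
    intro P hP hPc s hs
    rw [Finset.mem_sdiff] at hs
    exact form_ne_one_of_affineIndependent m P hPc s hs.2
      (hgen2 _ (Finset.insert_subset hs.1 hP) (by rw [Finset.card_insert_of_notMem hs.2, hPc]))
      (F P) (hF P hP hPc)
  obtain ⟨r, hr⟩ : ∃ r, S.card = m + 1 + k + r := ⟨n - (m + 1 + k), by omega⟩
  set lo : Finset (Fin 2 → ℝ) → Set (Fin (m + 1) → ℝ) := fun P => {y | ∑ i, F P i * y i < 1}
    with hlo
  set hi : Finset (Fin 2 → ℝ) → Set (Fin (m + 1) → ℝ) := fun P => {y | 1 < ∑ i, F P i * y i}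
    with hhi
  set A := (Finset.powersetCard (m + 1) S).filter fun P =>
    ((S \ P).filter fun s => ∑ i, F P i * HV2 m s i < 1).card = k with hA
  set B := (Finset.powersetCard (m + 1) S).filter fun P =>
    ((S \ P).filter fun s => ∑ i, F P i * HV2 m s i < 1).card = r with hB
  have hncard : ∀ (P : Finset (Fin 2 → ℝ)) (O : Set (Fin (m + 1) → ℝ)),
      Set.ncard {s : Fin 2 → ℝ | s ∈ S ∧ s ∉ P ∧ HV2 m s ∈ O} =
        ((S \ P).filter fun s => HV2 m s ∈ O).card := by
    intro P O
    rw [← Set.ncard_coe_finset]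
    congr 1
    ext s
    simp [and_assoc]
  have hlow : ∀ P, Set.ncard {s : Fin 2 → ℝ | s ∈ S ∧ s ∉ P ∧ HV2 m s ∈ lo P} =
      ((S \ P).filter fun s => ∑ i, F P i * HV2 m s i < 1).card := fun P =>
    (hncard P (lo P)).trans (by congr)
  have hsum : ∀ P ⊆ S, P.card = m + 1 →
      ((S \ P).filter fun s => ∑ i, F P i * HV2 m s i < 1).card +
        Set.ncard {s : Fin 2 → ℝ | s ∈ S ∧ s ∉ P ∧ HV2 m s ∈ hi P} = k + r := by
    intro P hP hPc
    rw [hncard, Finset.filter_congr (p := fun s => HV2 m s ∈ hi P)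
        (q := fun s => ¬ ∑ i, F P i * HV2 m s i < 1) fun s hs => ?_,
      Finset.card_filter_add_card_filter_not, Finset.card_sdiff_of_subset hP, hPc, hr]
    · omega
    · exact ⟨fun h => not_lt.2 (le_of_lt h),
        fun h => lt_of_le_of_ne (not_lt.1 h) (hne P hP hPc s hs).symm⟩
  have hF0 : ∀ P ⊆ S, P.card = m + 1 → F P ≠ 0 := by
    intro P hP hPc h0
    obtain ⟨p, hp⟩ := Finset.card_pos.1 (by omega : 0 < P.card)
    simpa [h0] using hF P hP hPc p hp
  have hset : {PO : Finset (Fin 2 → ℝ) × Set (Fin (m + 1) → ℝ) |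
      PO.1 ⊆ S ∧ PO.1.card = m + 1 ∧
      (∃ (a : Fin (m + 1) → ℝ) (c : ℝ), a ≠ 0 ∧
        (∀ p ∈ PO.1, ∑ i, a i * HV2 m p i = c) ∧
        PO.2 = {y : Fin (m + 1) → ℝ | ∑ i, a i * y i < c}) ∧
      Set.ncard {s : Fin 2 → ℝ | s ∈ S ∧ s ∉ PO.1 ∧ HV2 m s ∈ PO.2} = k} =
      ((A.image fun P => (P, lo P)) ∪ (B.image fun P => (P, hi P)) : Finset _) := by
    ext ⟨P, O⟩
    simp only [Set.mem_ofPred_eq, Finset.coe_union, Finset.coe_image, Set.mem_union, Set.mem_image,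
      Finset.mem_coe, Prod.mk.injEq, hA, hB, Finset.mem_filter, Finset.mem_powersetCard]
    constructor
    · rintro ⟨hP, hPc, ⟨a, c, ha0, ha, rfl⟩, hkO⟩
      have hac : a = c • F P := (huniq P hP hPc c).unique ha fun p hp => by
        simp only [Pi.smul_apply, smul_eq_mul, mul_assoc, ← Finset.mul_sum, hF P hP hPc p hp,
          mul_one]
      have hy : ∀ y : Fin (m + 1) → ℝ, ∑ i, a i * y i = c * ∑ i, F P i * y i := by
        intro y
        simp only [hac, Pi.smul_apply, smul_eq_mul, mul_assoc, ← Finset.mul_sum]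
      have hc : c ≠ 0 := by
        rintro rfl
        exact ha0 (by rw [hac, zero_smul])
      rcases lt_or_gt_of_ne hc with hc | hc
      · have hO : hi P = {y | ∑ i, a i * y i < c} := by
          ext y
          simp only [hhi, Set.mem_ofPred_eq, hy]
          constructor <;> intro h <;> nlinarith
        have := hsum P hP hPc
        rw [hO, hkO] at this
        exact Or.inr ⟨P, ⟨⟨hP, hPc⟩, by omega⟩, rfl, hO⟩
      · have hO : lo P = {y | ∑ i, a i * y i < c} := by
          ext y
          simp only [hlo, Set.mem_ofPred_eq, hy]
          constructor <;> intro h <;> nlinarith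
        rw [← hO, hlow] at hkO
        exact Or.inl ⟨P, ⟨⟨hP, hPc⟩, hkO⟩, rfl, hO⟩
    · rintro (⟨P, ⟨⟨hP, hPc⟩, hkP⟩, rfl, rfl⟩ | ⟨P, ⟨⟨hP, hPc⟩, hkP⟩, rfl, rfl⟩)
      · exact ⟨hP, hPc, ⟨F P, 1, hF0 P hP hPc, hF P hP hPc, rfl⟩, (hlow P).trans hkP⟩
      · refine ⟨hP, hPc, ⟨-F P, -1, neg_ne_zero.2 (hF0 P hP hPc), fun p hp => ?_, ?_⟩, ?_⟩
        · simp [hF P hP hPc p hp]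
        · ext y
          simp [hhi]
        · have := hsum P hP hPc
          omega
  have hdisj : Disjoint (A.image fun P => (P, lo P)) (B.image fun P => (P, hi P)) := by
    rw [Finset.disjoint_left]
    intro x hx hx'
    obtain ⟨P, -, rfl⟩ := Finset.mem_image.1 hx
    obtain ⟨P', -, h⟩ := Finset.mem_image.1 hx'
    obtain ⟨rfl, h⟩ := Prod.mk.inj h
    have h0 : (0 : Fin (m + 1) → ℝ) ∈ lo P' := by simp [hlo]
    rw [← h] at h0
    norm_num [hhi] at h0
  have hAcard := card_filter_card_form_lt_one m hmeven S hdet F hF hne k r hr (by omega)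
  have hBcard := card_filter_card_form_lt_one m hmeven S hdet F hF hne r k (by omega) (by omega)
  have hn : n - k - m / 2 - 1 = r + m / 2 := by
    obtain ⟨l, rfl⟩ := hmeven
    omega
  rw [hset, Set.ncard_coe_finset, Finset.card_union_of_disjoint hdisj,
    Finset.card_image_of_injective _ fun P P' h => (Prod.mk.inj h).1,
    Finset.card_image_of_injective _ fun P P' h => (Prod.mk.inj h).1, hAcard, hBcard, hn]
  have hmc : ∀ j, (m / 2 + 1).multichoose j = (j + m / 2).choose (m / 2) := by
    intro j
    rw [Nat.multichoose_eq, show m / 2 + 1 + j - 1 = j + m / 2 by omega, Nat.choose_symm_add]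
  rw [hmc, hmc]
  ring
end

section
/- Let m ≥ 2 be an even integer, d ≥ 1, and let S be a finite set of points in ℝ^d such that the image V_{m/2}^d(S) of S under the degree-(m/2) Veronese map is in general linear position in ℝ^{C(d+m/2, m/2) − 1}. Then V_m^d(S) is a (C(m/2+d, m/2) − 1)-neighborly point set in ℝ^{C(d+m, m) − 1}: for every nonempty subset T ⊆ S with |T| ≤ C(m/2+d, m/2) − 1 there exist a ∈ ℝ^{C(d+m, m) − 1} with a ≠ 0 and c ∈ ℝ such that ⟨a, V_m^d(t)⟩ = c for all t ∈ T and ⟨a, V_m^d(s)⟩ < c for all s ∈ S \ T. -/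
/-- Index type for the degree-`m` Veronese map of `ℝ^d`: exponent vectors of the
non-constant monomials of degree at most `m` in `d` variables. -/
def VeroneseIdx (d m : ℕ) : Type :=
  {α : Fin d → Fin (m + 1) // 1 ≤ ∑ i, (α i : ℕ) ∧ ∑ i, (α i : ℕ) ≤ m}

instance (d m : ℕ) : Fintype (VeroneseIdx d m) :=
  Subtype.fintype _

/-- The monomial `x₁^{α₁} ⋯ x_d^{α_d}` attached to an exponent vector. -/
noncomputable def veroneseMonomial {d m : ℕ} (α : VeroneseIdx d m) (x : Fin d → ℝ) : ℝ :=
  ∏ i, x i ^ ((α.1 i : ℕ))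

/-- The degree-`(m/2)` Veronese map of `ℝ^d` (coordinates indexed by the non-constant
monomials of degree at most `m/2`). -/
noncomputable def veroneseMap (d m : ℕ) (x : Fin d → ℝ) : VeroneseIdx d m → ℝ :=
  fun α => veroneseMonomial α x

/-- The functions on `ℝ^d` given by polynomials of total degree at most `m`. -/
def polyFun (d m : ℕ) : Submodule ℝ ((Fin d → ℝ) → ℝ) :=
  Submodule.span ℝ {f | ∃ k : Fin d → ℕ, ∑ i, k i ≤ m ∧ f = fun x => ∏ i, x i ^ k i}

theorem mul_mem_polyFun {d m n : ℕ} {f g : (Fin d → ℝ) → ℝ}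
    (hf : f ∈ polyFun d m) (hg : g ∈ polyFun d n) : f * g ∈ polyFun d (m + n) := by
  have h := Submodule.mul_mem_mul hf hg
  rw [polyFun, polyFun, Submodule.span_mul_span] at h
  refine Submodule.span_mono ?_ h
  rintro _ ⟨_, ⟨k, hk, rfl⟩, _, ⟨l, hl, rfl⟩, rfl⟩
  refine ⟨k + l, ?_, ?_⟩
  · simp only [Pi.add_apply, Finset.sum_add_distrib]
    omega
  · funext x
    simp [pow_add, Finset.prod_mul_distrib]

theorem const_mem_polyFun (d m : ℕ) (c : ℝ) : (fun _ => c) ∈ polyFun d m := by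
  have h : (fun _ => 1 : (Fin d → ℝ) → ℝ) ∈ polyFun d m :=
    Submodule.subset_span ⟨0, by simp, by simp⟩
  convert Submodule.smul_mem _ c h using 1
  funext x
  simp

theorem dual_veroneseMap_mem_polyFun (d m : ℕ) (φ : (VeroneseIdx d m → ℝ) →ₗ[ℝ] ℝ) :
    (fun x => φ (veroneseMap d m x)) ∈ polyFun d m := by
  classical
  have h : (fun x => φ (veroneseMap d m x)) =
      ∑ α, φ (fun β => if α = β then 1 else 0) • fun x => veroneseMonomial α x := by
    funext x
    rw [LinearMap.pi_apply_eq_sum_univ φ]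
    simp [veroneseMap, mul_comm]
  rw [h]
  exact Submodule.sum_mem _ fun α _ => Submodule.smul_mem _ _ <|
    Submodule.subset_span ⟨fun i => α.1 i, α.2.2, rfl⟩

/-- The affine function with linear coefficients `p.1` and constant term `p.2`, composed with the
Veronese map. -/
noncomputable def veroneseEval {ι : Type*} [Fintype ι] {d m : ℕ} (e : ι → VeroneseIdx d m) :
    (ι → ℝ) × ℝ →ₗ[ℝ] ((Fin d → ℝ) → ℝ) where
  toFun p x := ∑ j, p.1 j * veroneseMonomial (e j) x + p.2
  map_add' p q := by
    funext x
    simp only [Prod.fst_add, Prod.snd_add, Pi.add_apply, add_mul, Finset.sum_add_distrib]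
    ring
  map_smul' r p := by
    funext x
    simp [mul_add, Finset.mul_sum, mul_assoc]

theorem polyFun_le_range_veroneseEval {ι : Type*} [Fintype ι] {d m : ℕ}
    (e : ι ≃ VeroneseIdx d m) : polyFun d m ≤ LinearMap.range (veroneseEval e) := by
  classical
  refine Submodule.span_le.2 ?_
  rintro _ ⟨k, hk, rfl⟩
  rcases Nat.eq_zero_or_pos (∑ i, k i) with h0 | h0
  · have h1 : ∀ i, k i = 0 := by simpa using h0
    exact ⟨(0, 1), by funext x; simp [veroneseEval, h1]⟩
  · have hlt : ∀ i, k i < m + 1 := fun i =>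
      Nat.lt_succ_of_le ((Finset.single_le_sum (fun j _ => Nat.zero_le (k j))
        (Finset.mem_univ i)).trans hk)
    obtain ⟨j, hj⟩ := e.surjective ⟨fun i => ⟨k i, hlt i⟩, h0, hk⟩
    refine ⟨(Pi.single j 1, 0), ?_⟩
    funext x
    simp [veroneseEval, Pi.single_apply, veroneseMonomial, hj]

/-- An affinely independent finite family admits, for each of its points, an affine function
vanishing at all the other points only. -/
theorem exists_polyFun_vanishing {d n : ℕ} {T : Finset (Fin d → ℝ)} (hT : T.Nonempty)
    {s : Fin d → ℝ} (hs : s ∉ T)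
    (h : AffineIndependent ℝ
      (fun t : ((insert s T : Finset (Fin d → ℝ)) : Set (Fin d → ℝ)) => veroneseMap d n t)) :
    ∃ g ∈ polyFun d n, (∀ t ∈ T, g t = 0) ∧ g s ≠ 0 := by
  obtain ⟨t₀, ht₀⟩ := hT
  have hns : veroneseMap d n s ∉ affineSpan ℝ (veroneseMap d n '' (T : Set (Fin d → ℝ))) := by
    have := h.notMem_affineSpan_sdiff ⟨s, by simp⟩ Set.univ
    refine fun hmem => this (affineSpan_mono ℝ ?_ hmem)
    rintro _ ⟨t, ht, rfl⟩
    refine ⟨⟨t, by simp [Finset.mem_coe.1 ht]⟩, ⟨trivial, ?_⟩, rfl⟩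
    intro h'
    have hts : t = s := congrArg Subtype.val h'
    exact hs (hts ▸ ht)
  have hmem₀ := subset_affineSpan ℝ _ (Set.mem_image_of_mem (veroneseMap d n) ht₀)
  set A := affineSpan ℝ (veroneseMap d n '' (T : Set (Fin d → ℝ)))
  have hdir : veroneseMap d n s - veroneseMap d n t₀ ∉ A.direction := fun h' =>
    hns (by simpa using AffineSubspace.vadd_mem_of_mem_direction h' hmem₀)
  obtain ⟨φ, hφ, hker⟩ := Submodule.exists_le_ker_of_notMem hdir
  refine ⟨fun x => φ (veroneseMap d n x) - φ (veroneseMap d n t₀),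
    Submodule.sub_mem _ (dual_veroneseMap_mem_polyFun d n φ) (const_mem_polyFun d n _),
    fun t ht => ?_, ?_⟩
  · have := hker (AffineSubspace.vsub_mem_direction
      (subset_affineSpan ℝ _ (Set.mem_image_of_mem (veroneseMap d n) ht)) hmem₀)
    simpa using this
  · simpa using hφ

/-- Let `m ≥ 2` be even and `S ⊆ ℝ^d` finite with `V_{m/2}^d(S)` in general linear
position in `ℝ^{C(d+m/2, m/2) - 1}` (every subset of at most `C(d+m/2, m/2)` points is
affinely independent).  Then `V_m^d(S)` is a `(C(m/2+d, m/2) - 1)`-neighborly point set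
in `ℝ^{C(d+m, m) - 1}` (the coordinates being all non-constant monomials of degree at
most `m`, listed in some fixed order given by the bijection `e`). -/
theorem veronese_neighborly (d m : ℕ) (hd : 1 ≤ d) (hm : 2 ≤ m) (hmeven : Even m)
    (e : Fin ((d + m).choose m - 1) ≃ VeroneseIdx d m)
    (S : Finset (Fin d → ℝ))
    (hgen : ∀ T ⊆ S, T.card ≤ (d + m / 2).choose (m / 2) →
      AffineIndependent ℝ (fun t : (T : Set (Fin d → ℝ)) => veroneseMap d (m / 2) t)) :
    ∀ T ⊆ S, T.Nonempty → T.card ≤ (m / 2 + d).choose (m / 2) - 1 →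
      ∃ (a : Fin ((d + m).choose m - 1) → ℝ) (c : ℝ), a ≠ 0 ∧
        (∀ t ∈ T, ∑ j, a j * veroneseMonomial (e j) t = c) ∧
        (∀ s ∈ S \ T, ∑ j, a j * veroneseMonomial (e j) s < c) := by
  classical
  intro T hTS hTne hTcard
  have hchoose : 0 < (m / 2 + d).choose (m / 2) := Nat.choose_pos (Nat.le_add_right _ _)
  obtain ⟨t₀, ht₀⟩ := hTne
  rcases (S \ T).eq_empty_or_nonempty with hE | ⟨s₀, hs₀⟩
  · let R : (Fin ((d + m).choose m - 1) → ℝ) × ℝ →ₗ[ℝ] (T → ℝ) :=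
      LinearMap.funLeft ℝ ℝ (Subtype.val : T → Fin d → ℝ) ∘ₗ veroneseEval e
    have hle : (m / 2 + d).choose (m / 2) ≤ (d + m).choose m := by
      rw [Nat.choose_symm_add, add_comm, ← Nat.choose_symm_add]
      exact Nat.choose_le_choose d (by omega)
    have hker : LinearMap.ker R ≠ ⊥ := by
      apply LinearMap.ker_ne_bot_of_finrank_lt
      simp
      omega
    obtain ⟨⟨a, b⟩, hp, hne⟩ := Submodule.exists_mem_ne_zero_of_ne_bot hker
    have hval : ∀ t ∈ T, ∑ j, a j * veroneseMonomial (e j) t + b = 0 := fun t ht =>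
      congrFun (LinearMap.mem_ker.1 hp) ⟨t, ht⟩
    refine ⟨a, -b, ?_, fun t ht => eq_neg_of_add_eq_zero_left (hval t ht), by simp [hE]⟩
    rintro rfl
    have hb : b = 0 := by simpa using hval t₀ ht₀
    exact hne (by simp [hb])
  · have hg : ∀ s ∈ S \ T, ∃ g ∈ polyFun d (m / 2), (∀ t ∈ T, g t = 0) ∧ g s ≠ 0 := by
      intro s hs
      obtain ⟨hsS, hsT⟩ := Finset.mem_sdiff.1 hs
      refine exists_polyFun_vanishing ⟨t₀, ht₀⟩ hsT
        (hgen _ (Finset.insert_subset hsS hTS) ?_)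
      rw [Finset.card_insert_of_notMem hsT, add_comm d]
      omega
    choose! g hgmem hgT hgs using hg
    have hQ : -∑ s ∈ S \ T, g s * g s ∈ polyFun d m := by
      refine Submodule.neg_mem _ (Submodule.sum_mem _ fun s hs => ?_)
      have hm2 : m / 2 + m / 2 = m := by
        obtain ⟨k, rfl⟩ := hmeven
        omega
      exact hm2 ▸ mul_mem_polyFun (hgmem s hs) (hgmem s hs)
    obtain ⟨⟨a, b⟩, hab⟩ := polyFun_le_range_veroneseEval e hQ
    have hval : ∀ x, ∑ j, a j * veroneseMonomial (e j) x + b = -∑ s ∈ S \ T, g s x * g s x :=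
      fun x => by simpa [veroneseEval] using congrFun hab x
    have hzero : ∀ t ∈ T, ∑ j, a j * veroneseMonomial (e j) t = -b := fun t ht => by
      have : ∑ s ∈ S \ T, g s t * g s t = 0 :=
        Finset.sum_eq_zero fun s hs => by simp [hgT s hs t ht]
      linarith [hval t]
    have hneg : ∀ s ∈ S \ T, ∑ j, a j * veroneseMonomial (e j) s < -b := fun s hs => by
      have : 0 < ∑ r ∈ S \ T, g r s * g r s :=
        Finset.sum_pos' (fun r _ => mul_self_nonneg _) ⟨s, hs, mul_self_pos.2 (hgs s hs)⟩
      linarith [hval s]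
    refine ⟨a, -b, ?_, hzero, hneg⟩
    rintro rfl
    have h1 := hzero t₀ ht₀
    have h2 := hneg s₀ hs₀
    simp only [Pi.zero_apply, zero_mul, Finset.sum_const_zero] at h1 h2
    exact h2.ne h1
end

section
/- Let m ≥ 2 be an even integer, d ≥ 1, and let S be a finite set of points in ℝ^d such that no two distinct points of S lie on a common line through the origin. Then every point of the image HV_m^d(S) of S under the degree-m homogeneous Veronese map is a vertex of the convex hull of HV_m^d(S): for every v ∈ S there exist a ∈ ℝ^{C(d+m−1, m)} with a ≠ 0 and c ∈ ℝ such that ⟨a, HV_m^d(v)⟩ = c and ⟨a, HV_m^d(s)⟩ < c for all s ∈ S \ {v}. -/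
/-- Index type for the degree-`m` homogeneous Veronese map of `ℝ^d`: exponent vectors
of the monomials of degree exactly `m` in `d` variables. -/
def HVeroneseIdx (d m : ℕ) : Type :=
  {α : Fin d → Fin (m + 1) // ∑ i, (α i : ℕ) = m}

instance (d m : ℕ) : Fintype (HVeroneseIdx d m) :=
  Subtype.fintype _

/-- The monomial `x₁^{α₁} ⋯ x_d^{α_d}` attached to an exponent vector. -/
noncomputable def hVeroneseMonomial {d m : ℕ} (α : HVeroneseIdx d m) (x : Fin d → ℝ) : ℝ :=
  ∏ i, x i ^ ((α.1 i : ℕ))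

open MvPolynomial in
/-- Evaluation of a homogeneous polynomial of degree `m` is a linear functional of the
homogeneous Veronese map. -/
lemma MvPolynomial.IsHomogeneous.exists_eval_eq_sum_hVeroneseMonomial {d m : ℕ}
    {p : MvPolynomial (Fin d) ℝ} (hp : p.IsHomogeneous m) :
    ∃ b : HVeroneseIdx d m → ℝ, ∀ x, eval x p = ∑ α, b α * hVeroneseMonomial α x := by
  classical
  let f : HVeroneseIdx d m → (Fin d →₀ ℕ) :=
    fun α => Finsupp.equivFunOnFinite.symm fun i => (α.1 i : ℕ)
  have hf : Function.Injective f := fun α β h =>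
    Subtype.ext (_root_.funext fun i => Fin.ext (DFunLike.congr_fun h i))
  refine ⟨fun α => coeff (f α) p, fun x => ?_⟩
  have hsub : p.support ⊆ Finset.univ.image f := by
    intro u hu
    have hdeg : ∑ i, u i = m := by
      rw [← Finsupp.degree_eq_sum, Finsupp.degree_eq_weight_one]
      exact hp (mem_support_iff.1 hu)
    have hlt (i : Fin d) : u i < m + 1 := by
      rw [Nat.lt_succ_iff, ← hdeg]
      exact Finset.single_le_sum (fun _ _ => Nat.zero_le _) (Finset.mem_univ i)
    exact Finset.mem_image.2 ⟨⟨fun i => ⟨u i, hlt i⟩, hdeg⟩, Finset.mem_univ _, by ext; rfl⟩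
  rw [eval_eq', Finset.sum_subset hsub, Finset.sum_image hf.injOn]
  · rfl
  · intro u _ hu
    rw [notMem_support_iff.1 hu, zero_mul]

/-- The sum of the squares of the `2 × 2` minors of two independent vectors is positive. -/
lemma LinearIndependent.sum_sq_minors_pos {ι : Type*} [Fintype ι] {v s : ι → ℝ}
    (h : LinearIndependent ℝ ![v, s]) : 0 < ∑ i, ∑ j, (v i * s j - v j * s i) ^ 2 := by
  have hnn (i : ι) : 0 ≤ ∑ j, (v i * s j - v j * s i) ^ 2 :=
    Finset.sum_nonneg fun _ _ => sq_nonneg _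
  refine (Finset.sum_nonneg fun i _ => hnn i).lt_of_ne' fun h0 => h.ne_zero 0 ?_
  have hminor (i j : ι) : v i * s j - v j * s i = 0 := by
    have hi := (Finset.sum_eq_zero_iff_of_nonneg fun i _ => hnn i).1 h0 i (Finset.mem_univ i)
    exact pow_eq_zero_iff two_ne_zero |>.1 <|
      (Finset.sum_eq_zero_iff_of_nonneg fun _ _ => sq_nonneg _).1 hi j (Finset.mem_univ j)
  funext i
  refine neg_eq_zero.1 (LinearIndependent.pair_iff.1 h (s i) (-v i) ?_).2
  funext j
  simp only [Pi.add_apply, Pi.smul_apply, smul_eq_mul, Pi.zero_apply]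
  linarith [hminor i j]

open MvPolynomial in
/-- For even `m > 0` there is a form of degree `m` vanishing at `v` and positive at every vector
independent of `v`. -/
lemma exists_isHomogeneous_eval_eq_zero_eval_pos {ι : Type*} [Fintype ι] {m : ℕ} (hm : m ≠ 0)
    (hmeven : Even m) (v : ι → ℝ) :
    ∃ p : MvPolynomial ι ℝ, p.IsHomogeneous m ∧ eval v p = 0 ∧
      ∀ s, LinearIndependent ℝ ![v, s] → 0 < eval s p := by
  obtain ⟨k, rfl⟩ := even_iff_exists_two_mul.1 hmeven
  refine ⟨(∑ i, ∑ j, (C (v i) * X j - C (v j) * X i) ^ 2) ^ k, ?_, ?_, fun s hs => ?_⟩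
  · refine IsHomogeneous.pow (IsHomogeneous.sum _ _ _ fun i _ => IsHomogeneous.sum _ _ _
      fun j _ => ?_) k
    exact (((isHomogeneous_X ℝ j).C_mul _).sub ((isHomogeneous_X ℝ i).C_mul _)).pow 2
  · have hk : k ≠ 0 := by rintro rfl; exact hm rfl
    simp [mul_comm, hk]
  · simpa using pow_pos hs.sum_sq_minors_pos k

/-- Let `m ≥ 2` be even and let `S ⊆ ℝ^d` be a finite set such that no two distinct
points of `S` lie on a common line through the origin (any two distinct points of `S`
are linearly independent).  Then every point of the image of `S` under the degree-`m`
homogeneous Veronese map `HV_m^d : ℝ^d → ℝ^{C(d+m-1, m)}` (listing all monomials of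
degree exactly `m` in some fixed order given by the bijection `e`) is a vertex of the
convex hull of the image. -/
theorem homogeneousVeronese_convex_position (d m : ℕ) (hd : 1 ≤ d) (hm : 2 ≤ m)
    (hmeven : Even m)
    (e : Fin ((d + m - 1).choose m) ≃ HVeroneseIdx d m)
    (S : Finset (Fin d → ℝ))
    (hgen : ∀ p ∈ S, ∀ q ∈ S, p ≠ q → LinearIndependent ℝ ![p, q]) :
    ∀ v ∈ S, ∃ (a : Fin ((d + m - 1).choose m) → ℝ) (c : ℝ), a ≠ 0 ∧
      (∑ j, a j * hVeroneseMonomial (e j) v = c) ∧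
      (∀ s ∈ S \ {v}, ∑ j, a j * hVeroneseMonomial (e j) s < c) := by
  intro v hv
  obtain hS | ⟨t, ht⟩ := (S \ {v}).eq_empty_or_nonempty
  · have : Nonempty (Fin ((d + m - 1).choose m)) :=
      ⟨⟨0, Nat.choose_pos (by omega)⟩⟩
    exact ⟨1, _, one_ne_zero, rfl, by simp [hS]⟩
  obtain ⟨p, hp, hpv, hpos⟩ :=
    exists_isHomogeneous_eval_eq_zero_eval_pos (by omega : m ≠ 0) hmeven v
  obtain ⟨b, hb⟩ := hp.exists_eval_eq_sum_hVeroneseMonomial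
  have hsum (x : Fin d → ℝ) :
      ∑ j, -b (e j) * hVeroneseMonomial (e j) x = -MvPolynomial.eval x p := by
    rw [hb, ← Equiv.sum_comp e, ← Finset.sum_neg_distrib]
    exact Finset.sum_congr rfl fun _ _ => neg_mul _ _
  have hneg : ∀ s ∈ S \ {v}, ∑ j, -b (e j) * hVeroneseMonomial (e j) s < 0 := by
    intro s hs
    obtain ⟨hsS, hsv⟩ := Finset.mem_sdiff.1 hs
    rw [hsum, neg_lt_zero]
    exact hpos s (hgen v hv s hsS fun h => hsv (Finset.mem_singleton.2 h.symm))
  refine ⟨fun j => -b (e j), 0, fun h => (hneg t ht).ne ?_, by rw [hsum, hpv, neg_zero], hneg⟩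
  exact Finset.sum_eq_zero fun j _ => by rw [show -b (e j) = 0 from congrFun h j, zero_mul]
end

section
/- Let d ≥ 2 and let S be a set of n points in ℝ^d that is in general linear position and in convex position, with n > d. Let k ≥ 0 and suppose B is a number such that every set of n−1 points in general linear position in ℝ^{d−1} has at most B k-facets. Then d · e_k(S) ≤ n · B, i.e., e_k(S) ≤ (n/d) · e_k^{(d−1)}(n−1). -/
/-- A finite set of points in `ℝ^N` is in general linear position if every subset with
at most `N+1` elements is affinely independent. -/
def InGeneralLinearPosition {N : ℕ} (S : Finset (Fin N → ℝ)) : Prop :=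
  ∀ T ⊆ S, T.card ≤ N + 1 →
    AffineIndependent ℝ (fun t : (T : Set (Fin N → ℝ)) => (t : Fin N → ℝ))

/-- The number `e_k(S)` of `k`-facets of `S ⊆ ℝ^N`: pairs `(Δ, O)` where `Δ ⊆ S` has
exactly `N` elements and `O` is one of the two open half-spaces bounded by the
hyperplane `aff Δ`, such that `O` contains exactly `k` points of `S`. -/
noncomputable def kFacetCount {N : ℕ} (S : Finset (Fin N → ℝ)) (k : ℕ) : ℕ :=
  Set.ncard {ΔO : Finset (Fin N → ℝ) × Set (Fin N → ℝ) |
    ΔO.1 ⊆ S ∧ ΔO.1.card = N ∧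
    (∃ (a : Fin N → ℝ) (c : ℝ), a ≠ 0 ∧
      (∀ p ∈ ΔO.1, ∑ i, a i * p i = c) ∧
      ΔO.2 = {y : Fin N → ℝ | ∑ i, a i * y i < c}) ∧
    Set.ncard {s : Fin N → ℝ | s ∈ S ∧ s ∈ ΔO.2} = k}

/-- Affine independence of a finite set of vectors in terms of weights on the ambient space. -/
theorem affineIndependent_finset_iff {E : Type*} [AddCommGroup E] [Module ℝ E] (T : Finset E) :
    AffineIndependent ℝ (fun t : (T : Set E) => (t : E)) ↔
      ∀ w : E → ℝ, ∑ t ∈ T, w t = 0 → ∑ t ∈ T, w t • t = 0 → ∀ t ∈ T, w t = 0 := by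
  rw [affineIndependent_iff_of_fintype]
  constructor
  · intro h w h0 h1 t ht
    have hs : ∑ t : (T : Set E), w t = 0 := by
      rw [← h0]; exact Finset.sum_coe_sort T w
    refine h (fun t => w t) hs ?_ ⟨t, ht⟩
    rw [Finset.weightedVSub_eq_linear_combination _ hs, ← h1]
    exact Finset.sum_coe_sort T (fun t => w t • t)
  · intro h w h0 h1 t
    have hw : ∀ t : (T : Set E), Function.extend Subtype.val w 0 (t : E) = w t :=
      fun t => Subtype.val_injective.extend_apply w 0 t
    rw [Finset.weightedVSub_eq_linear_combination _ h0] at h1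
    rw [← hw t]
    refine h (Function.extend Subtype.val w 0) ?_ ?_ t t.2
    · rw [← h0, ← Finset.sum_coe_sort T]
      exact Finset.sum_congr rfl fun t _ => hw t
    · rw [← h1, ← Finset.sum_coe_sort T]
      exact Finset.sum_congr rfl fun t _ => by rw [hw t]

/-- An affine function that vanishes on `N + 1` affinely independent points vanishes. -/
theorem dotProduct_eq_of_affineIndependent {N : ℕ} {T : Finset (Fin N → ℝ)}
    (hT : AffineIndependent ℝ (fun t : (T : Set (Fin N → ℝ)) => (t : Fin N → ℝ)))
    (hcard : T.card = N + 1) {a : Fin N → ℝ} {c : ℝ} (h : ∀ p ∈ T, dotProduct a p = c)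
    (x : Fin N → ℝ) : dotProduct a x = c := by
  have htop : affineSpan ℝ (Set.range (fun t : (T : Set (Fin N → ℝ)) => (t : Fin N → ℝ))) = ⊤ := by
    rw [hT.affineSpan_eq_top_iff_card_eq_finrank_add_one]
    simp [hcard]
  obtain ⟨p, hp⟩ : T.Nonempty := by
    rw [← Finset.card_pos]; omega
  have hmem : x ∈ affineSpan ℝ (Set.range (fun t : (T : Set (Fin N → ℝ)) => (t : Fin N → ℝ))) := by
    rw [htop]; trivial
  have hle : affineSpan ℝ (Set.range (fun t : (T : Set (Fin N → ℝ)) => (t : Fin N → ℝ))) ≤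
      AffineSubspace.mk' p (LinearMap.ker (dotProductBilin ℝ ℝ a)) := by
    rw [affineSpan_le]
    rintro _ ⟨⟨t, ht⟩, rfl⟩
    simp only [SetLike.mem_coe, AffineSubspace.mem_mk', LinearMap.mem_ker]
    change dotProduct a (t - p) = 0
    rw [dotProduct_sub, h t ht, h p hp, sub_self]
  have hx := hle hmem
  simp only [AffineSubspace.mem_mk', LinearMap.mem_ker] at hx
  change dotProduct a (x - p) = 0 at hx
  rw [dotProduct_sub, h p hp] at hx
  linarith

/-- The `k`-facets of `S`, where each half-space is recorded by the points of `S` it contains. -/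
def IsFacetPair {N : ℕ} (S : Finset (Fin N → ℝ)) (k : ℕ)
    (x : Finset (Fin N → ℝ) × Finset (Fin N → ℝ)) : Prop :=
  x.1 ⊆ S ∧ x.1.card = N ∧ x.2.card = k ∧
    ∃ (a : Fin N → ℝ) (c : ℝ), a ≠ 0 ∧ (∀ p ∈ x.1, dotProduct a p = c) ∧
      ∀ p, p ∈ x.2 ↔ p ∈ S ∧ dotProduct a p < c

open Classical in
/-- The finite set of all `k`-facets of `S` in their combinatorial description. -/
noncomputable def facetPairs {N : ℕ} (S : Finset (Fin N → ℝ)) (k : ℕ) :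
    Finset (Finset (Fin N → ℝ) × Finset (Fin N → ℝ)) :=
  (S.powerset ×ˢ S.powerset).filter (IsFacetPair S k)

theorem mem_facetPairs {N : ℕ} {S : Finset (Fin N → ℝ)} {k : ℕ}
    {x : Finset (Fin N → ℝ) × Finset (Fin N → ℝ)} :
    x ∈ facetPairs S k ↔ IsFacetPair S k x := by
  classical
  simp only [facetPairs, Finset.mem_filter, Finset.mem_product, Finset.mem_powerset,
    and_iff_right_iff_imp]
  rintro ⟨h1, -, -, a, c, -, -, h⟩
  exact ⟨h1, fun p hp => ((h p).1 hp).1⟩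

/-- Two half-spaces bounded by the same spanned hyperplane agree as soon as they contain the same
points of `S`. -/
theorem halfSpace_eq_of_inter_eq {N : ℕ} {S : Finset (Fin N → ℝ)}
    (hgen : InGeneralLinearPosition S) (hN : N < S.card) {D : Finset (Fin N → ℝ)} (hD : D ⊆ S)
    (hDc : D.card = N) {a a' : Fin N → ℝ} {c c' : ℝ} (ha : a ≠ 0) (ha' : a' ≠ 0)
    (h : ∀ p ∈ D, dotProduct a p = c) (h' : ∀ p ∈ D, dotProduct a' p = c')
    (hS : ∀ p ∈ S, dotProduct a p < c ↔ dotProduct a' p < c') (x : Fin N → ℝ) :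
    dotProduct a x < c ↔ dotProduct a' x < c' := by
  classical
  obtain ⟨q, hqS, hqD⟩ := Finset.exists_mem_notMem_of_card_lt_card (hDc.trans_lt hN)
  have hTc : (insert q D).card = N + 1 := by rw [Finset.card_insert_of_notMem hqD, hDc]
  have hT := hgen (insert q D) (Finset.insert_subset hqS hD) hTc.le
  have hne : ∀ {b : Fin N → ℝ} {e : ℝ}, b ≠ 0 → (∀ p ∈ D, dotProduct b p = e) →
      dotProduct b q ≠ e := by
    intro b e hb hbD hbq
    have hall := dotProduct_eq_of_affineIndependent hT hTc (a := b) (c := e) (by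
      intro p hp
      rcases Finset.mem_insert.1 hp with rfl | hp
      · exact hbq
      · exact hbD p hp)
    have h0 : e = 0 := by rw [← hall 0, dotProduct_zero]
    exact hb (dotProduct_eq_zero b fun y => (hall y).trans h0)
  have hq := hne ha h
  have hq' := hne ha' h'
  have hprop := dotProduct_eq_of_affineIndependent hT hTc
    (a := (dotProduct a q - c) • a' - (dotProduct a' q - c') • a)
    (c := (dotProduct a q - c) * c' - (dotProduct a' q - c') * c) (by
      intro p hp
      simp only [sub_dotProduct, smul_dotProduct, smul_eq_mul]
      rcases Finset.mem_insert.1 hp with rfl | hp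
      · ring
      · rw [h p hp, h' p hp]) x
  simp only [sub_dotProduct, smul_dotProduct, smul_eq_mul] at hprop
  have hqq := hS q hqS
  rcases lt_or_gt_of_ne hq with h1 | h1
  · have h2 := hqq.1 h1
    constructor
    · intro hx; nlinarith [mul_pos_of_neg_of_neg (sub_neg.2 h2) (sub_neg.2 hx)]
    · intro hx; nlinarith [mul_pos_of_neg_of_neg (sub_neg.2 h1) (sub_neg.2 hx)]
  · have h2 : c' < dotProduct a' q :=
      lt_of_le_of_ne (not_lt.1 fun hlt => (hqq.2 hlt).not_gt h1) hq'.symm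
    constructor
    · intro hx; nlinarith [mul_neg_of_pos_of_neg (sub_pos.2 h2) (sub_neg.2 hx)]
    · intro hx; nlinarith [mul_neg_of_pos_of_neg (sub_pos.2 h1) (sub_neg.2 hx)]

theorem kFacetCount_eq_card_facetPairs {N : ℕ} {S : Finset (Fin N → ℝ)} (k : ℕ)
    (hgen : InGeneralLinearPosition S) (hN : N < S.card) :
    kFacetCount S k = (facetPairs S k).card := by
  classical
  rw [← Set.ncard_coe_finset, kFacetCount]
  have hcoe : ∀ O : Set (Fin N → ℝ), {s | s ∈ S ∧ s ∈ O} = ((S.filter (· ∈ O) : Finset _) : Set _) := by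
    intro O; ext; simp
  refine Set.ncard_congr (fun x _ => (x.1, S.filter (· ∈ x.2))) ?_ ?_ ?_
  · rintro ⟨D, O⟩ ⟨h1, h2, ⟨a, c, ha, hD, rfl⟩, hk⟩
    rw [hcoe, Set.ncard_coe_finset] at hk
    exact mem_facetPairs.2 ⟨h1, h2, hk, a, c, ha, hD, fun p => by
      simp only [Finset.mem_filter, Set.mem_ofPred_eq, dotProduct]⟩
  · rintro ⟨D, O⟩ ⟨D', O'⟩ ⟨h1, h2, ⟨a, c, ha, hD, rfl⟩, -⟩ ⟨-, -, ⟨a', c', ha', hD', rfl⟩, -⟩ heq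
    simp only [Prod.mk.injEq] at heq hD hD' h1 h2
    obtain ⟨rfl, heq⟩ := heq
    rw [Finset.filter_inj'] at heq
    simp only [Prod.mk.injEq, true_and]
    ext x
    exact halfSpace_eq_of_inter_eq hgen hN h1 h2 ha ha' hD hD' (fun p hp => heq hp) x
  · rintro ⟨D, A⟩ hx
    obtain ⟨h1, h2, hk, a, c, ha, hD, hA⟩ := mem_facetPairs.1 hx
    have hAeq : S.filter (· ∈ {y : Fin N → ℝ | ∑ i, a i * y i < c}) = A := by
      ext p
      rw [Finset.mem_filter]
      exact (hA p).symm
    refine ⟨(D, {y | ∑ i, a i * y i < c}), ⟨h1, h2, ⟨a, c, ha, hD, rfl⟩, ?_⟩, ?_⟩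
    · rw [hcoe, Set.ncard_coe_finset]
      simp only [hAeq]
      exact hk
    · simp only [hAeq]

/-- The central projection from `v` to the hyperplane `w ⬝ (p - v) = 1`, in the coordinates
other than `i`. -/
noncomputable def centralProjection {m : ℕ} (w : Fin (m + 1) → ℝ) (i : Fin (m + 1))
    (v p : Fin (m + 1) → ℝ) : Fin m → ℝ :=
  (dotProduct w (p - v))⁻¹ • i.removeNth (p - v)

theorem eq_zero_of_sum_smul_centralProjection {m : ℕ} {S : Finset (Fin (m + 1) → ℝ)}
    (hgen : InGeneralLinearPosition S) {v w : Fin (m + 1) → ℝ} {i : Fin (m + 1)} (hv : v ∈ S)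
    (hi : w i ≠ 0) (hw : ∀ p ∈ S.erase v, 0 < dotProduct w (p - v))
    {T : Finset (Fin (m + 1) → ℝ)} (hT : T ⊆ S.erase v) (hTc : T.card ≤ m + 1)
    {u : (Fin (m + 1) → ℝ) → ℝ} (hu : ∑ t ∈ T, u t = 0)
    (huc : ∑ t ∈ T, u t • centralProjection w i v t = 0) : ∀ t ∈ T, u t = 0 := by
  classical
  set r : (Fin (m + 1) → ℝ) → ℝ := fun t => u t * (dotProduct w (t - v))⁻¹ with hr
  have hvT : v ∉ T := fun h => Finset.notMem_erase v S (hT h)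
  have hpos : ∀ t ∈ T, dotProduct w (t - v) ≠ 0 := fun t ht => (hw t (hT ht)).ne'
  set z := ∑ t ∈ T, r t • (t - v) with hz
  have hzj : ∀ j, z (i.succAbove j) = 0 := by
    intro j
    have := congrFun huc j
    simp only [Finset.sum_apply, Pi.smul_apply, smul_eq_mul, centralProjection, Pi.zero_apply,
      Fin.removeNth] at this
    rw [hz, ← this]
    simp only [Finset.sum_apply, Pi.smul_apply, smul_eq_mul, hr, mul_assoc]
  have hwz : dotProduct w z = 0 := by
    rw [hz, dotProduct_sum, ← hu]
    refine Finset.sum_congr rfl fun t ht => ?_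
    rw [dotProduct_smul, smul_eq_mul, hr, inv_mul_cancel_right₀ (hpos t ht)]
  have hz0 : z = 0 := by
    rw [dotProduct, Fin.sum_univ_succAbove _ i] at hwz
    simp only [hzj, mul_zero, Finset.sum_const_zero, add_zero, mul_eq_zero, hi, false_or] at hwz
    ext j
    rcases Fin.eq_self_or_eq_succAbove i j with rfl | ⟨j, rfl⟩
    · exact hwz
    · exact hzj j
  have hne : ∀ t ∈ T, t ≠ v := fun t ht h => hvT (h ▸ ht)
  have hind := (affineIndependent_finset_iff _).1 (hgen (insert v T)
    (Finset.insert_subset hv (hT.trans (Finset.erase_subset _ _)))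
    (by rw [Finset.card_insert_of_notMem hvT]; omega))
    (fun x => if x = v then -∑ t ∈ T, r t else r x)
    (by
      rw [Finset.sum_insert hvT, if_pos rfl,
        Finset.sum_congr rfl (g := r) (fun t ht => if_neg (hne t ht))]
      simp)
    (by
      rw [Finset.sum_insert hvT, if_pos rfl,
        Finset.sum_congr rfl (g := fun t => r t • t) (fun t ht => by rw [if_neg (hne t ht)])]
      rw [← hz0, hz]
      simp only [smul_sub, Finset.sum_sub_distrib, ← Finset.sum_smul]
      rw [neg_smul]; abel)
  intro t ht
  have := hind t (Finset.mem_insert_of_mem ht)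
  simp only [if_neg (hne t ht), hr, mul_eq_zero, inv_eq_zero, hpos t ht, or_false] at this
  exact this

theorem injOn_centralProjection {m : ℕ} (hm : 1 ≤ m) {S : Finset (Fin (m + 1) → ℝ)}
    (hgen : InGeneralLinearPosition S) {v w : Fin (m + 1) → ℝ} {i : Fin (m + 1)} (hv : v ∈ S)
    (hi : w i ≠ 0) (hw : ∀ p ∈ S.erase v, 0 < dotProduct w (p - v)) :
    Set.InjOn (centralProjection w i v) (S.erase v : Finset _) := by
  classical
  intro p hp q hq hpq
  by_contra hne
  have := eq_zero_of_sum_smul_centralProjection hgen hv hi hw (T := {p, q})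
    (u := fun x => if x = p then 1 else -1)
    (by
      intro x hx
      rcases Finset.mem_insert.1 hx with rfl | hx
      · exact hp
      · rwa [Finset.mem_singleton.1 hx])
    (by rw [Finset.card_pair hne]; omega)
    (by simp [Finset.sum_pair hne, Ne.symm hne])
    (by simp [Finset.sum_pair hne, Ne.symm hne, hpq])
    p (Finset.mem_insert_self _ _)
  simp at this

open Classical in
theorem inGeneralLinearPosition_image_centralProjection {m : ℕ} {S : Finset (Fin (m + 1) → ℝ)}
    (hgen : InGeneralLinearPosition S) {v w : Fin (m + 1) → ℝ} {i : Fin (m + 1)} (hv : v ∈ S)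
    (hi : w i ≠ 0) (hw : ∀ p ∈ S.erase v, 0 < dotProduct w (p - v)) :
    InGeneralLinearPosition ((S.erase v).image (centralProjection w i v)) := by
  intro T' hT' hT'c
  obtain ⟨T, hTS, hinj, rfl⟩ := Finset.exists_subset_injOn_image_eq_of_surjOn
    (f := centralProjection w i v) (S.erase v : Finset _) T' (by
      intro y hy
      exact Finset.mem_image.1 (hT' hy))
  rw [Finset.card_image_of_injOn hinj] at hT'c
  rw [affineIndependent_finset_iff]
  intro u h0 h1 y hy
  rw [Finset.sum_image hinj] at h0 h1
  obtain ⟨t, ht, rfl⟩ := Finset.mem_image.1 hy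
  exact eq_zero_of_sum_smul_centralProjection hgen hv hi hw (by exact_mod_cast hTS) hT'c
    (u := fun t => u (centralProjection w i v t)) h0 h1 t ht

/-- Every affine function vanishing at `v` has the same sign at `p` as an affine function on the
hyperplane of projection at the projection of `p`. -/
theorem dotProduct_sub_eq_mul_centralProjection {m : ℕ} {a v w p : Fin (m + 1) → ℝ}
    {i : Fin (m + 1)} (hi : w i ≠ 0) (hp : dotProduct w (p - v) ≠ 0) :
    dotProduct a (p - v) = dotProduct w (p - v) *
      (dotProduct (i.removeNth (a - (a i / w i) • w)) (centralProjection w i v p) -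
        -(a i / w i)) := by
  have h1 : dotProduct (i.removeNth (a - (a i / w i) • w)) (i.removeNth (p - v)) =
      dotProduct (a - (a i / w i) • w) (p - v) := by
    rw [dotProduct, dotProduct, Fin.sum_univ_succAbove _ i]
    simp [Fin.removeNth, hi]
  rw [centralProjection, dotProduct_smul, h1, sub_dotProduct, smul_dotProduct]
  simp only [smul_eq_mul]
  field_simp
  ring

open Classical in
theorem card_filter_facetPairs_le {m : ℕ} (hm : 1 ≤ m) {S : Finset (Fin (m + 1) → ℝ)} (k : ℕ)
    (hgen : InGeneralLinearPosition S) {v w : Fin (m + 1) → ℝ} {i : Fin (m + 1)} (hv : v ∈ S)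
    (hi : w i ≠ 0) (hw : ∀ p ∈ S.erase v, 0 < dotProduct w (p - v)) :
    ((facetPairs S k).filter (v ∈ ·.1)).card ≤
      (facetPairs ((S.erase v).image (centralProjection w i v)) k).card := by
  have hinj := injOn_centralProjection hm hgen hv hi hw
  have hA : ∀ x ∈ (facetPairs S k).filter (v ∈ ·.1),
      v ∈ x.1 ∧ x.1.erase v ⊆ S.erase v ∧ x.2 ⊆ S.erase v := by
    intro x hx
    obtain ⟨hx, hvx⟩ := Finset.mem_filter.1 hx
    obtain ⟨h1, -, -, a, c, -, hD, hA⟩ := mem_facetPairs.1 hx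
    refine ⟨hvx, Finset.erase_subset_erase v h1, fun p hp => Finset.mem_erase.2 ⟨?_, ?_⟩⟩
    · rintro rfl
      exact ((hA p).1 hp).2.ne (hD p hvx)
    · exact ((hA p).1 hp).1
  refine Finset.card_le_card_of_injOn (fun x => ((x.1.erase v).image (centralProjection w i v),
    x.2.image (centralProjection w i v))) ?_ ?_
  · intro x hx
    obtain ⟨hvx, hs1, hs2⟩ := hA x hx
    obtain ⟨h1, h2, h3, a, c, ha, hD, hA⟩ := mem_facetPairs.1 (Finset.mem_filter.1 hx).1
    have hav : dotProduct a v = c := hD v hvx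
    have hsign : ∀ p ∈ S.erase v, dotProduct a p - c = dotProduct w (p - v) *
        (dotProduct (i.removeNth (a - (a i / w i) • w)) (centralProjection w i v p) -
          -(a i / w i)) := fun p hp => by
      rw [← dotProduct_sub_eq_mul_centralProjection hi (hw p hp).ne', dotProduct_sub, hav]
    have hD' : ∀ p ∈ x.1.erase v,
        dotProduct (i.removeNth (a - (a i / w i) • w)) (centralProjection w i v p) =
          -(a i / w i) := fun p hp => by
      have := hsign p (hs1 hp)
      rw [hD p (Finset.mem_of_mem_erase hp), sub_self, eq_comm, mul_eq_zero] at this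
      exact sub_eq_zero.1 (this.resolve_left (hw p (hs1 hp)).ne')
    have hcard : (x.1.erase v).card = m := by rw [Finset.card_erase_of_mem hvx, h2]; rfl
    refine mem_facetPairs.2 ⟨Finset.image_subset_image hs1, ?_, ?_,
      i.removeNth (a - (a i / w i) • w), -(a i / w i), ?_, ?_, ?_⟩
    · rw [Finset.card_image_of_injOn (hinj.mono (by exact_mod_cast hs1)), hcard]
    · rw [Finset.card_image_of_injOn (hinj.mono (by exact_mod_cast hs2)), h3]
    · intro h0
      obtain ⟨p, hp⟩ : (x.1.erase v).Nonempty := by rw [← Finset.card_pos]; omega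
      have ht : a i / w i = 0 := by
        have := hD' p hp
        rw [h0, zero_dotProduct] at this
        linarith
      apply ha
      rw [ht, zero_smul, sub_zero] at h0
      ext j
      rcases Fin.eq_self_or_eq_succAbove i j with rfl | ⟨j, rfl⟩
      · exact (div_eq_zero_iff.1 ht).resolve_right hi
      · exact congrFun h0 j
    · intro y hy
      obtain ⟨p, hp, rfl⟩ := Finset.mem_image.1 hy
      exact hD' p hp
    · have hiff : ∀ p ∈ S.erase v, p ∈ x.2 ↔
          dotProduct (i.removeNth (a - (a i / w i) • w)) (centralProjection w i v p) <
            -(a i / w i) := fun p hp => by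
        rw [hA p, and_iff_right (Finset.mem_of_mem_erase hp), ← sub_neg, hsign p hp,
          ← mul_zero (dotProduct w (p - v)), mul_lt_mul_iff_right₀ (hw p hp), sub_neg]
      intro y
      constructor
      · intro hy
        obtain ⟨p, hp, rfl⟩ := Finset.mem_image.1 hy
        exact ⟨Finset.mem_image_of_mem _ (hs2 hp), (hiff p (hs2 hp)).1 hp⟩
      · rintro ⟨hy, hlt⟩
        obtain ⟨p, hp, rfl⟩ := Finset.mem_image.1 hy
        exact Finset.mem_image_of_mem _ ((hiff p hp).2 hlt)
  · intro x hx y hy hxy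
    obtain ⟨hvx, hx1, hx2⟩ := hA x hx
    obtain ⟨hvy, hy1, hy2⟩ := hA y hy
    have himg : ∀ {A B : Finset (Fin (m + 1) → ℝ)}, A ⊆ S.erase v → B ⊆ S.erase v →
        A.image (centralProjection w i v) = B.image (centralProjection w i v) → A = B := by
      intro A B hA hB hAB
      have hAB' := congrArg (fun F : Finset (Fin m → ℝ) => (F : Set (Fin m → ℝ))) hAB
      simp only [Finset.coe_image] at hAB'
      exact_mod_cast (hinj.image_eq_image_iff (by exact_mod_cast hA) (by exact_mod_cast hB)).1 hAB'
    obtain ⟨he1, he2⟩ := Prod.mk.inj hxy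
    refine Prod.ext ?_ (himg hx2 hy2 he2)
    rw [← Finset.insert_erase hvx, ← Finset.insert_erase hvy, himg hx1 hy1 he1]

/-- A point outside the convex hull of a finite set is strictly separated from it. -/
theorem exists_dotProduct_sub_pos {d : ℕ} {P : Set (Fin d → ℝ)} (hP : P.Finite)
    {v : Fin d → ℝ} (hv : v ∉ convexHull ℝ P) :
    ∃ w : Fin d → ℝ, ∀ p ∈ P, 0 < dotProduct w (p - v) := by
  obtain ⟨f, u, hfv, hf⟩ := geometric_hahn_banach_point_closed (convex_convexHull ℝ P)
    (hP.isClosed_convexHull ℝ) hv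
  refine ⟨fun i => f fun j => if i = j then 1 else 0, fun p hp => ?_⟩
  have h1 := hf p (subset_convexHull ℝ P hp)
  have h2 := LinearMap.pi_apply_eq_sum_univ (f : (Fin d → ℝ) →ₗ[ℝ] ℝ) (p - v)
  simp only [ContinuousLinearMap.coe_coe, map_sub, smul_eq_mul] at h2
  simp only [dotProduct]
  simp_rw [mul_comm (f _)]
  rw [← h2]
  linarith

theorem mul_card_facetPairs {N : ℕ} (S : Finset (Fin N → ℝ)) (k : ℕ) [DecidableEq (Fin N → ℝ)] :
    N * (facetPairs S k).card = ∑ v ∈ S, ((facetPairs S k).filter (v ∈ ·.1)).card := by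
  have h := Finset.sum_card_bipartiteAbove_eq_sum_card_bipartiteBelow
    (fun (v : Fin N → ℝ) (x : Finset (Fin N → ℝ) × Finset (Fin N → ℝ)) => v ∈ x.1)
    (s := S) (t := facetPairs S k)
  refine Eq.trans ?_ h.symm
  rw [mul_comm, ← smul_eq_mul]
  refine (Finset.sum_eq_card_nsmul fun x hx => ?_).symm
  obtain ⟨h1, h2, -⟩ := mem_facetPairs.1 hx
  rw [Finset.bipartiteBelow, Finset.filter_mem_eq_inter, Finset.inter_eq_right.2 h1, h2]

/-- Improved `k`-facet bound for point sets in convex position: if `S` is a set of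
`n > d` points in general linear position and convex position in `ℝ^d` (`d ≥ 2`), and
every set of `n-1` points in general linear position in `ℝ^{d-1}` has at most `B`
`k`-facets, then `d · e_k(S) ≤ n · B`. -/
theorem convex_position_kfacet_bound (d n k B : ℕ) (hd : 2 ≤ d) (hnd : d < n)
    (S : Finset (Fin d → ℝ)) (hcard : S.card = n)
    (hgen : InGeneralLinearPosition S)
    (hconv : ∀ v ∈ S, v ∉ convexHull ℝ ((S : Set (Fin d → ℝ)) \ {v}))
    (hB : ∀ S' : Finset (Fin (d - 1) → ℝ), S'.card = n - 1 →
      InGeneralLinearPosition S' → kFacetCount S' k ≤ B) :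
    d * kFacetCount S k ≤ n * B := by
  classical
  obtain ⟨m, rfl⟩ : ∃ m, d = m + 1 := ⟨d - 1, by omega⟩
  subst hcard
  rw [kFacetCount_eq_card_facetPairs k hgen hnd, mul_card_facetPairs, ← smul_eq_mul]
  refine Finset.sum_le_card_nsmul _ _ _ fun v hv => ?_
  obtain ⟨w, hw⟩ := exists_dotProduct_sub_pos (S.finite_toSet.subset Set.sdiff_subset) (hconv v hv)
  replace hw : ∀ p ∈ S.erase v, 0 < dotProduct w (p - v) := fun p hp =>
    hw p ⟨Finset.mem_of_mem_erase hp, Finset.ne_of_mem_erase hp⟩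
  obtain ⟨i, hi⟩ : ∃ i, w i ≠ 0 := by
    obtain ⟨p, hp⟩ : (S.erase v).Nonempty := by
      rw [← Finset.card_pos, Finset.card_erase_of_mem hv]; omega
    by_contra! h
    have := hw p hp
    rw [show w = 0 from funext h, zero_dotProduct] at this
    exact this.false
  have hgen' := inGeneralLinearPosition_image_centralProjection hgen hv hi hw
  have hcard' : ((S.erase v).image (centralProjection w i v)).card = S.card - 1 := by
    rw [Finset.card_image_of_injOn (injOn_centralProjection (by omega) hgen hv hi hw),
      Finset.card_erase_of_mem hv]
  refine (card_filter_facetPairs_le (by omega) k hgen hv hi hw).trans ?_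
  rw [← kFacetCount_eq_card_facetPairs k hgen' (by omega)]
  exact hB _ hcard' hgen'
end

section
/- Let d, m be integers with 1 ≤ m < d, and let S be a set of n points in ℝ^d that is in general linear position and is m-neighborly, with n > d. Let k ≥ 0 and suppose B is a number such that every set of n−m points in general linear position in ℝ^{d−m} has at most B k-facets. Then C(d, m) · e_k(S) ≤ C(n, m) · B, i.e., e_k(S) ≤ C(n, m) · e_k^{(d−m)}(n−m) / C(d, m). -/
/-- A finite set `S ⊆ ℝ^N` is `m`-neighborly if every nonempty subset `T ⊆ S` with at
most `m` elements spans a face of `conv S` with vertex set exactly `T`. -/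
def IsNeighborly {N : ℕ} (m : ℕ) (S : Finset (Fin N → ℝ)) : Prop :=
  ∀ T ⊆ S, T.Nonempty → T.card ≤ m →
    ∃ (a : Fin N → ℝ) (c : ℝ), a ≠ 0 ∧
      (∀ x ∈ T, ∑ i, a i * x i = c) ∧
      (∀ x ∈ S \ T, ∑ i, a i * x i < c)

section

open Finset

/-- The lift of a point to the affine hyperplane at height one. -/
def homogenize {N : ℕ} (x : Fin N → ℝ) : (Fin N → ℝ) × ℝ := (x, 1)

theorem affineIndependent_iff_linearIndepOn_homogenize {N : ℕ} (T : Finset (Fin N → ℝ)) :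
    AffineIndependent ℝ (fun t : (T : Set (Fin N → ℝ)) => (t : Fin N → ℝ)) ↔
      LinearIndepOn ℝ homogenize (T : Set (Fin N → ℝ)) := by
  rw [affineIndependent_iff, LinearIndepOn, linearIndependent_iff']
  refine forall₂_congr fun s w => ?_
  have : (∑ i ∈ s, w i • homogenize (i : Fin N → ℝ) = 0) ↔
      s.sum w = 0 ∧ ∑ i ∈ s, w i • (i : Fin N → ℝ) = 0 := by
    simp [homogenize, Prod.ext_iff, Prod.fst_sum, Prod.snd_sum, and_comm]
  rw [this, and_imp]

theorem InGeneralLinearPosition.linearIndepOn {N : ℕ} {S T : Finset (Fin N → ℝ)}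
    (hS : InGeneralLinearPosition S) (hT : T ⊆ S) (hcard : T.card ≤ N + 1) :
    LinearIndepOn ℝ homogenize (T : Set (Fin N → ℝ)) :=
  (affineIndependent_iff_linearIndepOn_homogenize T).1 (hS T hT hcard)

/-- The linear functional on `ℝ^N × ℝ` that restricts to `x ↦ ⟨a, x⟩ - c` at height one. -/
def affineForm {N : ℕ} (a : Fin N → ℝ) (c : ℝ) : (Fin N → ℝ) × ℝ →ₗ[ℝ] ℝ :=
  (∑ i, a i • LinearMap.proj i).coprod (-c • LinearMap.id)

theorem affineForm_homogenize {N : ℕ} (a : Fin N → ℝ) (c : ℝ) (x : Fin N → ℝ) :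
    affineForm a c (homogenize x) = ∑ i, a i * x i - c := by
  simp [affineForm, homogenize, sub_eq_add_neg]

theorem affineForm_ne_zero {N : ℕ} {a : Fin N → ℝ} (ha : a ≠ 0) (c : ℝ) :
    affineForm a c ≠ 0 := by
  intro h
  apply ha
  ext i
  simpa [affineForm, Pi.single_apply] using LinearMap.congr_fun h (Pi.single i 1, 0)

theorem exists_eq_affineForm {N : ℕ} (f : (Fin N → ℝ) × ℝ →ₗ[ℝ] ℝ) :
    ∃ a c, f = affineForm a c := by
  refine ⟨fun i => f (Pi.single i 1, 0), -f (0, 1), ?_⟩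
  apply LinearMap.prod_ext
  · ext i
    simp [affineForm, Pi.single_apply]
  · ext
    simp [affineForm]

/-- The pairs `(Δ, A)` where `Δ` spans a `k`-facet of `S` and `A` consists of the points of `S`
in the corresponding open half-space. -/
noncomputable def facetTraces {N : ℕ} (S : Finset (Fin N → ℝ)) (k : ℕ) :
    Finset (Finset (Fin N → ℝ) × Finset (Fin N → ℝ)) := by
  classical
  exact (S.powersetCard N ×ˢ S.powersetCard k).filter fun p =>
    ∃ f : (Fin N → ℝ) × ℝ →ₗ[ℝ] ℝ, f ≠ 0 ∧ (∀ x ∈ p.1, f (homogenize x) = 0) ∧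
      ∀ x ∈ S, x ∈ p.2 ↔ f (homogenize x) < 0

theorem mem_facetTraces {N k : ℕ} {S Δ A : Finset (Fin N → ℝ)} :
    (Δ, A) ∈ facetTraces S k ↔ (Δ ⊆ S ∧ Δ.card = N) ∧ (A ⊆ S ∧ A.card = k) ∧
      ∃ f : (Fin N → ℝ) × ℝ →ₗ[ℝ] ℝ, f ≠ 0 ∧ (∀ x ∈ Δ, f (homogenize x) = 0) ∧
        ∀ x ∈ S, x ∈ A ↔ f (homogenize x) < 0 := by
  simp [facetTraces, mem_powersetCard, and_assoc]

/-- Two functionals vanishing on a facet that have the same sign at one further point have the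
same sign everywhere. -/
theorem InGeneralLinearPosition.forall_lt_zero_iff {N : ℕ} {S Δ : Finset (Fin N → ℝ)}
    (hS : InGeneralLinearPosition S) (hΔ : Δ ⊆ S) (hcard : Δ.card = N)
    {s : Fin N → ℝ} (hs : s ∈ S) (hsΔ : s ∉ Δ) {f g : (Fin N → ℝ) × ℝ →ₗ[ℝ] ℝ}
    (hf : f ≠ 0) (hg : g ≠ 0) (hfΔ : ∀ x ∈ Δ, f (homogenize x) = 0)
    (hgΔ : ∀ x ∈ Δ, g (homogenize x) = 0)
    (h : f (homogenize s) < 0 ↔ g (homogenize s) < 0) (y : (Fin N → ℝ) × ℝ) :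
    f y < 0 ↔ g y < 0 := by
  classical
  have hins : (insert s Δ).card = N + 1 := by rw [card_insert_of_notMem hsΔ, hcard]
  have hli := hS.linearIndepOn (insert_subset hs hΔ) hins.le
  have hspan : Submodule.span ℝ (homogenize '' ((insert s Δ : Finset _) : Set (Fin N → ℝ))) = ⊤ := by
    have := LinearIndependent.span_eq_top_of_card_eq_finrank' (b := fun x : (insert s Δ : Finset _) =>
      homogenize (x : Fin N → ℝ)) hli (by simp [hins])
    rw [← this]
    congr 1
    ext z
    simp
  have hext : ∀ u : (Fin N → ℝ) × ℝ →ₗ[ℝ] ℝ, (∀ x ∈ Δ, u (homogenize x) = 0) →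
      u (homogenize s) = 0 → u = 0 := by
    intro u hu hus
    refine LinearMap.ext_on hspan ?_
    rintro _ ⟨x, hx, rfl⟩
    rcases mem_insert.1 (mem_coe.1 hx) with rfl | hx
    · simpa using hus
    · simpa using hu x hx
  have hfs : f (homogenize s) ≠ 0 := fun h0 => hf (hext f hfΔ h0)
  have hgs : g (homogenize s) ≠ 0 := fun h0 => hg (hext g hgΔ h0)
  have hpos : 0 < f (homogenize s) / g (homogenize s) := by
    rcases hgs.lt_or_gt with hneg | hpos
    · exact div_pos_of_neg_of_neg (h.2 hneg) hneg
    · exact div_pos (lt_of_le_of_ne (not_lt.1 fun h' => hpos.not_gt (h.1 h')) hfs.symm) hpos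
  have heq : f - (f (homogenize s) / g (homogenize s)) • g = 0 :=
    hext _ (fun x hx => by simp [hfΔ x hx, hgΔ x hx]) (by simp [hgs])
  rw [sub_eq_zero.1 heq, LinearMap.smul_apply, smul_eq_mul, mul_neg_iff]
  simp [hpos, hpos.not_gt]

theorem kFacetCount_eq_card_facetTraces {N : ℕ} {S : Finset (Fin N → ℝ)} (k : ℕ)
    (hS : InGeneralLinearPosition S) (hN : 0 < N) (hcard : N < S.card) :
    kFacetCount S k = (facetTraces S k).card := by
  classical
  rw [← Set.ncard_coe_finset, kFacetCount]
  rw [← Set.InjOn.ncard_image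
    (f := fun p : Finset (Fin N → ℝ) × Set (Fin N → ℝ) => (p.1, S.filter (· ∈ p.2)))]
  · congr 1
    ext ⟨Δ, A⟩
    rw [mem_coe, mem_facetTraces]
    constructor
    · rintro ⟨⟨Δ, O⟩, ⟨hΔ, hΔc, ⟨a, c, ha, hac, rfl⟩, hk⟩, h⟩
      simp only [Prod.mk.injEq] at h
      obtain ⟨rfl, rfl⟩ := h
      refine ⟨⟨hΔ, hΔc⟩, ⟨filter_subset _ _, ?_⟩, affineForm a c, affineForm_ne_zero ha c, ?_, ?_⟩
      · rw [← hk, ← Set.ncard_coe_finset]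
        simp
      · intro x hx
        rw [affineForm_homogenize, hac x hx, sub_self]
      · intro x hx
        simp [affineForm_homogenize, hx]
    · rintro ⟨⟨hΔ, hΔc⟩, ⟨hA, hAc⟩, f, hf, hfΔ, hfA⟩
      obtain ⟨a, c, rfl⟩ := exists_eq_affineForm f
      simp only [affineForm_homogenize, sub_eq_zero, sub_neg] at hfΔ hfA
      have hAf : S.filter (fun x => ∑ i, a i * x i < c) = A := by
        ext x
        rw [mem_filter]
        exact ⟨fun h => (hfA x h.1).2 h.2, fun h => ⟨hA h, (hfA x (hA h)).1 h⟩⟩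
      refine ⟨(Δ, {y | ∑ i, a i * y i < c}), ⟨hΔ, hΔc, ⟨a, c, ?_, hfΔ, rfl⟩, ?_⟩, ?_⟩
      · rintro rfl
        obtain ⟨x, hx⟩ : Δ.Nonempty := card_pos.1 (hN.trans_eq hΔc.symm)
        have hc : c = 0 := by simpa using (hfΔ x hx).symm
        apply hf
        ext <;> simp [affineForm, hc]
      · rw [← hAc, ← hAf, ← Set.ncard_coe_finset]
        simp
      · simp [hAf]
  · rintro ⟨Δ, _⟩ ⟨hΔ, hΔc, ⟨a, c, ha, hac, rfl⟩, -⟩ ⟨_, _⟩ ⟨-, -, ⟨b, e, hb, hbe, rfl⟩, -⟩ h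
    simp only [Prod.mk.injEq] at h hΔ hΔc hac hbe ⊢
    obtain ⟨rfl, h⟩ := h
    refine ⟨rfl, ?_⟩
    obtain ⟨s, hs, hsΔ⟩ := exists_mem_notMem_of_card_lt_card (hΔc.trans_lt hcard)
    have hst : (∑ i, a i * s i < c) ↔ (∑ i, b i * s i < e) := by
      simpa [hs] using Finset.ext_iff.1 h s
    ext y
    simpa [affineForm_homogenize] using hS.forall_lt_zero_iff hΔ hΔc hs hsΔ
      (affineForm_ne_zero ha c) (affineForm_ne_zero hb e)
      (fun x hx => by rw [affineForm_homogenize, hac x hx, sub_self])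
      (fun x hx => by rw [affineForm_homogenize, hbe x hx, sub_self])
      (by simpa [affineForm_homogenize] using hst) (homogenize y)

theorem exists_linearEquiv_snd_eq {Q : Type*} [AddCommGroup Q] [Module ℝ Q]
    [FiniteDimensional ℝ Q] {r : ℕ} (hQ : Module.finrank ℝ Q = r + 1) {h : Q →ₗ[ℝ] ℝ}
    (hh : h ≠ 0) : ∃ Ψ : Q ≃ₗ[ℝ] (Fin r → ℝ) × ℝ, ∀ q, (Ψ q).2 = h q := by
  have hsurj : Function.Surjective h := LinearMap.surjective hh
  have hker : Module.finrank ℝ (LinearMap.ker h) = r := by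
    have h1 := h.finrank_range_add_finrank_ker
    rw [LinearMap.range_eq_top.2 hsurj, finrank_top, Module.finrank_self, hQ] at h1
    omega
  let e : LinearMap.ker h ≃ₗ[ℝ] (Fin r → ℝ) := LinearEquiv.ofFinrankEq _ _ (by simpa using hker)
  obtain ⟨p, hp⟩ := (LinearMap.ker h).exists_isCompl
  let π := (LinearMap.ker h).projectionOnto p hp
  have hπ : LinearMap.range (e.toLinearMap ∘ₗ π) = ⊤ := by
    rw [LinearMap.range_comp, Submodule.range_projectionOnto]
    simp
  refine ⟨LinearMap.equivProdOfSurjectiveOfIsCompl (e.toLinearMap ∘ₗ π) h hπ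
    (LinearMap.range_eq_top.2 hsurj) ?_, fun q => rfl⟩
  rw [LinearEquiv.ker_comp, Submodule.ker_projectionOnto]
  exact hp.symm

/-- Projecting from the affine span of a face. -/
theorem exists_projection {d m : ℕ} (hm : 1 ≤ m) (hmd : m < d) {S T : Finset (Fin d → ℝ)}
    (hcard : d < S.card) (hgen : InGeneralLinearPosition S) (hnbr : IsNeighborly m S)
    (hT : T ⊆ S) (hTc : T.card = m) :
    ∃ (Ψ : (((Fin d → ℝ) × ℝ) ⧸ Submodule.span ℝ (homogenize '' (T : Set (Fin d → ℝ)))) ≃ₗ[ℝ]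
        (Fin (d - m) → ℝ) × ℝ) (φ : (Fin d → ℝ) → (Fin (d - m) → ℝ))
      (w : (Fin d → ℝ) → ℝ), ∀ x ∈ S \ T, 0 < w x ∧
        Ψ (Submodule.Quotient.mk (homogenize x)) = w x • homogenize (φ x) := by
  obtain ⟨a, c, -, haT, haS⟩ := hnbr T hT (card_pos.1 (by omega)) hTc.le
  set W := Submodule.span ℝ (homogenize '' (T : Set (Fin d → ℝ))) with hW
  have hWh : W ≤ LinearMap.ker (-affineForm a c) := by
    rw [hW, Submodule.span_le]
    rintro _ ⟨x, hx, rfl⟩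
    simp [affineForm_homogenize, haT x hx]
  have hfin : Module.finrank ℝ (((Fin d → ℝ) × ℝ) ⧸ W) = (d - m) + 1 := by
    have h1 := W.finrank_quotient_add_finrank
    have h2 : Module.finrank ℝ W = m := by
      have hli := hgen.linearIndepOn hT (by omega)
      have := finrank_span_eq_card (b := fun x : T => homogenize (x : Fin d → ℝ)) hli
      rw [Fintype.card_coe, hTc] at this
      rw [← this, hW, Set.image_eq_range]
      rfl
    rw [h2] at h1
    simp at h1
    omega
  let h : (((Fin d → ℝ) × ℝ) ⧸ W) →ₗ[ℝ] ℝ := W.liftQ (-affineForm a c) hWh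
  have hpos : ∀ x ∈ S \ T, 0 < h (Submodule.Quotient.mk (homogenize x)) := by
    intro x hx
    simpa [h, affineForm_homogenize] using haS x hx
  have hne : h ≠ 0 := by
    obtain ⟨x, hx, hxT⟩ := exists_mem_notMem_of_card_lt_card (s := T) (t := S) (by omega)
    intro h0
    simpa [h0] using hpos x (mem_sdiff.2 ⟨hx, hxT⟩)
  obtain ⟨Ψ, hΨ⟩ := exists_linearEquiv_snd_eq hfin hne
  refine ⟨Ψ, fun x => (h (Submodule.Quotient.mk (homogenize x)))⁻¹ •
    (Ψ (Submodule.Quotient.mk (homogenize x))).1,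
    fun x => h (Submodule.Quotient.mk (homogenize x)), fun x hx => ⟨hpos x hx, ?_⟩⟩
  ext1
  · exact (smul_inv_smul₀ (hpos x hx).ne' _).symm
  · simp [homogenize, hΨ]

theorem card_facetTraces_superset_le {d m k B : ℕ} (hm : 1 ≤ m) (hmd : m < d)
    {S T : Finset (Fin d → ℝ)} (hcard : d < S.card) (hgen : InGeneralLinearPosition S)
    (hnbr : IsNeighborly m S) (hT : T ⊆ S) (hTc : T.card = m)
    (hB : ∀ S' : Finset (Fin (d - m) → ℝ), S'.card = S.card - m →
      InGeneralLinearPosition S' → kFacetCount S' k ≤ B) :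
    ((facetTraces S k).filter fun p => T ⊆ p.1).card ≤ B := by
  classical
  obtain ⟨Ψ, φ, w, hφ⟩ := exists_projection hm hmd hcard hgen hnbr hT hTc
  have hli : ∀ U ⊆ S \ T, U.card ≤ d - m + 1 →
      LinearIndepOn ℝ (homogenize ∘ φ) (U : Set (Fin d → ℝ)) := by
    intro U hU hUc
    have hdisj : Disjoint T U := disjoint_of_subset_right hU disjoint_sdiff
    have h1 := hgen.linearIndepOn (union_subset hT (hU.trans sdiff_subset))
      (by rw [card_union_of_disjoint hdisj]; omega)
    rw [coe_union, linearIndepOn_union_iff_quotient (by simpa using hdisj)] at h1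
    have h2 : LinearIndependent ℝ _ := h1.2.map' Ψ.toLinearMap Ψ.ker
    have h3 := h2.units_smul fun x : (U : Set (Fin d → ℝ)) =>
      (Units.mk0 (w x) (hφ x (hU x.2)).1.ne')⁻¹
    rw [LinearIndepOn]
    convert! h3 using 1
    ext1 x
    have := hφ x (hU x.2)
    simp [this.2, Units.smul_def, smul_smul, this.1.ne']
  have hinj : Set.InjOn φ (S \ T : Finset _) := by
    intro x hx y hy hxy
    by_contra hne
    have h1 := hli {x, y} (by
      intro z hz
      rcases mem_insert.1 hz with rfl | hz
      · exact hx
      · rw [mem_singleton.1 hz]; exact hy) (by rw [card_pair hne]; omega)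
    exact hne (h1.injOn (by simp) (by simp) (by simp [hxy]))
  have hcard' : ((S \ T).image φ).card = S.card - m := by
    rw [card_image_of_injOn hinj, card_sdiff_of_subset hT, hTc]
  have hgen' : InGeneralLinearPosition ((S \ T).image φ) := by
    intro V hV hVc
    obtain ⟨U, hU, rfl⟩ := subset_image_iff.1 hV
    rw [affineIndependent_iff_linearIndepOn_homogenize, coe_image]
    exact (hli U (by exact_mod_cast hU) (by
      rwa [card_image_of_injOn (hinj.mono (by exact_mod_cast hU))] at hVc)).image_of_comp _ _
  refine le_trans ?_ (hB _ hcard' hgen')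
  rw [kFacetCount_eq_card_facetTraces k hgen' (by omega) (by omega)]
  have hsub : ∀ {Δ A : Finset (Fin d → ℝ)}, (Δ, A) ∈ facetTraces S k → T ⊆ Δ → A ⊆ S \ T := by
    intro Δ A h hTΔ x hx
    obtain ⟨-, ⟨hA, -⟩, f, -, hfΔ, hfA⟩ := mem_facetTraces.1 h
    refine mem_sdiff.2 ⟨hA hx, fun hxT => ?_⟩
    exact ((hfA x (hA hx)).1 hx).ne (hfΔ x (hTΔ hxT))
  have himg : ∀ {U V : Finset (Fin d → ℝ)}, U ⊆ S \ T → V ⊆ S \ T →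
      U.image φ = V.image φ → U = V := by
    intro U V hU hV h
    rw [← coe_inj, coe_image, coe_image] at h
    exact coe_injective ((hinj.image_eq_image_iff (by exact_mod_cast hU)
      (by exact_mod_cast hV)).1 h)
  refine card_le_card_of_injOn (fun p => ((p.1 \ T).image φ, p.2.image φ)) ?_ ?_
  · rintro ⟨Δ, A⟩ hp
    obtain ⟨hp, hTΔ⟩ := mem_filter.1 hp
    have hAT := hsub hp hTΔ
    obtain ⟨⟨hΔ, hΔc⟩, ⟨hA, hAc⟩, f, hf, hfΔ, hfA⟩ := mem_facetTraces.1 hp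
    have hΔT : Δ \ T ⊆ S \ T := sdiff_subset_sdiff hΔ le_rfl
    have hker : Submodule.span ℝ (homogenize '' (T : Set (Fin d → ℝ))) ≤ LinearMap.ker f := by
      rw [Submodule.span_le]
      rintro _ ⟨x, hx, rfl⟩
      exact hfΔ x (hTΔ hx)
    let g := (Submodule.liftQ _ f hker) ∘ₗ Ψ.symm.toLinearMap
    have hg : ∀ x ∈ S \ T, f (homogenize x) = w x * g (homogenize (φ x)) := by
      intro x hx
      rw [← smul_eq_mul, ← map_smul, ← (hφ x hx).2]
      simp [g]
    refine mem_coe.2 (mem_facetTraces.2 ⟨⟨image_subset_image hΔT, ?_⟩,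
      ⟨image_subset_image hAT, ?_⟩, g, ?_, ?_, ?_⟩)
    · rw [card_image_of_injOn (hinj.mono (by exact_mod_cast hΔT)), card_sdiff_of_subset hTΔ, hΔc,
        hTc]
    · rw [card_image_of_injOn (hinj.mono (by exact_mod_cast hAT)), hAc]
    · intro h0
      apply hf
      refine LinearMap.ext fun y => ?_
      have := LinearMap.congr_fun h0 (Ψ (Submodule.Quotient.mk y))
      simpa [g] using this
    · intro y hy
      obtain ⟨x, hx, rfl⟩ := mem_image.1 hy
      have := hg x (hΔT hx)
      rw [hfΔ x (mem_sdiff.1 hx).1] at this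
      exact (mul_eq_zero.1 this.symm).resolve_left (hφ x (hΔT hx)).1.ne'
    · intro y hy
      obtain ⟨x, hx, rfl⟩ := mem_image.1 hy
      have h1 : φ x ∈ A.image φ ↔ x ∈ A := by
        refine ⟨fun h => ?_, mem_image_of_mem φ⟩
        obtain ⟨z, hz, hzx⟩ := mem_image.1 h
        rwa [← hinj (hAT hz) hx hzx]
      rw [h1, hfA x (mem_sdiff.1 hx).1, hg x hx, mul_neg_iff]
      simp [(hφ x hx).1, (hφ x hx).1.not_gt]
  · rintro ⟨Δ, A⟩ hp ⟨Δ', A'⟩ hp' h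
    obtain ⟨hp, hTΔ⟩ := mem_filter.1 hp
    obtain ⟨hp', hTΔ'⟩ := mem_filter.1 hp'
    simp only [Prod.mk.injEq] at h hTΔ hTΔ' ⊢
    have hS := (mem_facetTraces.1 hp).1.1
    have hS' := (mem_facetTraces.1 hp').1.1
    have h1 := himg (sdiff_subset_sdiff hS le_rfl) (sdiff_subset_sdiff hS' le_rfl) h.1
    exact ⟨by rw [← sdiff_union_of_subset hTΔ, h1, sdiff_union_of_subset hTΔ'],
      himg (hsub hp hTΔ) (hsub hp' hTΔ') h.2⟩

end

/-- Improved `k`-facet bound for `m`-neighborly point sets: if `S` is a set of `n > d`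
points in general linear position in `ℝ^d` which is `m`-neighborly (`1 ≤ m < d`), and
every set of `n-m` points in general linear position in `ℝ^{d-m}` has at most `B`
`k`-facets, then `C(d,m) · e_k(S) ≤ C(n,m) · B`. -/
theorem neighborly_kfacet_bound (d m n k B : ℕ) (hm : 1 ≤ m) (hmd : m < d) (hnd : d < n)
    (S : Finset (Fin d → ℝ)) (hcard : S.card = n)
    (hgen : InGeneralLinearPosition S)
    (hnbr : IsNeighborly m S)
    (hB : ∀ S' : Finset (Fin (d - m) → ℝ), S'.card = n - m →
      InGeneralLinearPosition S' → kFacetCount S' k ≤ B) :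
    d.choose m * kFacetCount S k ≤ n.choose m * B := by
  classical
  subst hcard
  rw [kFacetCount_eq_card_facetTraces k hgen (by omega) hnd]
  calc d.choose m * (facetTraces S k).card
      = ∑ p ∈ facetTraces S k, ((S.powersetCard m).filter fun T => T ⊆ p.1).card := by
        rw [mul_comm, ← smul_eq_mul, ← Finset.sum_const]
        refine Finset.sum_congr rfl ?_
        rintro ⟨Δ, A⟩ hp
        obtain ⟨⟨hΔ, hΔc⟩, -⟩ := mem_facetTraces.1 hp
        rw [show d.choose m = (Δ.powersetCard m).card by rw [Finset.card_powersetCard, hΔc]]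
        congr 1
        ext T
        simp only [Finset.mem_filter, Finset.mem_powersetCard]
        exact ⟨fun h => ⟨⟨h.1.trans hΔ, h.2⟩, h.1⟩, fun h => ⟨h.2, h.1.2⟩⟩
    _ = ∑ T ∈ S.powersetCard m, ((facetTraces S k).filter fun p => T ⊆ p.1).card := by
        simp only [Finset.card_filter]
        exact Finset.sum_comm
    _ ≤ ∑ _T ∈ S.powersetCard m, B := by
        refine Finset.sum_le_sum fun T hT => ?_
        obtain ⟨hTS, hTc⟩ := Finset.mem_powersetCard.1 hT
        exact card_facetTraces_superset_le hm hmd hnd hgen hnbr hTS hTc hB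
    _ = S.card.choose m * B := by rw [Finset.sum_const, Finset.card_powersetCard, smul_eq_mul]
end

section
/- For all integers d ≥ 1 and k ≥ 1, the map φ : ℝ^d → ℝ^{2k+d−1} defined by φ(x₁, x₂, …, x_d) = (x₁, x₁², x₁³, …, x₁^{2k}, x₂, …, x_d) is a generally k-neighborly embedding. That is: (i) φ is a topological embedding (a homeomorphism onto its image); and (ii) for every n ≥ 1, the set of n-tuples (p₁, …, p_n) ∈ (ℝ^d)^n for which the set {φ(p₁), …, φ(p_n)} is k-neighborly contains a subset that is open and dense in (ℝ^d)^n. -/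
/-- The map `φ : ℝ^d → ℝ^{2k+d-1}`,
`φ(x₁, …, x_d) = (x₁, x₁², …, x₁^{2k}, x₂, …, x_d)`. -/
noncomputable def phiMap (d k : ℕ) (hd : 1 ≤ d) (x : Fin d → ℝ) :
    Fin (2 * k + d - 1) → ℝ :=
  fun j =>
    if h : (j : ℕ) < 2 * k then x ⟨0, hd⟩ ^ ((j : ℕ) + 1)
    else x ⟨(j : ℕ) - 2 * k + 1, by have := j.isLt; omega⟩

/-- A set `X ⊆ ℝ^N` is `k`-neighborly if every finite nonempty subset `T ⊆ X` with at
most `k` elements spans a face of `conv X` with vertex set exactly `T`. -/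
def IsKNeighborly {N : ℕ} (k : ℕ) (X : Set (Fin N → ℝ)) : Prop :=
  ∀ T ⊆ X, T.Nonempty → T.Finite → T.ncard ≤ k →
    ∃ (a : Fin N → ℝ) (c : ℝ), a ≠ 0 ∧
      (∀ x ∈ T, ∑ i, a i * x i = c) ∧
      (∀ x ∈ X \ T, ∑ i, a i * x i < c)

open Polynomial in
/-- A polynomial of degree at most `2k`, evaluated at the first coordinate of `x`, is an affine
functional of `phiMap d k hd x`. -/
lemma sum_coeff_mul_phiMap {d k : ℕ} (hd : 1 ≤ d) (P : ℝ[X]) (hP : P.natDegree ≤ 2 * k)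
    (x : Fin d → ℝ) :
    ∑ i : Fin (2 * k + d - 1),
        (if (i : ℕ) < 2 * k then -P.coeff ((i : ℕ) + 1) else 0) * phiMap d k hd x i =
      P.coeff 0 - P.eval (x ⟨0, hd⟩) := by
  let f : ℕ → ℝ := fun m => if m < 2 * k then -(P.coeff (m + 1) * x ⟨0, hd⟩ ^ (m + 1)) else 0
  have hterm : ∀ i : Fin (2 * k + d - 1),
      (if (i : ℕ) < 2 * k then -P.coeff ((i : ℕ) + 1) else 0) * phiMap d k hd x i = f i := by
    intro i
    by_cases h : (i : ℕ) < 2 * k <;> simp [f, phiMap, h]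
  have hrange : ∑ m ∈ Finset.range (2 * k + d - 1), f m =
      ∑ m ∈ Finset.range (2 * k), -(P.coeff (m + 1) * x ⟨0, hd⟩ ^ (m + 1)) := by
    simp only [f]
    rw [← Finset.sum_filter]
    congr 1
    ext m
    simp only [Finset.mem_filter, Finset.mem_range]
    omega
  rw [Finset.sum_congr rfl fun i _ => hterm i, Fin.sum_univ_eq_sum_range f, hrange,
    P.eval_eq_sum_range' (Nat.lt_succ_of_le hP), Finset.sum_range_succ', Finset.sum_neg_distrib]
  simp

lemma isEmbedding_phiMap {d k : ℕ} (hd : 1 ≤ d) (hk : 1 ≤ k) :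
    Topology.IsEmbedding (phiMap d k hd) := by
  let g : (Fin (2 * k + d - 1) → ℝ) → Fin d → ℝ := fun y i =>
    if (i : ℕ) = 0 then y ⟨0, by omega⟩ else y ⟨2 * k + i - 1, by omega⟩
  have hg : Continuous g := by
    refine continuous_pi fun i => ?_
    by_cases h : (i : ℕ) = 0 <;> simp only [g, h, if_true, if_false] <;> fun_prop
  have hφ : Continuous (phiMap d k hd) := by
    refine continuous_pi fun j => ?_
    by_cases h : (j : ℕ) < 2 * k <;> simp only [phiMap, h, dite_true, dite_false] <;> fun_prop
  refine Function.LeftInverse.isEmbedding (f := g) (fun x => ?_) hg hφ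
  ext i
  by_cases h : (i : ℕ) = 0
  · have hi : i = ⟨0, hd⟩ := Fin.ext h
    have hk0 : 0 < k := hk
    simp [g, phiMap, hi, hk0]
  · have h' : ¬ 2 * k + (i : ℕ) - 1 < 2 * k := by omega
    simp only [g, phiMap, h, h', if_false, dite_false]
    congr 1
    ext
    simp only
    omega

open Polynomial in
lemma isKNeighborly_range_phiMap {d k : ℕ} (hd : 1 ≤ d) (hk : 1 ≤ k) {ι : Type*}
    (p : ι → Fin d → ℝ) (hp : Function.Injective fun i => p i ⟨0, hd⟩) :
    IsKNeighborly k (Set.range fun i => phiMap d k hd (p i)) := by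
  intro T hT hne hfin hcard
  have hφ0 : ∀ x, phiMap d k hd x ⟨0, by omega⟩ = x ⟨0, hd⟩ := by
    intro x
    have hk0 : 0 < k := hk
    simp [phiMap, hk0]
  let Q : ℝ[X] := ∏ y ∈ hfin.toFinset, (X - C (y ⟨0, by omega⟩))
  have hQ : Q.Monic := monic_prod_X_sub_C _ _
  have hQdeg : Q.natDegree = T.ncard := by
    rw [natDegree_finsetProd_X_sub_C_eq_card, Set.ncard_eq_toFinset_card T hfin]
  have hdeg : (Q ^ 2).natDegree = 2 * T.ncard := by rw [hQ.natDegree_pow, hQdeg]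
  have hpos : 0 < T.ncard := (Set.ncard_pos hfin).2 hne
  have hsum := sum_coeff_mul_phiMap (k := k) hd (Q ^ 2) (by omega)
  refine ⟨fun i => if (i : ℕ) < 2 * k then -(Q ^ 2).coeff ((i : ℕ) + 1) else 0,
    (Q ^ 2).coeff 0, fun h => ?_, fun x hx => ?_, fun x hx => ?_⟩
  · have h1 := congrFun h ⟨2 * T.ncard - 1, by omega⟩
    have hlt : 2 * T.ncard - 1 < 2 * k := by omega
    have hlead : (Q ^ 2).coeff (2 * T.ncard - 1 + 1) = 1 := by
      rw [Nat.sub_add_cancel (by omega), ← hdeg]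
      exact hQ.pow 2
    simp [hlt, hlead] at h1
  · obtain ⟨i, rfl⟩ := hT hx
    have hroot : Q.eval (p i ⟨0, hd⟩) = 0 := by
      rw [eval_prod]
      exact Finset.prod_eq_zero (hfin.mem_toFinset.2 hx) (by simp [hφ0])
    rw [hsum, eval_pow, hroot]
    simp
  · obtain ⟨⟨i, rfl⟩, hxT⟩ := hx
    have hroot : Q.eval (p i ⟨0, hd⟩) ≠ 0 := by
      rw [eval_prod]
      refine Finset.prod_ne_zero_iff.2 fun y hy => ?_
      rw [hfin.mem_toFinset] at hy
      obtain ⟨j, rfl⟩ := hT hy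
      simp only [eval_sub, eval_X, eval_C, hφ0, sub_ne_zero]
      intro hij
      exact hxT (hp hij ▸ hy)
    rw [hsum, eval_pow]
    exact sub_lt_self _ (by positivity)

lemma dense_setOf_coord_ne {ι κ : Type*} [Finite ι] [Finite κ] {i j : ι} (hij : i ≠ j) (c : κ) :
    Dense {p : ι → κ → ℝ | p i c ≠ p j c} := by
  classical
  let L : (ι → κ → ℝ) →ₗ[ℝ] ℝ :=
    { toFun := fun p => p i c - p j c
      map_add' := fun p q => by simp only [Pi.add_apply]; ring
      map_smul' := fun r p => by simp only [Pi.smul_apply, smul_eq_mul, RingHom.id_apply]; ring }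
  have hset : {p : ι → κ → ℝ | p i c ≠ p j c} = (LinearMap.ker L : Set (ι → κ → ℝ))ᶜ := by
    ext p
    simp [L, sub_eq_zero]
  rw [hset, ← interior_eq_empty_iff_dense_compl, ← Set.not_nonempty_iff_eq_empty]
  intro h
  have htop := (LinearMap.ker L).eq_top_of_nonempty_interior' h
  have hmem : Pi.single i (fun _ => 1) ∈ LinearMap.ker L := htop ▸ Submodule.mem_top
  simp [L, hij.symm] at hmem

/-- The map `φ(x₁, …, x_d) = (x₁, x₁², …, x₁^{2k}, x₂, …, x_d)` is a generally
`k`-neighborly embedding of `ℝ^d` into `ℝ^{2k+d-1}`: it is a topological embedding, and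
for every `n ≥ 1` the set of `n`-tuples of points of `ℝ^d` whose image under `φ` is a
`k`-neighborly set contains an open dense subset of `(ℝ^d)^n`. -/
theorem phi_generally_neighborly (d k : ℕ) (hd : 1 ≤ d) (hk : 1 ≤ k) :
    Topology.IsEmbedding (phiMap d k hd) ∧
    ∀ n : ℕ, 1 ≤ n →
      ∃ U : Set (Fin n → Fin d → ℝ), IsOpen U ∧ Dense U ∧
        ∀ p ∈ U, IsKNeighborly k (Set.range fun i => phiMap d k hd (p i)) := by
  refine ⟨isEmbedding_phiMap hd hk, fun n _ => ?_⟩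
  let V : {q : Fin n × Fin n // q.1 ≠ q.2} → Set (Fin n → Fin d → ℝ) :=
    fun q => {p | p q.1.1 ⟨0, hd⟩ ≠ p q.1.2 ⟨0, hd⟩}
  have hV : ∀ q, IsOpen (V q) := fun q => isOpen_ne_fun (by fun_prop) (by fun_prop)
  refine ⟨⋂ q, V q, isOpen_iInter_of_finite hV,
    dense_iInter_of_isOpen hV fun q => dense_setOf_coord_ne q.2 _, fun p hp => ?_⟩
  refine isKNeighborly_range_phiMap hd hk p fun i j hij => ?_
  by_contra hne
  exact Set.mem_iInter.1 hp ⟨(i, j), hne⟩ hij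
end
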